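/- Suppose the central arrangement A defined by l_1,…,l_p is free, i.e. D(A) is a free R-module. Then every b in the Bernstein ideal B(A) is divisible in ℂ[s_1,…,s_p] by the polynomial b_de(s_1,…,s_p) = ∏_{X ∈ L'(A)} ∏_{j=0}^{2(card J(X) − r(X))} ( (∑_{i ∈ J(X)} s_i) + r(X) + j ). -/

import Mathlib

open MvPolynomial

namespace Arrangement

variable {n : ℕ} {ι : Type} [Fintype ι]

/-- The module `D(A)` of logarithmic derivations of the arrangement defined by
the forms `l i`. -/
noncomputable def DA (l : ι → MvPolynomial (Fin n) ℂ) :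
    Submodule (MvPolynomial (Fin n) ℂ)
      (Derivation ℂ (MvPolynomial (Fin n) ℂ) (MvPolynomial (Fin n) ℂ)) where
  carrier := {χ | ∀ i, χ (l i) ∈ Ideal.span {l i}}
  add_mem' := fun hx hy i => by
    simpa using add_mem (hx i) (hy i)
  zero_mem' := fun i => by simp
  smul_mem' := fun r χ hχ i => by
    simpa using Ideal.mul_mem_left _ r (hχ i)

open Classical in
/-- The property characterizing the family of twisted derivatives
`D i = ∂/∂xᵢ + ∑ⱼ sⱼ (∂lⱼ/∂xᵢ)/lⱼ` acting on the localization
`M = ℂ[x,s,1/F]·l^s`. -/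
def IsTwisted (l : ι → MvPolynomial (Fin n) ℂ)
    (D : Fin n → Module.End ℂ
      (Localization.Away (rename Sum.inl (∏ i, l i) : MvPolynomial (Fin n ⊕ ι) ℂ))) : Prop :=
  (∀ (i : Fin n) (r : MvPolynomial (Fin n ⊕ ι) ℂ)
      (m : Localization.Away (rename Sum.inl (∏ i, l i) : MvPolynomial (Fin n ⊕ ι) ℂ)),
      D i (algebraMap _ _ r * m)
        = algebraMap _ _ (pderiv (Sum.inl i) r) * m + algebraMap _ _ r * D i m) ∧
  (∀ i : Fin n,
      algebraMap (MvPolynomial (Fin n ⊕ ι) ℂ) _ (rename Sum.inl (∏ j, l j)) * D i 1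
        = algebraMap _ _ (∑ j, X (Sum.inr j) *
            rename Sum.inl (pderiv i (l j) * ∏ k ∈ Finset.univ.erase j, l k)))

/-- The algebra `W` of operators on `M`, image of the Weyl algebra
`Aₙ(ℂ)[s₁,…,s_p]` acting on `ℂ[x,s,1/F]·l^s`. -/
noncomputable def Wa (l : ι → MvPolynomial (Fin n) ℂ)
    (D : Fin n → Module.End ℂ
      (Localization.Away (rename Sum.inl (∏ i, l i) : MvPolynomial (Fin n ⊕ ι) ℂ))) :
    Subalgebra ℂ (Module.End ℂ
      (Localization.Away (rename Sum.inl (∏ i, l i) : MvPolynomial (Fin n ⊕ ι) ℂ))) :=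
  Algebra.adjoin ℂ
    ((Set.range fun i : Fin n =>
        LinearMap.mulLeft ℂ (algebraMap _ _ (X (Sum.inl i) : MvPolynomial (Fin n ⊕ ι) ℂ))) ∪
     (Set.range fun j : ι =>
        LinearMap.mulLeft ℂ (algebraMap _ _ (X (Sum.inr j) : MvPolynomial (Fin n ⊕ ι) ℂ))) ∪
     Set.range D)

/-- The Bernstein ideal `B(A)`, as the set of polynomials `b(s₁,…,s_p)` such that
`b · l^s = P · l^{s+1}` for some operator `P` in the Weyl algebra. -/
noncomputable def Bideal (l : ι → MvPolynomial (Fin n) ℂ)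
    (D : Fin n → Module.End ℂ
      (Localization.Away (rename Sum.inl (∏ i, l i) : MvPolynomial (Fin n ⊕ ι) ℂ))) :
    Set (MvPolynomial ι ℂ) :=
  {b | ∃ P ∈ Wa l D,
    algebraMap (MvPolynomial (Fin n ⊕ ι) ℂ) _ ((rename Sum.inr b : MvPolynomial (Fin n ⊕ ι) ℂ))
      = P (algebraMap _ _ (rename Sum.inl (∏ i, l i) : MvPolynomial (Fin n ⊕ ι) ℂ))}

/-- The linear functional on `ℂⁿ` associated to a linear form. -/
noncomputable def toLin (f : MvPolynomial (Fin n) ℂ) : (Fin n → ℂ) →ₗ[ℂ] ℂ :=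
  ∑ i, f.coeff (Finsupp.single i 1) • LinearMap.proj i

/-- The hyperplane `ker lᵢ ⊆ ℂⁿ`. -/
noncomputable def hyp (l : ι → MvPolynomial (Fin n) ℂ) (i : ι) : Submodule ℂ (Fin n → ℂ) :=
  LinearMap.ker (toLin (l i))

open Classical in
/-- The intersection lattice `L(A)`: all intersections of nonempty subfamilies. -/
noncomputable def LA (l : ι → MvPolynomial (Fin n) ℂ) : Finset (Submodule ℂ (Fin n → ℂ)) :=
  (Finset.univ.powerset.filter Finset.Nonempty).image fun I : Finset ι => ⨅ i ∈ I, hyp l i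

open Classical in
/-- `J(X) = {i : X ⊆ ker lᵢ}`. -/
noncomputable def JX (l : ι → MvPolynomial (Fin n) ℂ) (Y : Submodule ℂ (Fin n → ℂ)) :
    Finset ι :=
  Finset.univ.filter fun i => Y ≤ hyp l i

/-- `r(X) = n - dim X`, the codimension. -/
noncomputable def rX (Y : Submodule ℂ (Fin n → ℂ)) : ℕ :=
  n - Module.finrank ℂ Y

/-- Irreducibility of the subarrangement with hyperplanes indexed by `J`. -/
def IrredOn (l : ι → MvPolynomial (Fin n) ℂ) (J : Finset ι) : Prop :=
  ¬ ∃ V₁ V₂ : Submodule ℂ (Fin n → ℂ), IsCompl V₁ V₂ ∧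
      (∀ i ∈ J, V₁ ≤ hyp l i ∨ V₂ ≤ hyp l i) ∧
      (∃ i ∈ J, V₁ ≤ hyp l i) ∧ (∃ i ∈ J, V₂ ≤ hyp l i)

open Classical in
/-- `L'(A) = {X ∈ L(A) : A_X irreducible}`. -/
noncomputable def Lprime (l : ι → MvPolynomial (Fin n) ℂ) :
    Finset (Submodule ℂ (Fin n → ℂ)) :=
  (LA l).filter fun Y => IrredOn l (JX l Y)

/-- The polynomial
`b_A = ∏_{X ∈ L'(A)} ∏_{j=0}^{2(card J(X) − r(X))} ((∑_{i ∈ J(X)} sᵢ) + r(X) + j)`. -/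
noncomputable def bGen (l : ι → MvPolynomial (Fin n) ℂ) : MvPolynomial ι ℂ :=
  ∏ Y ∈ Lprime l, ∏ j ∈ Finset.range (2 * ((JX l Y).card - rX (n := n) Y) + 1),
    ((∑ i ∈ JX l Y, X i) + C ((rX (n := n) Y : ℂ) + (j : ℂ)))

end Arrangement

section

open RingTheory.Sequence IsLocalRing
open scoped Pointwise

universe u

theorem le_ringKrullDim_quotient_of_isAssociatedPrime {R : Type*} [CommRing R] [IsLocalRing R]
    [IsNoetherianRing R] (rs : List R) : ∀ {M : Type*} [AddCommGroup M] [Module R M]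
    [Module.Finite R M], (∀ r ∈ rs, r ∈ maximalIdeal R) → IsRegular M rs →
    ∀ P : Ideal R, IsAssociatedPrime P M → (rs.length : WithBot ℕ∞) ≤ ringKrullDim (R ⧸ P) := by
  induction rs with
  | nil =>
    intro M _ _ _ _ _ P hP
    have := hP.isPrime
    simpa using ringKrullDim_nonneg_of_nontrivial (R := R ⧸ P)
  | cons x xs ih =>
    intro M _ _ _ hmem hreg P hP
    have hPp := hP.isPrime
    rw [isRegular_cons_iff] at hreg
    obtain ⟨hx, hxs⟩ := hreg
    rw [isAssociatedPrime_iff] at hP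
    obtain ⟨-, m, hm⟩ := hP
    have hxm : x ∈ maximalIdeal R := hmem x (by simp)
    have hmP : ∀ a, a ∈ P ↔ a • m = 0 := by
      intro a; rw [hm, Submodule.mem_colon_singleton]; simp
    have hm0 : m ≠ 0 := by
      intro h
      exact hPp.ne_top ((Ideal.eq_top_iff_one _).2 ((hmP 1).2 (by simp [h])))
    let U : Submodule R M :=
      { carrier := {z | ∀ a ∈ P, a • z = 0}
        add_mem' := fun {y z} hy hz a ha => by rw [smul_add, hy a ha, hz a ha, add_zero]
        zero_mem' := fun a _ => smul_zero a
        smul_mem' := fun c z hz a ha => by rw [smul_comm, hz a ha, smul_zero] }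
    have hmU : m ∈ U := fun a ha => (hmP a).1 ha
    have hU : ¬ U ≤ x • (⊤ : Submodule R M) := by
      intro hle
      have hU0 : U = ⊥ := by
        apply Submodule.eq_bot_of_le_smul_of_le_jacobson_bot (Ideal.span {x}) U
          (IsNoetherian.noetherian U)
        · intro z hz
          obtain ⟨y, -, rfl⟩ := (Submodule.mem_smul_pointwise_iff_exists _ _ _).1 (hle hz)
          refine Submodule.smul_mem_smul (Ideal.mem_span_singleton_self x) fun a ha => ?_
          have := hz a ha
          rw [smul_comm] at this
          exact hx (by simpa using this)
        · rw [IsLocalRing.jacobson_eq_maximalIdeal _ bot_ne_top]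
          simpa [Ideal.span_le] using hxm
      rw [hU0] at hmU
      exact hm0 (by simpa using hmU)
    obtain ⟨z, hzU, hz⟩ := SetLike.not_le_iff_exists.1 hU
    have hz0 : (Submodule.Quotient.mk z : QuotSMulTop x M) ≠ 0 := by
      rwa [Ne, Submodule.Quotient.mk_eq_zero]
    obtain ⟨Q, hQ, hle⟩ := exists_le_isAssociatedPrime_of_isNoetherianRing R _ hz0
    have hQp := hQ.isPrime
    have hPQ : P ≤ Q := fun a ha => hle <| by
      rw [Submodule.mem_colon_singleton, ← Submodule.Quotient.mk_smul, hzU a ha]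
      simp
    have hxQ : x ∈ Q := hle <| by
      rw [Submodule.mem_colon_singleton, ← Submodule.Quotient.mk_smul, Submodule.mem_bot,
        Submodule.Quotient.mk_eq_zero]
      exact Submodule.smul_mem_pointwise_smul z x ⊤ trivial
    have hxP : x ∉ P := fun h => hm0 (hx (by simpa using (hmP x).1 h))
    have h1 := ih (M := QuotSMulTop x M) (fun r hr => hmem r (by simp [hr])) hxs Q hQ
    have h2 : ringKrullDim ((R ⧸ P) ⧸ Ideal.span {Ideal.Quotient.mk P x}) + 1
        ≤ ringKrullDim (R ⧸ P) := by
      apply ringKrullDim_quotient_succ_le_of_nonZeroDivisor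
      rw [mem_nonZeroDivisors_iff_ne_zero, Ne, Ideal.Quotient.eq_zero_iff_mem]
      exact hxP
    have h3 : ringKrullDim (R ⧸ Q) ≤ ringKrullDim ((R ⧸ P) ⧸ Ideal.span {Ideal.Quotient.mk P x}) := by
      refine ringKrullDim_le_of_surjective
        (Ideal.Quotient.lift _ (Ideal.Quotient.factor hPQ) ?_) ?_
      · intro a ha
        rw [← RingHom.mem_ker]
        revert a
        show Ideal.span _ ≤ _
        rw [Ideal.span_le]
        simpa [RingHom.mem_ker, Ideal.Quotient.eq_zero_iff_mem] using hxQ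
      · intro y
        obtain ⟨y, rfl⟩ := Ideal.Quotient.mk_surjective y
        exact ⟨Ideal.Quotient.mk _ (Ideal.Quotient.mk _ y), by simp⟩
    calc ((x :: xs).length : WithBot ℕ∞) = (xs.length : WithBot ℕ∞) + 1 := by simp
      _ ≤ _ := le_trans (add_le_add_left (h1.trans h3) 1) h2

open CategoryTheory Abelian in
theorem exists_isRegular_quotSMulTop {R : Type u} [CommRing R] [IsLocalRing R]
    [IsNoetherianRing R] {M : Type u} [AddCommGroup M] [Module R M] [Module.Finite R M]
    (rs : List R) (hmem : ∀ r ∈ rs, r ∈ maximalIdeal R) (hreg : IsRegular M rs)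
    {g : R} (hg : g ∈ maximalIdeal R) (hgM : IsSMulRegular M g) :
    ∃ rs' : List R, rs'.length = rs.length - 1 ∧ (∀ r ∈ rs', r ∈ maximalIdeal R) ∧
      IsRegular (QuotSMulTop g M) rs' := by
  have hnt : Nontrivial M := hreg.nontrivial
  have hlt : ∀ (N : Type u) [AddCommGroup N] [Module R N] [Module.Finite R N] [Nontrivial N],
      maximalIdeal R • (⊤ : Submodule R N) < ⊤ := by
    intro N _ _ _ _
    refine lt_top_iff_ne_top.2 fun h => ?_
    exact Submodule.top_ne_ideal_smul_of_le_jacobson_annihilator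
      (IsLocalRing.maximalIdeal_le_jacobson _) h.symm
  have tfae := ModuleCat.exists_isRegular_tfae (maximalIdeal R) rs.length (ModuleCat.of R M)
    (hlt M)
  have h13 := tfae.out 1 3
  have h1 := h13.2 ⟨rs, rfl, hmem, hreg⟩
  have hntq : Nontrivial (QuotSMulTop g M) :=
    nontrivial_quotSMulTop_of_mem_maximalIdeal M hg
  have tfae' := ModuleCat.exists_isRegular_tfae (maximalIdeal R) (rs.length - 1)
    (ModuleCat.of R (QuotSMulTop g M)) (hlt (QuotSMulTop g M))
  have h13' := tfae'.out 1 3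
  refine h13'.1 ?_
  intro i hi
  have zero1 := AddCommGrpCat.isZero_of_iff_subsingleton.mpr (h1 i (by omega))
  have zero2 := AddCommGrpCat.isZero_of_iff_subsingleton.mpr (h1 (i + 1) (by omega))
  exact AddCommGrpCat.subsingleton_of_isZero <| ShortComplex.Exact.isZero_of_both_zeros
    ((Ext.covariant_sequence_exact₃' _
      (IsSMulRegular.smulShortComplex_shortExact (M := ModuleCat.of R M) hgM)) i (i + 1) rfl)
    (zero1.eq_zero_of_src _) (zero2.eq_zero_of_tgt _)

theorem isWeaklyRegular_of_maximalIdeal_le_radical {R : Type u} [CommRing R] [IsLocalRing R]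
    [IsNoetherianRing R] (gs : List R) : ∀ {M : Type u} [AddCommGroup M] [Module R M]
    [Module.Finite R M] (rs : List R), (∀ r ∈ rs, r ∈ maximalIdeal R) → IsRegular M rs →
    gs.length = rs.length → (∀ g ∈ gs, g ∈ maximalIdeal R) →
    maximalIdeal R ≤ (Ideal.ofList gs ⊔ Module.annihilator R M).radical →
    IsWeaklyRegular M gs := by
  induction gs with
  | nil => intros; exact IsWeaklyRegular.nil R _
  | cons g gs ih =>
    intro M _ _ _ rs hrs hreg hlen hgs hrad
    have hgm : g ∈ maximalIdeal R := hgs g (by simp)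
    have hgM : IsSMulRegular M g := by
      rw [isSMulRegular_iff_right_eq_zero_of_smul]
      intro m hm
      by_contra hm0
      obtain ⟨P, hP, hle⟩ := exists_le_isAssociatedPrime_of_isNoetherianRing R m hm0
      have hPp := hP.isPrime
      have hgP : g ∈ P := hle (by rw [Submodule.mem_colon_singleton, hm]; simp)
      have h1 := le_ringKrullDim_quotient_of_isAssociatedPrime rs hrs hreg P hP
      have hAnn : Module.annihilator R M ≤ P := by
        have := hP.annihilator_le
        rwa [Submodule.annihilator_top] at this
      have hloc : IsLocalRing (R ⧸ P) :=
        IsLocalRing.of_surjective' (Ideal.Quotient.mk P) Ideal.Quotient.mk_surjective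
      set s : Set (R ⧸ P) := Ideal.Quotient.mk P '' {x | x ∈ gs} with hs
      have h2 := ringKrullDim_le_ringKrullDim_quotient_add_encard s (by
        rw [IsLocalRing.ringJacobson_eq_maximalIdeal]
        rintro _ ⟨x, hx, rfl⟩
        rw [SetLike.mem_coe, IsLocalRing.mem_maximalIdeal, mem_nonunits_iff]
        intro hu
        obtain ⟨y, hy⟩ := hu.exists_right_inv
        obtain ⟨y, rfl⟩ := Ideal.Quotient.mk_surjective y
        rw [← map_mul, ← map_one (Ideal.Quotient.mk P), Ideal.Quotient.eq] at hy
        have hxm := hgs x (List.mem_cons_of_mem g hx)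
        have := sub_mem (Ideal.mul_mem_right y _ hxm) (IsLocalRing.le_maximalIdeal hPp.ne_top hy)
        rw [sub_sub_cancel] at this
        exact (IsLocalRing.maximalIdeal.isMaximal R).ne_top ((Ideal.eq_top_iff_one _).2 this))
      have h3 : ringKrullDim ((R ⧸ P) ⧸ Ideal.span s) ≤ 0 := by
        have : Ring.KrullDimLE 0 ((R ⧸ P) ⧸ Ideal.span s) := by
          refine Ring.krullDimLE_zero_iff.2 fun J hJ => ?_
          set f : R →+* (R ⧸ P) ⧸ Ideal.span s :=
            (Ideal.Quotient.mk (Ideal.span s)).comp (Ideal.Quotient.mk P)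
          have hf : Function.Surjective f :=
            Ideal.Quotient.mk_surjective.comp Ideal.Quotient.mk_surjective
          have hPf : P ≤ J.comap f := fun a ha => by
            rw [Ideal.mem_comap]
            simp [f, Ideal.Quotient.eq_zero_iff_mem.2 ha]
          have hQ : (J.comap f).IsPrime := Ideal.comap_isPrime f J
          have hmQ : maximalIdeal R ≤ J.comap f := by
            refine hrad.trans (hQ.radical_le_iff.2 (sup_le ?_ (hAnn.trans hPf)))
            rw [Ideal.ofList, Ideal.span_le]
            intro x hx
            rcases List.mem_cons.1 hx with rfl | hx
            · exact hPf hgP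
            · have : f x = 0 := Ideal.Quotient.eq_zero_iff_mem.2
                (Ideal.subset_span ⟨x, hx, rfl⟩)
              simp [this]
          have hmax : (J.comap f).IsMaximal := by
            rw [← (IsLocalRing.maximalIdeal.isMaximal R).eq_of_le hQ.ne_top hmQ]
            exact IsLocalRing.maximalIdeal.isMaximal R
          have := Ideal.map_eq_top_or_isMaximal_of_surjective f hf hmax
          rw [Ideal.map_comap_of_surjective f hf] at this
          exact this.resolve_left hJ.ne_top
        exact_mod_cast (Ring.krullDimLE_iff).1 this
      have h4 : s.encard ≤ gs.length := by
        classical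
        refine (Set.encard_image_le _ _).trans ?_
        have : {x | x ∈ gs} = (gs.toFinset : Set R) := by ext; simp
        rw [this, Set.encard_coe_eq_coe_finsetCard]
        exact_mod_cast List.toFinset_card_le gs
      have h5 : ((rs.length : ℕ) : WithBot ℕ∞) ≤ ((gs.length : ℕ) : WithBot ℕ∞) := by
        refine h1.trans (h2.trans ?_)
        calc _ ≤ (0 : WithBot ℕ∞) + ((gs.length : ℕ∞) : WithBot ℕ∞) :=
              add_le_add h3 (by exact_mod_cast h4)
          _ = _ := by simp
      have h6 : rs.length ≤ gs.length := by exact_mod_cast h5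
      simp at hlen
      omega
    rw [isWeaklyRegular_cons_iff]
    refine ⟨hgM, ?_⟩
    obtain ⟨rs', hl', hm', hr'⟩ := exists_isRegular_quotSMulTop rs hrs hreg hgm hgM
    refine ih rs' hm' hr' ?_ (fun x hx => hgs x (by simp [hx])) ?_
    · rw [hl', ← hlen]; simp
    · refine hrad.trans (Ideal.radical_mono (sup_le ?_ ?_))
      · rw [Ideal.ofList_cons]
        refine sup_le ?_ le_sup_left
        rw [Ideal.span_singleton_le_iff_mem]
        refine Ideal.mem_sup_right (Module.mem_annihilator.2 fun m => ?_)
        obtain ⟨m, rfl⟩ := Submodule.Quotient.mk_surjective _ m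
        rw [← Submodule.Quotient.mk_smul, Submodule.Quotient.mk_eq_zero]
        exact Submodule.smul_mem_pointwise_smul m g ⊤ trivial
      · refine le_trans ?_ le_sup_right
        intro a ha
        rw [Module.mem_annihilator] at ha ⊢
        intro m
        obtain ⟨m, rfl⟩ := Submodule.Quotient.mk_surjective _ m
        rw [← Submodule.Quotient.mk_smul, ha, Submodule.Quotient.mk_zero]

end

section

open RingTheory.Sequence IsLocalRing MvPolynomial

theorem isWeaklyRegular_iff_forall_mul_mem {R : Type*} [CommRing R] (rs : List R) :
    IsWeaklyRegular R rs ↔ ∀ (i : ℕ) (h : i < rs.length) (c : R),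
      rs[i] * c ∈ Ideal.ofList (rs.take i) → c ∈ Ideal.ofList (rs.take i) := by
  rw [isWeaklyRegular_iff_Fin]
  constructor
  · intro H i h c hc
    have := (isSMulRegular_quotient_iff_mem_of_smul_mem _ _).1 (H ⟨i, h⟩) c
    simp only [smul_eq_mul, Ideal.mul_top] at this
    exact this hc
  · intro H i
    rw [isSMulRegular_quotient_iff_mem_of_smul_mem]
    simp only [smul_eq_mul, Ideal.mul_top]
    exact H i i.2

theorem isWeaklyRegular_map_X {σ : Type*} {R : Type*} [CommRing R] (L : List σ) (hL : L.Nodup) :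
    IsWeaklyRegular (MvPolynomial σ R) (L.map (X (R := R))) := by
  classical
  rw [isWeaklyRegular_iff_forall_mul_mem]
  intro i h c hc
  have hI : Ideal.ofList ((L.map (X (R := R))).take i)
      = Ideal.span (X '' {a | a ∈ L.take i}) := by
    rw [Ideal.ofList]; congr 1; ext x; simp [← List.map_take]
  rw [hI] at hc ⊢
  rw [mem_ideal_span_X_image] at hc ⊢
  intro m hm
  have hi : i < L.length := by simpa using h
  obtain ⟨a, ha, hne⟩ := hc (Finsupp.single L[i] 1 + m) (by
    rw [mem_support_iff, List.getElem_map, coeff_X_mul]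
    exact mem_support_iff.1 hm)
  refine ⟨a, ha, ?_⟩
  have : a ≠ L[i] := by
    rintro rfl
    have := List.mem_take_iff_getElem.1 ha
    obtain ⟨j, hj, hj'⟩ := this
    have := (List.Nodup.getElem_inj_iff hL).1 hj'
    omega
  simpa [Finsupp.single_apply, this.symm] using hne

theorem weightedHomogeneousComponent_mul_of_le {σ : Type*} {R : Type*} [CommRing R] (w : σ → ℕ)
    (hw : ∀ i, 0 < w i) (h c : MvPolynomial σ R) (d : ℕ)
    (hc : ∀ m ∈ c.support, d ≤ Finsupp.weight w m) :
    weightedHomogeneousComponent w d (h * c)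
      = C (h.coeff 0) * weightedHomogeneousComponent w d c := by
  classical
  ext m
  rw [coeff_C_mul, coeff_weightedHomogeneousComponent, coeff_weightedHomogeneousComponent]
  split_ifs with hm
  · rw [coeff_mul, Finset.sum_eq_single (0, m)]
    · rintro ⟨a, b⟩ hab hne
      by_cases hb : b ∈ c.support
      · exfalso
        rw [Finset.HasAntidiagonal.mem_antidiagonal] at hab
        simp only at hab
        have h1 := hc b hb
        have h2 : Finsupp.weight w a + Finsupp.weight w b = d := by rw [← map_add, hab, hm]
        have h3 : Finsupp.weight w a = 0 := by omega
        have h4 : a = 0 := by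
          ext i
          by_contra hi
          have h5 := Finsupp.le_weight w (hw i).ne' a
          simp only [Finsupp.coe_zero, Pi.zero_apply] at hi
          omega
        simp only [h4, zero_add] at hab
        exact hne (by rw [h4, hab])
      · rw [notMem_support_iff.1 hb, mul_zero]
    · intro h; simp at h
  · simp

theorem mem_of_mul_mem_of_isHomogeneous {σ : Type*} {k : Type*} [Field k] (w : σ → ℕ)
    (hw : ∀ i, 0 < w i) (gs : List (MvPolynomial σ k))
    (hg : ∀ g ∈ gs, ∃ d, IsWeightedHomogeneous w g d) (h c : MvPolynomial σ k)
    (h0 : h.coeff 0 ≠ 0) (hc : h * c ∈ Ideal.ofList gs) : c ∈ Ideal.ofList gs := by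
  classical
  let _ := weightedGradedAlgebra k w
  have hI : Ideal.IsHomogeneous (weightedHomogeneousSubmodule k w) (Ideal.ofList gs) := by
    apply Ideal.homogeneous_span
    intro x hx
    obtain ⟨d, hd⟩ := hg x hx
    exact ⟨d, hd⟩
  rw [mem_iff_weightedHomogeneousComponent_mem k w hI]
  intro d
  induction d using Nat.strong_induction_on with
  | _ d ih =>
    have h1 : h * (c - ∑ j ∈ Finset.range d, weightedHomogeneousComponent w j c)
        ∈ Ideal.ofList gs := by
      rw [mul_sub]
      refine sub_mem hc (Ideal.mul_mem_left _ _ (sum_mem fun j hj => ih j (by simpa using hj)))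
    have h2 := weightedHomogeneousComponent_mem_of_mem k w hI h1 d
    have h3 : ∀ m ∈ (c - ∑ j ∈ Finset.range d, weightedHomogeneousComponent w j c).support,
        d ≤ Finsupp.weight w m := by
      intro m hm
      by_contra hlt
      push Not at hlt
      rw [mem_support_iff, coeff_sub, coeff_sum] at hm
      apply hm
      rw [Finset.sum_eq_single (Finsupp.weight w m)]
      · rw [coeff_weightedHomogeneousComponent, if_pos rfl, sub_self]
      · intro j _ hj
        rw [coeff_weightedHomogeneousComponent, if_neg (Ne.symm hj)]
      · intro h; simp at h; omega
    rw [weightedHomogeneousComponent_mul_of_le w hw _ _ d h3] at h2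
    have h4 : weightedHomogeneousComponent w d
        (c - ∑ j ∈ Finset.range d, weightedHomogeneousComponent w j c)
        = weightedHomogeneousComponent w d c := by
      ext m
      rw [coeff_weightedHomogeneousComponent, coeff_weightedHomogeneousComponent]
      split_ifs with hm
      · rw [coeff_sub, coeff_sum, Finset.sum_eq_zero, sub_zero]
        intro j hj
        rw [coeff_weightedHomogeneousComponent, if_neg]
        simp at hj; omega
      · rfl
    rw [h4] at h2
    have h5 := Ideal.mul_mem_left _ (C (h.coeff 0)⁻¹) h2
    rwa [← mul_assoc, ← C_mul, inv_mul_cancel₀ h0, C_1, one_mul] at h5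

theorem isWeaklyRegular_of_isWeightedHomogeneous {σ : Type u} [Fintype σ] (w : σ → ℕ)
    (hw : ∀ i, 0 < w i) (gs : List (MvPolynomial σ ℂ)) (hlen : gs.length = Fintype.card σ)
    (hg : ∀ g ∈ gs, ∃ d, 0 < d ∧ IsWeightedHomogeneous w g d)
    (hz : ∀ x : σ → ℂ, (∀ g ∈ gs, eval x g = 0) → x = 0) :
    IsWeaklyRegular (MvPolynomial σ ℂ) gs := by
  classical
  let p : Ideal (MvPolynomial σ ℂ) := RingHom.ker (eval (0 : σ → ℂ))
  have hpmem : ∀ f, f ∈ p ↔ f.coeff 0 = 0 := fun f => by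
    rw [RingHom.mem_ker, eval_zero, constantCoeff_eq]
  have : p.IsPrime := RingHom.ker_isPrime _
  let S := Localization.AtPrime p
  have hgp : ∀ g ∈ gs, g ∈ p := by
    intro g hgm
    obtain ⟨d, hd, h⟩ := hg g hgm
    rw [hpmem]
    by_contra hne
    have := h hne
    simp at this; omega
  have hrad : p ≤ (Ideal.ofList gs).radical := by
    rw [← vanishingIdeal_zeroLocus_eq_radical (K := ℂ)]
    intro f hf x hx
    have hx0 : x = 0 := hz x fun g hgm => by
      have := hx g (Ideal.subset_span hgm)
      simpa [aeval_eq_eval] using this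
    subst hx0
    have := (hpmem f).1 hf
    simpa [aeval_eq_eval, constantCoeff_eq] using this
  have hX : RingTheory.Sequence.IsRegular S
      (((Finset.univ : Finset σ).toList.map X).map (algebraMap (MvPolynomial σ ℂ) S)) := by
    refine IsWeaklyRegular.isRegular_of_isLocalization_of_mem S p
      (isWeaklyRegular_map_X _ (Finset.nodup_toList _)) ?_
    intro r hr
    simp at hr
    obtain ⟨i, rfl⟩ := hr
    simp [p, RingHom.mem_ker]
  have hmax : ∀ f, f ∈ p → algebraMap (MvPolynomial σ ℂ) S f ∈ maximalIdeal S := by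
    intro f hf
    exact (IsLocalization.AtPrime.to_map_mem_maximal_iff S p f).2 hf
  have : IsNoetherianRing S := IsLocalization.isNoetherianRing p.primeCompl S inferInstance
  have key : IsWeaklyRegular S (gs.map (algebraMap (MvPolynomial σ ℂ) S)) := by
    refine isWeaklyRegular_of_maximalIdeal_le_radical _ _ ?_ hX ?_ ?_ ?_
    · intro r hr
      simp at hr
      obtain ⟨i, rfl⟩ := hr
      exact hmax _ (by simp [p, RingHom.mem_ker])
    · simp [hlen]
    · intro r hr
      simp only [List.mem_map] at hr
      obtain ⟨g, hgm, rfl⟩ := hr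
      exact hmax _ (hgp g hgm)
    · refine le_trans ?_ (Ideal.radical_mono le_sup_left)
      rw [← Localization.AtPrime.map_eq_maximalIdeal, Ideal.map_le_iff_le_comap]
      intro f hf
      obtain ⟨N, hN⟩ := hrad hf
      refine ⟨N, ?_⟩
      rw [← map_pow, ← Ideal.map_ofList]
      exact Ideal.mem_map_of_mem _ hN
  rw [isWeaklyRegular_iff_forall_mul_mem] at key ⊢
  intro i h c hc
  have h1 := key i (by simpa using h) (algebraMap _ S c) (by
    rw [List.getElem_map, ← map_mul, ← List.map_take, ← Ideal.map_ofList]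
    exact Ideal.mem_map_of_mem _ hc)
  rw [← List.map_take, ← Ideal.map_ofList,
    IsLocalization.algebraMap_mem_map_algebraMap_iff p.primeCompl] at h1
  obtain ⟨s, hs, h2⟩ := h1
  refine mem_of_mul_mem_of_isHomogeneous w hw _ (fun g hg' => ?_) s c (fun h0 => hs ?_) h2
  · obtain ⟨d, _, hd⟩ := hg g (List.mem_of_mem_take hg')
    exact ⟨d, hd⟩
  · exact (hpmem s).2 h0

end

section

open RingTheory.Sequence MvPolynomial

section Koszul

theorem isWeaklyRegular_self_append_singleton {R : Type*} [CommRing R] (rs : List R) (a : R)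
    (h : IsWeaklyRegular R (rs ++ [a])) :
    IsWeaklyRegular R rs ∧ ∀ c, a * c ∈ Ideal.ofList rs → c ∈ Ideal.ofList rs := by
  refine ⟨((isWeaklyRegular_append_iff _ _ _).1 h).1, fun c hc => ?_⟩
  have := (isWeaklyRegular_iff_forall_mul_mem _).1 h rs.length (by simp) c
  simpa using this (by simpa using hc)

theorem mem_ofList_ofFn {R : Type*} [CommRing R] {k : ℕ} (g : Fin k → R) (x : R) :
    x ∈ Ideal.ofList (List.ofFn g) ↔ ∃ b : Fin k → R, x = ∑ i, b i * g i := by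
  have : Ideal.ofList (List.ofFn g) = Ideal.span (Set.range g) := by
    rw [Ideal.ofList]; congr 1; ext y; simp [List.mem_ofFn]
  rw [this, Ideal.mem_span_range_iff_exists_fun]
  simp only [eq_comm]

theorem exists_koszul_of_isWeaklyRegular {R : Type*} [CommRing R] {k : ℕ} (g : Fin k → R)
    (hg : IsWeaklyRegular R (List.ofFn g)) (f : Fin k → R) (hf : ∑ i, f i * g i = 0) :
    ∃ a : Fin k → Fin k → R, (∀ i j, a i j = - a j i) ∧ (∀ i, a i i = 0) ∧
      ∀ i, f i = ∑ j, a i j * g j := by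
  induction k with
  | zero => exact ⟨fun i => i.elim0, fun i => i.elim0, fun i => i.elim0, fun i => i.elim0⟩
  | succ k ih =>
    have hl : List.ofFn g = List.ofFn (fun i : Fin k => g i.castSucc) ++ [g (Fin.last k)] := by
      rw [List.ofFn_succ_last]
    rw [hl] at hg
    obtain ⟨h1, h2⟩ := isWeaklyRegular_self_append_singleton _ _ hg
    rw [Fin.sum_univ_castSucc] at hf
    obtain ⟨b, hb⟩ := (mem_ofList_ofFn _ _).1 (h2 (f (Fin.last k)) ((mem_ofList_ofFn _ _).2
      ⟨fun i => - f i.castSucc, by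
        simp only [neg_mul, Finset.sum_neg_distrib]; linear_combination hf⟩))
    obtain ⟨a, ha, ha0, haf⟩ := ih (fun i => g i.castSucc) h1
      (fun i => f i.castSucc + b i * g (Fin.last k)) (by
        rw [hb] at hf
        rw [← hf, Finset.sum_mul, ← Finset.sum_add_distrib]
        exact Finset.sum_congr rfl fun i _ => by ring)
    refine ⟨Fin.snoc (α := fun _ => Fin (k + 1) → R)
      (fun i => Fin.snoc (α := fun _ => R) (a i) (- b i))
      (Fin.snoc (α := fun _ => R) b 0), ?_, ?_, ?_⟩
    · intro i j
      induction i using Fin.lastCases <;> induction j using Fin.lastCases <;> simp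
      exact ha _ _
    · intro i
      induction i using Fin.lastCases <;> simp [ha0]
    · intro i
      induction i using Fin.lastCases with
      | last => simp [Fin.sum_univ_castSucc, hb]
      | cast i =>
        simp only [Fin.sum_univ_castSucc, Fin.snoc_castSucc, Fin.snoc_last]
        rw [← haf]; ring

end Koszul

section Hilbert

variable {r : ℕ}

theorem homogeneousComponent_mul_of_isHomogeneous {σ : Type*} {R : Type*} [CommRing R]
    {g : MvPolynomial σ R} {D : ℕ} (hg : g.IsHomogeneous D) (c : MvPolynomial σ R) (e : ℕ) :
    homogeneousComponent e (g * c)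
      = if D ≤ e then g * homogeneousComponent (e - D) c else 0 := by
  have h1 : ∀ N, homogeneousComponent N c = 0 ∨ N ∈ Finset.range (c.totalDegree + 1) := by
    intro N
    by_cases hN : N ≤ c.totalDegree
    · right; simp; omega
    · left; exact homogeneousComponent_eq_zero _ _ (by omega)
  conv_lhs => rw [← sum_homogeneousComponent c, Finset.mul_sum, map_sum]
  have h2 : ∀ i, homogeneousComponent e (g * homogeneousComponent i c)
      = if e = D + i then g * homogeneousComponent i c else 0 := fun i =>
    homogeneousComponent_of_mem (hg.mul (homogeneousComponent_isHomogeneous i c))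
  simp only [h2]
  split_ifs with h
  · have : ∀ i, e = D + i ↔ e - D = i := fun i => by omega
    simp only [this, Finset.sum_ite_eq]
    split_ifs with h3
    · rfl
    · rcases h1 (e - D) with h4 | h4
      · rw [h4, mul_zero]
      · exact absurd h4 h3
  · exact Finset.sum_eq_zero fun i _ => if_neg (by omega)

instance finite_homogeneousSubmodule (r e : ℕ) :
    Module.Finite ℂ (homogeneousSubmodule (Fin r) ℂ e) := by
  have := weightedHomogeneousSubmodule_fg (R := ℂ) (1 : Fin r → ℕ) (by simp) e
  exact Module.Finite.iff_fg.2 this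

/-- The degree `e` part of an ideal. -/
noncomputable def gradedPart (J : Ideal (MvPolynomial (Fin r) ℂ)) (e : ℕ) :
    Submodule ℂ (MvPolynomial (Fin r) ℂ) :=
  J.restrictScalars ℂ ⊓ homogeneousSubmodule (Fin r) ℂ e

/-- The Hilbert series of the quotient by an ideal. -/
noncomputable def hilbSeries (J : Ideal (MvPolynomial (Fin r) ℂ)) : PowerSeries ℤ :=
  PowerSeries.mk fun e => (Module.finrank ℂ (homogeneousSubmodule (Fin r) ℂ e) : ℤ)
    - Module.finrank ℂ (gradedPart J e)

theorem mem_gradedPart {J : Ideal (MvPolynomial (Fin r) ℂ)} {e : ℕ} {f : MvPolynomial (Fin r) ℂ} :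
    f ∈ gradedPart J e ↔ f ∈ J ∧ f.IsHomogeneous e := by
  simp [gradedPart]

instance (J : Ideal (MvPolynomial (Fin r) ℂ)) (e : ℕ) : Module.Finite ℂ (gradedPart J e) :=
  Submodule.finiteDimensional_of_le (S₂ := homogeneousSubmodule (Fin r) ℂ e) inf_le_right

theorem gradedPart_top (e : ℕ) : gradedPart (r := r) ⊤ e = homogeneousSubmodule (Fin r) ℂ e := by
  ext f; simp [mem_gradedPart]

theorem hilbSeries_sup_span (J : Ideal (MvPolynomial (Fin r) ℂ))
    (hJ : ∀ f ∈ J, ∀ e, homogeneousComponent e f ∈ J) (g : MvPolynomial (Fin r) ℂ) (D : ℕ)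
    (hg : g.IsHomogeneous D) (hreg : ∀ c, g * c ∈ J → c ∈ J) :
    hilbSeries (J ⊔ Ideal.span {g}) = hilbSeries J * (1 - PowerSeries.X ^ D) := by
  by_cases hg0 : g = 0
  · subst hg0
    have : J = ⊤ := by
      rw [Ideal.eq_top_iff_one]; exact hreg 1 (by simp)
    subst this
    have : hilbSeries (r := r) ⊤ = 0 := by
      ext e; rw [hilbSeries, PowerSeries.coeff_mk, gradedPart_top, sub_self, map_zero]
    simp [this]
  have hmem : ∀ f, f ∈ J ⊔ Ideal.span {g} ↔ ∃ j ∈ J, ∃ c, f = j + g * c := by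
    intro f
    rw [Submodule.mem_sup]
    constructor
    · rintro ⟨j, hj, z, hz, rfl⟩
      obtain ⟨c, rfl⟩ := Ideal.mem_span_singleton.1 hz
      exact ⟨j, hj, c, rfl⟩
    · rintro ⟨j, hj, c, rfl⟩
      exact ⟨j, hj, g * c, Ideal.mem_span_singleton.2 ⟨c, rfl⟩, rfl⟩
  ext e
  rw [mul_sub, mul_one, map_sub, PowerSeries.coeff_mul_X_pow', hilbSeries, hilbSeries]
  simp only [PowerSeries.coeff_mk]
  split_ifs with h
  · let φ := LinearMap.mulLeft ℂ g
    have hφ : Function.Injective φ := fun a b hab => mul_left_cancel₀ hg0 hab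
    have e1 : gradedPart (J ⊔ Ideal.span {g}) e
        = gradedPart J e ⊔ (homogeneousSubmodule (Fin r) ℂ (e - D)).map φ := by
      apply le_antisymm
      · intro f hf
        rw [mem_gradedPart, hmem] at hf
        obtain ⟨⟨j, hj, c, rfl⟩, hfe⟩ := hf
        have := homogeneousComponent_of_mem hfe (m := e)
        rw [if_pos rfl, map_add, homogeneousComponent_mul_of_isHomogeneous hg, if_pos h] at this
        rw [← this]
        refine Submodule.add_mem_sup (mem_gradedPart.2 ⟨hJ _ hj _,
          homogeneousComponent_isHomogeneous _ _⟩)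
          ⟨_, homogeneousComponent_isHomogeneous (e - D) c, rfl⟩
      · refine sup_le (fun f hf => ?_) ?_
        · rw [mem_gradedPart] at hf ⊢
          exact ⟨Submodule.mem_sup_left hf.1, hf.2⟩
        · rintro _ ⟨c, hc, rfl⟩
          rw [mem_gradedPart, hmem]
          refine ⟨⟨0, J.zero_mem, c, by simp [φ]⟩, ?_⟩
          have := hg.mul hc
          rwa [Nat.add_sub_cancel' h] at this
    have e2 : gradedPart J e ⊓ (homogeneousSubmodule (Fin r) ℂ (e - D)).map φ
        = (gradedPart J (e - D)).map φ := by
      apply le_antisymm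
      · rintro f ⟨hf, c, hc, rfl⟩
        exact ⟨c, mem_gradedPart.2 ⟨hreg c (mem_gradedPart.1 hf).1, hc⟩, rfl⟩
      · rintro _ ⟨c, hc, rfl⟩
        have hc' := mem_gradedPart.1 hc
        refine ⟨mem_gradedPart.2 ⟨J.mul_mem_left _ hc'.1, ?_⟩, c, hc'.2, rfl⟩
        have := hg.mul hc'.2
        rwa [Nat.add_sub_cancel' h] at this
    have h3 := Submodule.finrank_sup_add_finrank_inf_eq (gradedPart J e)
      ((homogeneousSubmodule (Fin r) ℂ (e - D)).map φ)
    rw [← e1, e2, ← (Submodule.equivMapOfInjective φ hφ _).finrank_eq,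
      ← (Submodule.equivMapOfInjective φ hφ _).finrank_eq] at h3
    omega
  · have e1 : gradedPart (J ⊔ Ideal.span {g}) e = gradedPart J e := by
      apply le_antisymm
      · intro f hf
        rw [mem_gradedPart, hmem] at hf
        obtain ⟨⟨j, hj, c, rfl⟩, hfe⟩ := hf
        have := homogeneousComponent_of_mem hfe (m := e)
        rw [if_pos rfl, map_add, homogeneousComponent_mul_of_isHomogeneous hg, if_neg h,
          add_zero] at this
        rw [← this]
        exact mem_gradedPart.2 ⟨hJ _ hj _, homogeneousComponent_isHomogeneous _ _⟩
      · intro f hf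
        rw [mem_gradedPart] at hf ⊢
        exact ⟨Submodule.mem_sup_left hf.1, hf.2⟩
    rw [e1, sub_zero]

theorem homogeneousComponent_mem_ofList (gs : List (MvPolynomial (Fin r) ℂ))
    (hg : ∀ g ∈ gs, ∃ d, g.IsHomogeneous d) :
    ∀ f ∈ Ideal.ofList gs, ∀ e, homogeneousComponent e f ∈ Ideal.ofList gs := by
  let _ := MvPolynomial.gradedAlgebra (σ := Fin r) (R := ℂ)
  intro f hf e
  refine homogeneousComponent_mem_of_mem (Ideal.homogeneous_span _ _ fun g hg' => ?_) hf e
  obtain ⟨d, hd⟩ := hg g hg'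
  exact ⟨d, hd⟩

theorem hilbSeries_ofFn {k : ℕ} (g : Fin k → MvPolynomial (Fin r) ℂ)
    (hreg : IsWeaklyRegular (MvPolynomial (Fin r) ℂ) (List.ofFn g)) (D : Fin k → ℕ)
    (hg : ∀ i, (g i).IsHomogeneous (D i)) :
    hilbSeries (Ideal.ofList (List.ofFn g))
      = hilbSeries (⊥ : Ideal (MvPolynomial (Fin r) ℂ)) * ∏ i, (1 - PowerSeries.X ^ D i) := by
  induction k with
  | zero => simp
  | succ k ih =>
    have hl : List.ofFn g = List.ofFn (fun i : Fin k => g i.castSucc) ++ [g (Fin.last k)] := by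
      rw [List.ofFn_succ_last]
    rw [hl] at hreg ⊢
    obtain ⟨h1, h2⟩ := isWeaklyRegular_self_append_singleton _ _ hreg
    rw [Ideal.ofList_append, Ideal.ofList_singleton, hilbSeries_sup_span _ _ _ _ (hg _) h2,
      ih _ h1 (fun i => D i.castSucc) (fun i => hg _), Fin.prod_univ_castSucc, mul_assoc]
    apply homogeneousComponent_mem_ofList
    intro x hx
    obtain ⟨i, rfl⟩ := (List.mem_ofFn' _ _).1 hx
    exact ⟨_, hg _⟩

theorem hilbSeries_X :
    hilbSeries (Ideal.ofList (List.ofFn (X : Fin r → MvPolynomial (Fin r) ℂ))) = 1 := by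
  have hmem : ∀ f, f ∈ Ideal.ofList (List.ofFn (X : Fin r → MvPolynomial (Fin r) ℂ)) ↔
      f.coeff 0 = 0 := by
    intro f
    have hI : Ideal.ofList (List.ofFn (X : Fin r → MvPolynomial (Fin r) ℂ))
        = Ideal.span (X '' Set.univ) := by
      rw [Ideal.ofList]; congr 1; ext x; simp [List.mem_ofFn]
    rw [hI, mem_ideal_span_X_image]
    constructor
    · intro h
      by_contra h0
      obtain ⟨i, -, hi⟩ := h 0 (mem_support_iff.2 h0)
      simp at hi
    · intro h m hm
      by_contra hcon
      push Not at hcon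
      have : m = 0 := by ext i; simpa using hcon i (Set.mem_univ i)
      subst this
      exact mem_support_iff.1 hm h
  ext e
  rw [hilbSeries, PowerSeries.coeff_mk, PowerSeries.coeff_one]
  split_ifs with he
  · subst he
    have h1 : gradedPart (Ideal.ofList (List.ofFn (X : Fin r → MvPolynomial (Fin r) ℂ))) 0 = ⊥ := by
      rw [eq_bot_iff]
      intro f hf
      obtain ⟨hf1, hf2⟩ := mem_gradedPart.1 hf
      rw [hmem] at hf1
      have := homogeneousComponent_of_mem hf2 (m := 0)
      rw [if_pos rfl, homogeneousComponent_zero, hf1, C_0] at this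
      exact this.symm
    have h2 : homogeneousSubmodule (Fin r) ℂ 0 = Submodule.span ℂ {1} := by
      apply le_antisymm
      · intro f hf
        have := homogeneousComponent_of_mem hf (m := 0)
        rw [if_pos rfl, homogeneousComponent_zero] at this
        rw [← this, Submodule.mem_span_singleton]
        exact ⟨_, by rw [smul_eq_C_mul, mul_one]⟩
      · rw [Submodule.span_singleton_le_iff_mem]
        exact isHomogeneous_one _ _
    rw [h1, h2, finrank_span_singleton one_ne_zero]
    simp
  · have : gradedPart (Ideal.ofList (List.ofFn (X : Fin r → MvPolynomial (Fin r) ℂ))) e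
        = homogeneousSubmodule (Fin r) ℂ e := by
      refine le_antisymm inf_le_right fun f hf => mem_gradedPart.2 ⟨(hmem f).2 ?_, hf⟩
      by_contra h0
      have := hf h0
      simp at this
      exact he this.symm
    rw [this, sub_self]

/-- A complete intersection of `r` homogeneous forms in `r` variables does not contain all forms
of its socle degree. -/
theorem not_homogeneousSubmodule_le_of_isWeaklyRegular (g : Fin r → MvPolynomial (Fin r) ℂ)
    (hreg : IsWeaklyRegular (MvPolynomial (Fin r) ℂ) (List.ofFn g)) (D : Fin r → ℕ)
    (hg : ∀ i, (g i).IsHomogeneous (D i)) (hD : ∀ i, 1 ≤ D i) (j : ℕ) (hj : j ≤ ∑ i, (D i - 1)) :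
    ¬ ∀ f, f.IsHomogeneous j → f ∈ Ideal.ofList (List.ofFn g) := by
  intro hall
  have hXreg : IsWeaklyRegular (MvPolynomial (Fin r) ℂ)
      (List.ofFn (X : Fin r → MvPolynomial (Fin r) ℂ)) := by
    have := isWeaklyRegular_map_X (R := ℂ) (List.finRange r) (List.nodup_finRange r)
    rwa [← List.ofFn_eq_map] at this
  have h1 := hilbSeries_ofFn g hreg D hg
  have h2 := hilbSeries_ofFn X hXreg (fun _ => 1) (fun i => isHomogeneous_X _ _)
  rw [hilbSeries_X] at h2
  have h3 : hilbSeries (Ideal.ofList (List.ofFn g))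
      = ((∏ i, ∑ k ∈ Finset.range (D i), Polynomial.X ^ k : Polynomial ℤ) : PowerSeries ℤ) := by
    have : ∀ i, (1 - PowerSeries.X ^ D i : PowerSeries ℤ)
        = (1 - PowerSeries.X ^ 1) * ((∑ k ∈ Finset.range (D i), Polynomial.X ^ k : Polynomial ℤ) :
          PowerSeries ℤ) := by
      intro i
      rw [← Polynomial.coeToPowerSeries.ringHom_apply, map_sum]
      simp only [map_pow, Polynomial.coeToPowerSeries.ringHom_apply, Polynomial.coe_X, pow_one]
      rw [mul_neg_geom_sum]
    rw [h1, Finset.prod_congr rfl fun i _ => this i, Finset.prod_mul_distrib, ← mul_assoc, ← h2,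
      one_mul, ← Polynomial.coeToPowerSeries.ringHom_apply, map_prod]
    rfl
  have hmonic : ∀ i, (∑ k ∈ Finset.range (D i), Polynomial.X ^ k : Polynomial ℤ).Monic := by
    intro i
    exact Polynomial.monic_geom_sum_X (by have := hD i; omega)
  have hdeg : ∀ i, (∑ k ∈ Finset.range (D i), Polynomial.X ^ k : Polynomial ℤ).natDegree
      = D i - 1 := by
    intro i
    have h5 : (Polynomial.X - 1 : Polynomial ℤ).Monic := Polynomial.monic_X_sub_C (1 : ℤ)
    have h6 := h5.natDegree_mul (hmonic i)
    rw [mul_comm, geom_sum_mul, show (Polynomial.X - 1 : Polynomial ℤ).natDegree = 1 from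
      Polynomial.natDegree_X_sub_C 1] at h6
    have h7 : (Polynomial.X ^ D i - 1 : Polynomial ℤ).natDegree = D i :=
      Polynomial.natDegree_X_pow_sub_C (r := (1 : ℤ))
    omega
  set N := ∑ i, (D i - 1) with hN
  have h4 : PowerSeries.coeff N (hilbSeries (Ideal.ofList (List.ofFn g))) = 1 := by
    rw [h3, Polynomial.coeff_coe]
    have h8 := Polynomial.monic_prod_of_monic Finset.univ _ fun i _ => hmonic i
    have h9 := Polynomial.natDegree_prod_of_monic Finset.univ _ fun i _ => hmonic i
    rw [Finset.sum_congr rfl fun i _ => hdeg i] at h9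
    rw [hN, ← h9]
    exact h8
  have hall' : ∀ N, j ≤ N → ∀ f, f.IsHomogeneous N → f ∈ Ideal.ofList (List.ofFn g) := by
    intro N hN f hf
    rw [f.as_sum]
    refine sum_mem fun m hm => ?_
    have hmN : m.degree = N := by
      by_contra h; exact mem_support_iff.1 hm (hf.coeff_eq_zero h)
    obtain ⟨m', hm', hdeg'⟩ : ∃ m' ≤ m, m'.degree = j := Finsupp.exists_le_degree_eq m j (by omega)
    obtain ⟨m'', rfl⟩ := exists_add_of_le hm'
    have : monomial (m' + m'') (coeff (m' + m'') f)
        = monomial m'' (coeff (m' + m'') f) * monomial m' 1 := by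
      rw [monomial_mul, mul_one, add_comm]
    rw [this]
    exact Ideal.mul_mem_left _ _ (hall _ (isHomogeneous_monomial _ hdeg'))
  rw [hilbSeries, PowerSeries.coeff_mk] at h4
  have : gradedPart (Ideal.ofList (List.ofFn g)) N = homogeneousSubmodule (Fin r) ℂ N :=
    le_antisymm inf_le_right fun f hf => mem_gradedPart.2 ⟨hall' N hj f hf, hf⟩
  rw [this] at h4
  simp at h4

end Hilbert

end

section LeadingCoefficient
open RingTheory.Sequence Polynomial

variable {S : Type*} [CommRing S]

theorem monomial_mem_degreeLT (e : ℕ) (a : S) : Polynomial.monomial e a ∈ degreeLT S (e + 1) := by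
  rw [mem_degreeLT]
  exact lt_of_le_of_lt (degree_monomial_le _ _) (by exact_mod_cast Nat.lt_succ_self e)

theorem sub_monomial_mem_degreeLT {e : ℕ} {f : S[X]} (hf : f ∈ degreeLT S (e + 1)) :
    f - Polynomial.monomial e (f.coeff e) ∈ degreeLT S e := by
  rw [mem_degreeLT, degree_lt_iff_coeff_zero] at hf ⊢
  intro m hm
  rw [Polynomial.coeff_sub, Polynomial.coeff_monomial]
  rcases hm.eq_or_lt with h | h
  · simp [h]
  · rw [if_neg h.ne, sub_zero]; exact hf m h

theorem C_mul_mem_degreeLT {e : ℕ} {f : S[X]} (hf : f ∈ degreeLT S e) (a : S) :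
    Polynomial.C a * f ∈ degreeLT S e := by
  rw [← Polynomial.smul_eq_C_mul]; exact Submodule.smul_mem _ _ hf

variable [Algebra ℂ S] {q : ℕ}

/-- Combinations `G f₀ + ∑ Eᵢ fᵢ` with `deg f₀ ≤ e` and `deg fᵢ < e`. -/
def boundedRange (G : S) (E : Fin (q + 1) → S[X] →ₗ[ℂ] S[X]) (e : ℕ) : Submodule ℂ S[X] where
  carrier := {h | ∃ f₀ ∈ degreeLT S (e + 1), ∃ f : Fin (q + 1) → S[X],
    (∀ i, f i ∈ degreeLT S e) ∧ h = Polynomial.C G * f₀ + ∑ i, E i (f i)}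
  add_mem' := by
    rintro _ _ ⟨f₀, hf₀, f, hf, rfl⟩ ⟨g₀, hg₀, g, hg, rfl⟩
    refine ⟨f₀ + g₀, add_mem hf₀ hg₀, fun i => f i + g i, fun i => add_mem (hf i) (hg i), ?_⟩
    simp only [map_add, Finset.sum_add_distrib]
    ring
  zero_mem' := ⟨0, zero_mem _, 0, fun i => zero_mem _, by simp⟩
  smul_mem' := by
    rintro c _ ⟨f₀, hf₀, f, hf, rfl⟩
    refine ⟨c • f₀, ?_, fun i => c • f i, fun i => ?_, ?_⟩
    · rw [← algebraMap_smul S c f₀]; exact Submodule.smul_mem _ _ hf₀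
    · show c • f i ∈ _
      rw [← algebraMap_smul S c (f i)]; exact Submodule.smul_mem _ _ (hf i)
    · simp only [map_smul, smul_add, Finset.smul_sum, mul_smul_comm]

variable {G : S} {E : Fin (q + 1) → S[X] →ₗ[ℂ] S[X]}

theorem C_mul_mem_boundedRange {e : ℕ} {f : S[X]} (hf : f ∈ degreeLT S (e + 1)) :
    Polynomial.C G * f ∈ boundedRange G E e :=
  ⟨f, hf, 0, fun _ => zero_mem _, by simp⟩

theorem apply_mem_boundedRange {e : ℕ} {f : S[X]} (hf : f ∈ degreeLT S e) (i : Fin (q + 1)) :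
    E i f ∈ boundedRange G E e := by
  classical
  refine ⟨0, zero_mem _, Pi.single i f, fun k => ?_, ?_⟩
  · by_cases h : k = i
    · subst h; simpa using hf
    · rw [Pi.single_eq_of_ne h]; exact zero_mem _
  · rw [mul_zero, zero_add, Finset.sum_eq_single i]
    · simp
    · intro k _ h; rw [Pi.single_eq_of_ne h, map_zero]
    · simp

variable {P : Fin (q + 1) → S[X] →ₗ[ℂ] S[X]} {lam : Fin (q + 1) → S} {π : S[X] →ₗ[ℂ] S[X]}

theorem exists_eq_of_mem_boundedRange
    (hπ0 : ∀ f, π (E 0 f) = 0)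
    (hπE : ∀ i e, ∀ f ∈ degreeLT S e, ∃ f' ∈ degreeLT S e, π (E i f) = E i f')
    (hπG : ∀ e, ∀ f ∈ degreeLT S e, ∃ f' ∈ degreeLT S e,
      π (Polynomial.C G * f) = Polynomial.C G * f')
    {e : ℕ} {h : S[X]} (hh : h ∈ boundedRange G E e) :
    ∃ f₀ ∈ degreeLT S (e + 1), ∃ f : Fin q → S[X], (∀ i, f i ∈ degreeLT S e) ∧
      π h = Polynomial.C G * f₀ + ∑ i, E i.succ (f i) := by
  obtain ⟨f₀, hf₀, f, hf, rfl⟩ := hh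
  obtain ⟨f₀', hf₀', h0⟩ := hπG _ f₀ hf₀
  choose f' hf' h' using fun i : Fin q => hπE i.succ e (f i.succ) (hf i.succ)
  refine ⟨f₀', hf₀', f', hf', ?_⟩
  rw [map_add, h0, map_sum, Fin.sum_univ_succ, hπ0, zero_add]
  exact congrArg _ (Finset.sum_congr rfl fun i _ => h' i)

theorem coeff_eq_of_eq
    (hE : ∀ i f, E i f = P i f - Polynomial.X * (Polynomial.C (lam i) * f))
    (hP : ∀ i e, ∀ f ∈ degreeLT S e, P i f ∈ degreeLT S e)
    {e : ℕ} {f₀ : S[X]} {f : Fin q → S[X]} (hf : ∀ i, f i ∈ degreeLT S (e + 1)) :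
    (Polynomial.C G * f₀ + ∑ i : Fin q, E i.succ (f i)).coeff (e + 1)
      = f₀.coeff (e + 1) * G + ∑ i : Fin q, (- (f i).coeff e) * lam i.succ := by
  rw [Polynomial.coeff_add, Polynomial.coeff_C_mul, finsetSum_coeff, mul_comm]
  congr 1
  refine Finset.sum_congr rfl fun i _ => ?_
  have := hP i.succ _ _ (hf i)
  rw [mem_degreeLT, degree_lt_iff_coeff_zero] at this
  rw [hE, Polynomial.coeff_sub, this _ le_rfl, Polynomial.coeff_X_mul, Polynomial.coeff_C_mul]
  ring

theorem mem_boundedRange_of_coeff_eq_zero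
    (hE : ∀ i f, E i f = P i f - Polynomial.X * (Polynomial.C (lam i) * f))
    (hP : ∀ i e, ∀ f ∈ degreeLT S e, P i f ∈ degreeLT S e)
    (hcomm : ∀ i k, ∃ c : Fin (q + 1) → S, ∀ f,
      E i (E k f) - E k (E i f) = ∑ m, E m (Polynomial.C (c m) * f))
    (hG : ∀ i, ∃ μ : S, ∀ f,
      E i (Polynomial.C G * f) = Polynomial.C G * (E i f - Polynomial.C μ * f))
    (hreg : IsWeaklyRegular S (List.ofFn (Fin.cons G (fun i : Fin q => lam i.succ) :
      Fin (q + 1) → S)))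
    (hπ0 : ∀ f, π (E 0 f) = 0)
    (hπE : ∀ i e, ∀ f ∈ degreeLT S e, ∃ f' ∈ degreeLT S e, π (E i f) = E i f')
    (hπG : ∀ e, ∀ f ∈ degreeLT S e, ∃ f' ∈ degreeLT S e,
      π (Polynomial.C G * f) = Polynomial.C G * f')
    {e : ℕ} {h : S[X]} (hπ : π h = h) (hh : h ∈ boundedRange G E (e + 2))
    (hc : h.coeff (e + 2) = 0) : h ∈ boundedRange G E (e + 1) := by
  obtain ⟨f₀, hf₀, f, hf, heq⟩ := exists_eq_of_mem_boundedRange hπ0 hπE hπG hh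
  rw [hπ] at heq
  have h1 := hc
  rw [heq, coeff_eq_of_eq hE hP hf] at h1
  obtain ⟨a, ha, ha0, haf⟩ := exists_koszul_of_isWeaklyRegular _ hreg
    (Fin.cons (f₀.coeff (e + 2)) (fun i => - (f i).coeff (e + 1))) (by
      rw [Fin.sum_univ_succ]; simpa using h1)
  have hf₀c : f₀.coeff (e + 2) = ∑ j : Fin q, a 0 j.succ * lam j.succ := by
    have := haf 0
    simpa [Fin.sum_univ_succ, ha0] using this
  have hfc : ∀ i, (f i).coeff (e + 1)
      = a 0 i.succ * G - ∑ j : Fin q, a i.succ j.succ * lam j.succ := by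
    intro i
    have := haf i.succ
    simp only [Fin.cons_succ, Fin.sum_univ_succ, Fin.cons_zero] at this
    rw [ha i.succ 0] at this
    linear_combination -this
  have hX : ∀ (k : ℕ) (x : S), (Polynomial.X * Polynomial.monomial k x : S[X]) =
      Polynomial.monomial (k + 1) x := by
    intro k x; rw [X_mul_monomial]
  have hCm : ∀ (k : ℕ) (x y : S), (Polynomial.C x * Polynomial.monomial k y : S[X]) =
      Polynomial.monomial k (x * y) := by
    intro k x y; rw [Polynomial.C_mul_monomial]
  have key1 : ∀ i : Fin q, Polynomial.C G * Polynomial.monomial (e + 2) (a 0 i.succ * lam i.succ)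
      + E i.succ (Polynomial.monomial (e + 1) (a 0 i.succ * G)) ∈ boundedRange G E (e + 1) := by
    intro i
    obtain ⟨μ, hμ⟩ := hG i.succ
    set x : S[X] := Polynomial.monomial (e + 1) (a 0 i.succ) with hx
    have hxd : x ∈ degreeLT S (e + 2) := monomial_mem_degreeLT _ _
    have e1 : (Polynomial.monomial (e + 1) (a 0 i.succ * G) : S[X]) = Polynomial.C G * x := by
      rw [hx, hCm, mul_comm]
    have e2 : (Polynomial.monomial (e + 2) (a 0 i.succ * lam i.succ) : S[X]) =
        Polynomial.X * (Polynomial.C (lam i.succ) * x) := by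
      rw [hx, hCm, hX, mul_comm]
    rw [e1, e2, hμ, hE]
    have : Polynomial.C G * (Polynomial.X * (Polynomial.C (lam i.succ) * x)) +
        Polynomial.C G * (P i.succ x - Polynomial.X * (Polynomial.C (lam i.succ) * x) - Polynomial.C μ * x)
        = Polynomial.C G * (P i.succ x - Polynomial.C μ * x) := by ring
    rw [this]
    exact C_mul_mem_boundedRange (sub_mem (hP _ _ _ hxd) (C_mul_mem_degreeLT hxd _))
  have key2 : ∀ i k : Fin q, ∀ b : S, E i.succ (Polynomial.monomial (e + 1) (b * lam k.succ))
      - E k.succ (Polynomial.monomial (e + 1) (b * lam i.succ)) ∈ boundedRange G E (e + 1) := by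
    intro i k b
    obtain ⟨c, hc⟩ := hcomm i.succ k.succ
    set x : S[X] := Polynomial.monomial e b with hx
    have hxd : x ∈ degreeLT S (e + 1) := monomial_mem_degreeLT _ _
    have e1 : ∀ k : Fin q, (Polynomial.monomial (e + 1) (b * lam k.succ) : S[X])
        = P k.succ x - E k.succ x := by
      intro k
      rw [hE, sub_sub_cancel, hx, hCm, hX, mul_comm]
    rw [e1, e1, map_sub, map_sub]
    have e2 := hc x
    have : E i.succ (P k.succ x) - E i.succ (E k.succ x)
        - (E k.succ (P i.succ x) - E k.succ (E i.succ x))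
        = E i.succ (P k.succ x) - E k.succ (P i.succ x) - ∑ m, E m (Polynomial.C (c m) * x) := by
      rw [← e2]; ring
    rw [this]
    refine sub_mem (sub_mem (apply_mem_boundedRange (hP _ _ _ hxd) _)
      (apply_mem_boundedRange (hP _ _ _ hxd) _)) (sum_mem fun m _ => ?_)
    exact apply_mem_boundedRange (C_mul_mem_degreeLT hxd _) _
  have key3 : ∑ i : Fin q, ∑ j : Fin q, E i.succ (Polynomial.monomial (e + 1) (a i.succ j.succ * lam j.succ))
      ∈ boundedRange G E (e + 1) := by
    have h2 : (2 : ℂ) • ∑ i : Fin q, ∑ j : Fin q,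
        E i.succ (Polynomial.monomial (e + 1) (a i.succ j.succ * lam j.succ))
        = ∑ i : Fin q, ∑ j : Fin q, (E i.succ (Polynomial.monomial (e + 1) (a i.succ j.succ * lam j.succ))
          - E j.succ (Polynomial.monomial (e + 1) (a i.succ j.succ * lam i.succ))) := by
      simp only [Finset.sum_sub_distrib]
      rw [two_smul, sub_eq_add_neg]
      congr 1
      rw [Finset.sum_comm (f := fun i j => E (Fin.succ j) _), ← Finset.sum_neg_distrib]
      refine Finset.sum_congr rfl fun i _ => ?_
      rw [← Finset.sum_neg_distrib]
      refine Finset.sum_congr rfl fun j _ => ?_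
      rw [ha j.succ i.succ, neg_mul, map_neg, map_neg, neg_neg]
    have h3 : (2 : ℂ) • ∑ i : Fin q, ∑ j : Fin q,
        E i.succ (Polynomial.monomial (e + 1) (a i.succ j.succ * lam j.succ)) ∈ boundedRange G E (e + 1) := by
      rw [h2]
      exact sum_mem fun i _ => sum_mem fun j _ => key2 i j _
    have h4 := Submodule.smul_mem _ (2⁻¹ : ℂ) h3
    rwa [smul_smul, inv_mul_cancel₀ two_ne_zero, one_smul] at h4
  have hfin : h = (Polynomial.C G * (f₀ - Polynomial.monomial (e + 2) (f₀.coeff (e + 2)))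
      + ∑ i : Fin q, E i.succ (f i - Polynomial.monomial (e + 1) ((f i).coeff (e + 1))))
      + ∑ i : Fin q, (Polynomial.C G * Polynomial.monomial (e + 2) (a 0 i.succ * lam i.succ)
        + E i.succ (Polynomial.monomial (e + 1) (a 0 i.succ * G)))
      - ∑ i : Fin q, ∑ j : Fin q, E i.succ (Polynomial.monomial (e + 1) (a i.succ j.succ * lam j.succ)) := by
    simp only [hf₀c, hfc, map_sub, map_sum, Finset.sum_add_distrib, Finset.sum_sub_distrib,
      mul_sub, Finset.mul_sum]
    rw [heq]
    ring
  rw [hfin]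
  refine sub_mem (add_mem (add_mem ?_ (sum_mem fun i _ => ?_)) (sum_mem fun i _ => key1 i)) key3
  · exact C_mul_mem_boundedRange (sub_monomial_mem_degreeLT hf₀)
  · exact apply_mem_boundedRange (sub_monomial_mem_degreeLT (hf i)) _

theorem coeff_mem_of_mem_boundedRange
    (hE : ∀ i f, E i f = P i f - Polynomial.X * (Polynomial.C (lam i) * f))
    (hP : ∀ i e, ∀ f ∈ degreeLT S e, P i f ∈ degreeLT S e)
    (hcomm : ∀ i k, ∃ c : Fin (q + 1) → S, ∀ f,
      E i (E k f) - E k (E i f) = ∑ m, E m (Polynomial.C (c m) * f))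
    (hG : ∀ i, ∃ μ : S, ∀ f,
      E i (Polynomial.C G * f) = Polynomial.C G * (E i f - Polynomial.C μ * f))
    (hreg : IsWeaklyRegular S (List.ofFn (Fin.cons G (fun i : Fin q => lam i.succ) :
      Fin (q + 1) → S)))
    (hπ0 : ∀ f, π (E 0 f) = 0)
    (hπE : ∀ i e, ∀ f ∈ degreeLT S e, ∃ f' ∈ degreeLT S e, π (E i f) = E i f')
    (hπG : ∀ e, ∀ f ∈ degreeLT S e, ∃ f' ∈ degreeLT S e,
      π (Polynomial.C G * f) = Polynomial.C G * f')
    {e N : ℕ} {h : S[X]} (hπ : π h = h) (hh : h ∈ boundedRange G E (N + 1 + e))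
    (hN : h ∈ degreeLT S (N + 2)) :
    h.coeff (N + 1) ∈ Ideal.ofList (List.ofFn (Fin.cons G (fun i : Fin q => lam i.succ) :
      Fin (q + 1) → S)) := by
  induction e with
  | zero =>
    obtain ⟨f₀, hf₀, f, hf, heq⟩ := exists_eq_of_mem_boundedRange hπ0 hπE hπG hh
    rw [hπ] at heq
    rw [heq, coeff_eq_of_eq hE hP hf, mem_ofList_ofFn]
    refine ⟨Fin.cons (f₀.coeff (N + 1)) (fun i => - (f i).coeff N), ?_⟩
    rw [Fin.sum_univ_succ]
    simp
  | succ e ih =>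
    apply ih
    have : N + 1 + (e + 1) = N + e + 2 := by ring
    rw [this] at hh
    rw [show N + 1 + e = N + e + 1 by ring]
    refine mem_boundedRange_of_coeff_eq_zero hE hP hcomm hG hreg hπ0 hπE hπG hπ hh ?_
    rw [mem_degreeLT, degree_lt_iff_coeff_zero] at hN
    exact hN _ (by omega)

end LeadingCoefficient

section NormalOrdering
open MvPolynomial

section
variable {σ S : Type*} [CommRing S]

/-- The additive map with prescribed values on monomials. -/
noncomputable def monomialLift {B : Type*} [AddCommMonoid B] (f : (σ →₀ ℕ) → S →+ B) :
    MvPolynomial σ S →+ B :=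
  (Finsupp.liftAddHom f).comp
    ((AddMonoidAlgebra.coeffLinearEquiv S : AddMonoidAlgebra S (σ →₀ ℕ) ≃ₗ[S] _).toAddMonoidHom)

theorem monomialLift_monomial {B : Type*} [AddCommMonoid B] (f : (σ →₀ ℕ) → S →+ B)
    (β : σ →₀ ℕ) (c : S) : monomialLift f (monomial β c) = f β c := by
  have : (AddMonoidAlgebra.coeffLinearEquiv S : AddMonoidAlgebra S (σ →₀ ℕ) ≃ₗ[S] _)
    (monomial β c) = Finsupp.single β c := rfl
  simp only [monomialLift, AddMonoidHom.comp_apply]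
  erw [this]
  simp

/-- The coefficientwise application of an additive map. -/
noncomputable def coeffMap (δ : S →+ S) : MvPolynomial σ S →+ MvPolynomial σ S :=
  monomialLift fun β => (monomial β : S →ₗ[S] MvPolynomial σ S).toAddMonoidHom.comp δ

theorem coeffMap_monomial (δ : S →+ S) (β : σ →₀ ℕ) (c : S) :
    coeffMap δ (monomial β c) = monomial β (δ c) := monomialLift_monomial _ _ _

theorem coeff_coeffMap (δ : S →+ S) (p : MvPolynomial σ S) (β : σ →₀ ℕ) :
    coeff β (coeffMap δ p) = δ (coeff β p) := by
  classical
  induction p using MvPolynomial.induction_on' with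
  | monomial a c =>
    rw [coeffMap_monomial, coeff_monomial, coeff_monomial]; split_ifs <;> simp
  | add p q hp hq => rw [map_add, coeff_add, coeff_add, map_add, hp, hq]

/-- Polynomials all of whose monomials have degree `< n`. -/
def degLT (σ S : Type*) [CommRing S] (n : ℕ) : Submodule S (MvPolynomial σ S) where
  carrier := {p | ∀ β, coeff β p ≠ 0 → β.degree < n}
  add_mem' := by
    intro p q hp hq β h
    rw [coeff_add] at h
    by_cases h1 : coeff β p = 0
    · exact hq β (by intro h2; simp [h1, h2] at h)
    · exact hp β h1
  zero_mem' := by intro β h; simp at h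
  smul_mem' := by
    intro c p hp β h
    refine hp β fun h1 => h ?_
    rw [coeff_smul, h1, smul_zero]

theorem degLT_mono {m n : ℕ} (h : m ≤ n) : degLT σ S m ≤ degLT σ S n :=
  fun _ hp β hβ => (hp β hβ).trans_le h

theorem degLT_zero {p : MvPolynomial σ S} (hp : p ∈ degLT σ S 0) : p = 0 := by
  ext β
  by_contra h
  exact absurd (hp β (by simpa using h)) (by simp)

theorem mem_degLT_totalDegree (p : MvPolynomial σ S) : p ∈ degLT σ S (p.totalDegree + 1) := by
  intro β h
  have := le_totalDegree (mem_support_iff.2 h)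
  exact Nat.lt_succ_of_le this

theorem monomial_mem_degLT (β : σ →₀ ℕ) (c : S) {n : ℕ} (h : β.degree < n) :
    monomial β c ∈ degLT σ S n := by
  classical
  intro γ hγ
  rw [coeff_monomial] at hγ
  split_ifs at hγ with h1
  · rwa [← h1]
  · simp at hγ

theorem mul_mem_degLT {p q : MvPolynomial σ S} {m n : ℕ} (hp : p ∈ degLT σ S (m + 1))
    (hq : q ∈ degLT σ S n) : p * q ∈ degLT σ S (m + n) := by
  classical
  intro β h
  rw [coeff_mul] at h
  obtain ⟨⟨a, b⟩, hab, hne⟩ := Finset.exists_ne_zero_of_sum_ne_zero h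
  rw [Finset.HasAntidiagonal.mem_antidiagonal] at hab
  have h1 := hp a (left_ne_zero_of_mul hne)
  have h2 := hq b (right_ne_zero_of_mul hne)
  simp only at hab
  rw [← hab, map_add]
  omega

theorem degLT_induction {n : ℕ} {motive : MvPolynomial σ S → Prop}
    (hm : ∀ β c, β.degree < n → motive (monomial β c)) (h0 : motive 0)
    (hadd : ∀ p q, motive p → motive q → motive (p + q))
    {p : MvPolynomial σ S} (hp : p ∈ degLT σ S n) : motive p := by
  rw [p.as_sum]
  exact Finset.sum_induction _ motive hadd h0 fun β hβ => hm _ _ (hp β (mem_support_iff.1 hβ))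

theorem coeffMap_mem_degLT (δ : S →+ S) {p : MvPolynomial σ S} {n : ℕ} (hp : p ∈ degLT σ S n) :
    coeffMap δ p ∈ degLT σ S n := by
  refine degLT_induction (motive := fun p => coeffMap δ p ∈ degLT σ S n) ?_ ?_ ?_ hp
  · intro β c h; rw [coeffMap_monomial]; exact monomial_mem_degLT _ _ h
  · rw [map_zero]; exact zero_mem _
  · intro p q hp hq; rw [map_add]; exact add_mem hp hq

theorem rename_mem_degLT {τ : Type*} (e : σ → τ) {p : MvPolynomial σ S} {n : ℕ}
    (hp : p ∈ degLT σ S n) : rename e p ∈ degLT τ S n := by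
  refine degLT_induction (motive := fun p => rename e p ∈ degLT τ S n) ?_ ?_ ?_ hp
  · intro β c h; rw [rename_monomial]
    exact monomial_mem_degLT _ _ (by rwa [Finsupp.degree_mapDomain])
  · rw [map_zero]; exact zero_mem _
  · intro p q hp hq; rw [map_add]; exact add_mem hp hq

theorem _root_.MvPolynomial.IsHomogeneous.mem_degLT {p : MvPolynomial σ S} {n : ℕ}
    (hp : p.IsHomogeneous n) : p ∈ degLT σ S (n + 1) := by
  intro β h
  by_contra h1
  exact h (hp.coeff_eq_zero (by omega))

end

theorem finsupp_induction_add_single_one {J : Type*} {motive : (J →₀ ℕ) → Prop} (zero : motive 0)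
    (add_single : ∀ β j, motive β → motive (β + Finsupp.single j 1)) (β : J →₀ ℕ) : motive β := by
  induction h : β.degree generalizing β with
  | zero => rw [Finsupp.degree_eq_zero_iff] at h; rwa [h]
  | succ n ih =>
    have hne : β ≠ 0 := by rintro rfl; simp at h
    obtain ⟨j, hj⟩ := Finsupp.ne_iff.1 hne
    obtain ⟨γ, rfl⟩ := exists_add_of_le (show Finsupp.single j 1 ≤ β by
      rw [Finsupp.single_le_iff]; exact Nat.one_le_iff_ne_zero.2 hj)
    rw [add_comm]
    refine add_single _ _ (ih _ ?_)
    rw [map_add, Finsupp.degree_single] at h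
    omega

variable {J S B : Type*} [CommRing S] [Ring B]

theorem exists_commuting_monomials (Dv : J → B) (hcomm : ∀ i j, Dv i * Dv j = Dv j * Dv i) :
    ∃ d : (J →₀ ℕ) → B, d 0 = 1 ∧ (∀ β j, d (β + Finsupp.single j 1) = d β * Dv j) ∧
      ∀ β j, Dv j * d β = d β * Dv j := by
  let A := Algebra.adjoin ℤ (Set.range Dv)
  have : IsMulCommutative A := Algebra.isMulCommutative_adjoin ℤ (by
    rintro _ ⟨i, rfl⟩ _ ⟨j, rfl⟩; exact hcomm i j)
  let _ : CommRing A := { (inferInstance : Ring A) with mul_comm := this.is_comm.comm }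
  let f : MvPolynomial J ℤ →+* A :=
    eval₂Hom (Int.castRingHom A) fun j => ⟨Dv j, Algebra.subset_adjoin ⟨j, rfl⟩⟩
  refine ⟨fun β => (f (monomial β 1) : A), ?_, ?_, ?_⟩
  · have : f (monomial 0 1) = 1 := map_one f
    simp only [this]; rfl
  · intro β j
    have h1 : (monomial (β + Finsupp.single j 1) 1 : MvPolynomial J ℤ) = monomial β 1 * X j := by
      rw [X, monomial_mul, mul_one]
    have h2 : f (X j) = ⟨Dv j, Algebra.subset_adjoin ⟨j, rfl⟩⟩ := by simp [f]
    have : f (monomial (β + Finsupp.single j 1) 1)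
      = f (monomial β 1) * ⟨Dv j, Algebra.subset_adjoin ⟨j, rfl⟩⟩ := by rw [h1, map_mul, h2]
    simp only [this]; rfl
  · intro β j
    have : (⟨Dv j, Algebra.subset_adjoin ⟨j, rfl⟩⟩ : A) * f (monomial β 1)
      = f (monomial β 1) * ⟨Dv j, Algebra.subset_adjoin ⟨j, rfl⟩⟩ := mul_comm _ _
    exact congrArg (fun x : A => (x : B)) this

/-- The additive map sending `f ξ^β` to `f D^β`. -/
noncomputable def normalOrder (φ : S →+* B) (d : (J →₀ ℕ) → B) : MvPolynomial J S →+ B :=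
  monomialLift fun β => (AddMonoidHom.mulRight (d β)).comp φ.toAddMonoidHom

section
variable (φ : S →+* B) (d : (J →₀ ℕ) → B) (Dv : J → B) (der : J → S →+ S)

theorem normalOrder_monomial (β : J →₀ ℕ) (c : S) :
    normalOrder φ d (monomial β c) = φ c * d β := monomialLift_monomial _ _ _

theorem normalOrder_C_mul (f : S) (p : MvPolynomial J S) :
    normalOrder φ d (C f * p) = φ f * normalOrder φ d p := by
  induction p using MvPolynomial.induction_on' with
  | monomial a c => rw [C_mul_monomial, normalOrder_monomial, normalOrder_monomial, map_mul, mul_assoc]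
  | add p q hp hq => rw [mul_add, map_add, hp, hq, map_add, mul_add]

theorem normalOrder_C (hd0 : d 0 = 1) (f : S) : normalOrder φ d (C f) = φ f := by
  rw [C_apply, normalOrder_monomial, hd0, mul_one]

theorem normalOrder_X (hd0 : d 0 = 1) (hd : ∀ β j, d (β + Finsupp.single j 1) = d β * Dv j) (j : J) :
    normalOrder φ d (X j) = Dv j := by
  have := hd 0 j
  rw [hd0, zero_add, one_mul] at this
  rw [X, normalOrder_monomial, this, map_one, one_mul]

theorem mul_normalOrder (hd : ∀ β j, d (β + Finsupp.single j 1) = d β * Dv j)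
    (hd' : ∀ β j, Dv j * d β = d β * Dv j)
    (hD : ∀ j f, Dv j * φ f = φ f * Dv j + φ (der j f)) (j : J) (p : MvPolynomial J S) :
    Dv j * normalOrder φ d p = normalOrder φ d (X j * p + coeffMap (der j) p) := by
  induction p using MvPolynomial.induction_on' with
  | monomial a c =>
    rw [map_add, coeffMap_monomial, X, monomial_mul, normalOrder_monomial, normalOrder_monomial,
      normalOrder_monomial, one_mul, add_comm _ a, hd, ← hd', ← mul_assoc, hD, add_mul, mul_assoc]
  | add p q hp hq =>
    rw [map_add, mul_add, hp, hq, ← map_add]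
    congr 1
    rw [map_add]; ring

theorem exists_monomial_mul_normalOrder (hd0 : d 0 = 1)
    (hd : ∀ β j, d (β + Finsupp.single j 1) = d β * Dv j)
    (hd' : ∀ β j, Dv j * d β = d β * Dv j)
    (hD : ∀ j f, Dv j * φ f = φ f * Dv j + φ (der j f)) (β : J →₀ ℕ) (n : ℕ)
    (p : MvPolynomial J S) (hp : p ∈ degLT J S (n + 1)) :
    ∃ low ∈ degLT J S (n + β.degree), d β * normalOrder φ d p
      = normalOrder φ d (monomial β 1 * p + low) := by
  induction β using finsupp_induction_add_single_one generalizing n p with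
  | zero => exact ⟨0, zero_mem _, by rw [hd0, one_mul, add_zero]; congr 1; exact (one_mul p).symm⟩
  | add_single β j ih =>
    have hXp : X j * p ∈ degLT J S (n + 1 + 1) := by
      rw [show n + 1 + 1 = 1 + (n + 1) by ring]
      exact mul_mem_degLT ((isHomogeneous_X S j).mem_degLT) hp
    obtain ⟨l1, hl1, h1⟩ := ih (n + 1) (X j * p) hXp
    obtain ⟨l2, hl2, h2⟩ := ih n (coeffMap (der j) p) (coeffMap_mem_degLT _ hp)
    have hdeg : (β + Finsupp.single j 1).degree = β.degree + 1 := by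
      rw [map_add, Finsupp.degree_single]
    refine ⟨l1 + (monomial β 1 * coeffMap (der j) p + l2), ?_, ?_⟩
    · rw [hdeg]
      refine add_mem (by convert hl1 using 2; ring) (add_mem ?_ (degLT_mono (by omega) hl2))
      have := mul_mem_degLT (monomial_mem_degLT β (1 : S) (Nat.lt_succ_self _))
        (coeffMap_mem_degLT (der j) hp)
      convert this using 2; ring
    · rw [hd, mul_assoc, mul_normalOrder φ d Dv der hd hd' hD, map_add, mul_add, h1, h2, ← map_add]
      congr 1
      rw [← mul_one (1 : S), ← monomial_mul, mul_one, ← X]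
      ring

theorem exists_normalOrder_mul (hd0 : d 0 = 1)
    (hd : ∀ β j, d (β + Finsupp.single j 1) = d β * Dv j)
    (hd' : ∀ β j, Dv j * d β = d β * Dv j)
    (hD : ∀ j f, Dv j * φ f = φ f * Dv j + φ (der j f)) {m n : ℕ}
    {q p : MvPolynomial J S} (hq : q ∈ degLT J S (m + 1)) (hp : p ∈ degLT J S (n + 1)) :
    ∃ low ∈ degLT J S (n + m), normalOrder φ d q * normalOrder φ d p
      = normalOrder φ d (q * p + low) := by
  refine degLT_induction (motive := fun q => ∃ low ∈ degLT J S (n + m),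
    normalOrder φ d q * normalOrder φ d p = normalOrder φ d (q * p + low)) ?_ ?_ ?_ hq
  · intro β c hβ
    obtain ⟨l, hl, h⟩ := exists_monomial_mul_normalOrder φ d Dv der hd0 hd hd' hD β n p hp
    refine ⟨C c * l, ?_, ?_⟩
    · rw [← smul_eq_C_mul]
      exact Submodule.smul_mem _ _ (degLT_mono (by omega) hl)
    · rw [normalOrder_monomial, mul_assoc, h, ← normalOrder_C_mul]
      congr 1
      rw [mul_add, ← mul_assoc, C_mul_monomial, mul_one]
  · exact ⟨0, zero_mem _, by simp⟩
  · rintro q₁ q₂ ⟨l₁, hl₁, h₁⟩ ⟨l₂, hl₂, h₂⟩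
    refine ⟨l₁ + l₂, add_mem hl₁ hl₂, ?_⟩
    rw [map_add, add_mul, h₁, h₂, ← map_add]
    congr 1; ring

end

end NormalOrdering

section AnnihilatorNormalForm
open MvPolynomial

variable {J κ S B M : Type*} [CommRing S] [Ring B] [AddCommGroup M] [Module B M]
  (φ : S →+* B) (d : (J →₀ ℕ) → B) (Dv : J → B) (der : J → S →+ S)
  (e : κ → J) (jj : MvPolynomial κ S →+ M) (G : S) (ω : J → MvPolynomial κ S)

theorem leibniz_pow_of_leibniz (δ : S →+ S) (h : ∀ a b, δ (a * b) = a * δ b + b * δ a) (a : S)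
    (n : ℕ) : a * δ (a ^ n) = n * δ a * a ^ n := by
  induction n with
  | zero =>
    have : δ 1 = 0 := by have := h 1 1; simpa using this
    simp [this]
  | succ n ih =>
    rw [pow_succ, h]
    push_cast
    linear_combination a * ih

theorem exists_pow_smul_monomial_smul
    (hd0 : d 0 = 1) (hd : ∀ β j, d (β + Finsupp.single j 1) = d β * Dv j)
    (hd' : ∀ β j, Dv j * d β = d β * Dv j)
    (hD : ∀ j f, Dv j * φ f = φ f * Dv j + φ (der j f))
    (hder : ∀ j a b, der j (a * b) = a * der j b + b * der j a)
    (hjj : ∀ f a, φ f • jj a = jj (C f * a))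
    (hω : ∀ j, ω j ∈ degLT κ S 2)
    (hDjj : ∀ j a, φ G • Dv j • jj a = jj (C G * coeffMap (der j) a + ω j * a)) (β : J →₀ ℕ) :
    ∃ P ∈ degLT κ S (β.degree + 1), φ (G ^ β.degree) • d β • jj 1 = jj P ∧
      ∃ g ∈ Ideal.span (Set.range fun j => C G * X j - rename e (ω j)),
        C (G ^ β.degree) * monomial β 1 - rename e P - g ∈ degLT J S β.degree := by
  induction β using finsupp_induction_add_single_one with
  | zero =>
    refine ⟨1, (isHomogeneous_one κ S).mem_degLT, by simp [hd0], 0, zero_mem _, ?_⟩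
    have : (C (G ^ (0 : J →₀ ℕ).degree) * monomial 0 1 - rename e (1 : MvPolynomial κ S) - 0
      : MvPolynomial J S) = 0 := by
      rw [map_one (rename e), map_zero, pow_zero, C_1, one_mul, sub_zero, sub_eq_zero]; rfl
    rw [this]; exact zero_mem _
  | add_single β j ih =>
    obtain ⟨P, hP, hPeq, g, hg, hlow⟩ := ih
    set n := β.degree with hn
    have hdeg : (β + Finsupp.single j 1).degree = n + 1 := by
      rw [map_add, Finsupp.degree_single]
    rw [hdeg]
    have hr1 : C G * coeffMap (der j) P - (n : MvPolynomial κ S) * C (der j G) * P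
        ∈ degLT κ S (n + 1) := by
      refine sub_mem ?_ ?_
      · rw [← smul_eq_C_mul]; exact Submodule.smul_mem _ _ (coeffMap_mem_degLT _ hP)
      · have : ((n : MvPolynomial κ S) * C (der j G) * P) = ((n : S) * der j G) • P := by
          rw [smul_eq_C_mul, map_mul]; simp
        rw [this]; exact Submodule.smul_mem _ _ hP
    refine ⟨ω j * P + (C G * coeffMap (der j) P - (n : MvPolynomial κ S) * C (der j G) * P),
      ?_, ?_, X j * C G * g + rename e P * (C G * X j - rename e (ω j)), ?_, ?_⟩
    · refine add_mem ?_ (degLT_mono (by omega) hr1)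
      have := mul_mem_degLT (hω j) hP
      convert this using 2; ring
    · have h1 : d (β + Finsupp.single j 1) • jj 1 = Dv j • d β • jj 1 := by
        rw [hd, ← hd', mul_smul]
      have h2 : φ (G ^ (n + 1)) * Dv j = φ G * Dv j * φ (G ^ n) - φ ((n : S) * der j G) * φ (G ^ n) := by
        have h3 := leibniz_pow_of_leibniz (der j) (hder j) G n
        rw [mul_assoc, hD, mul_add, ← map_mul, h3, pow_succ', map_mul, map_mul φ (_ * _) (_ ^ n)]
        simp only [mul_assoc]
        abel
      rw [h1, ← mul_smul, h2, sub_smul, mul_smul, mul_smul (φ _) (φ (G ^ n)), hPeq, mul_smul, hDjj,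
        hjj, ← map_sub]
      congr 1
      rw [map_mul]; simp only [map_natCast]
      ring
    · refine add_mem (Ideal.mul_mem_left _ _ hg) (Ideal.mul_mem_left _ _ (Ideal.subset_span ⟨j, rfl⟩))
    · have h1 : (monomial (β + Finsupp.single j 1) 1 : MvPolynomial J S) = monomial β 1 * X j := by
        rw [X, monomial_mul, mul_one]
      have h2 : X j * (C G * (C (G ^ n) * monomial β 1 - rename e P - g)) ∈ degLT J S (1 + n) := by
        refine mul_mem_degLT ((isHomogeneous_X S j).mem_degLT) ?_
        rw [← smul_eq_C_mul]; exact Submodule.smul_mem _ _ hlow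
      have h3 := sub_mem h2 (degLT_mono (show n + 1 ≤ 1 + n by omega) (rename_mem_degLT e hr1))
      rw [add_comm 1 n] at h3
      convert h3 using 1
      rw [h1, pow_succ, map_mul, map_add, map_mul]
      ring

theorem exists_pow_smul_normalOrder_smul
    (hd0 : d 0 = 1) (hd : ∀ β j, d (β + Finsupp.single j 1) = d β * Dv j)
    (hd' : ∀ β j, Dv j * d β = d β * Dv j)
    (hD : ∀ j f, Dv j * φ f = φ f * Dv j + φ (der j f))
    (hder : ∀ j a b, der j (a * b) = a * der j b + b * der j a)
    (hjj : ∀ f a, φ f • jj a = jj (C f * a))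
    (hω : ∀ j, ω j ∈ degLT κ S 2)
    (hDjj : ∀ j a, φ G • Dv j • jj a = jj (C G * coeffMap (der j) a + ω j * a)) {n : ℕ}
    {p : MvPolynomial J S} (hp : p ∈ degLT J S (n + 1)) :
    ∃ P, φ (G ^ n) • normalOrder φ d p • jj 1 = jj P ∧
      ∃ g ∈ Ideal.span (Set.range fun j => C G * X j - rename e (ω j)),
        C (G ^ n) * p - rename e P - g ∈ degLT J S n := by
  refine degLT_induction (motive := fun p => ∃ P, φ (G ^ n) • normalOrder φ d p • jj 1 = jj P ∧
      ∃ g ∈ Ideal.span (Set.range fun j => C G * X j - rename e (ω j)),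
        C (G ^ n) * p - rename e P - g ∈ degLT J S n) ?_ ?_ ?_ hp
  · intro β c hβ
    obtain ⟨P, -, hPeq, g, hg, hlow⟩ := exists_pow_smul_monomial_smul φ d Dv der e jj G ω hd0 hd hd'
      hD hder hjj hω hDjj β
    obtain ⟨m, rfl⟩ : ∃ m, n = β.degree + m := ⟨n - β.degree, by omega⟩
    refine ⟨C (c * G ^ m) * P, ?_, C (c * G ^ m) * g, Ideal.mul_mem_left _ _ hg, ?_⟩
    · rw [← hjj, ← hPeq, normalOrder_monomial, ← mul_smul, ← mul_smul, ← mul_smul, ← mul_assoc,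
        ← map_mul, ← map_mul]
      congr 3; ring
    · have : C (G ^ (β.degree + m)) * monomial β c - rename e (C (c * G ^ m) * P)
          - C (c * G ^ m) * g
          = (c * G ^ m) • (C (G ^ β.degree) * monomial β 1 - rename e P - g) := by
        have h1 : (monomial β c : MvPolynomial J S) = C c * monomial β 1 := by
          rw [C_mul_monomial, mul_one]
        rw [h1, smul_eq_C_mul]
        simp only [pow_add, map_mul, rename_C]
        ring
      rw [this]
      exact Submodule.smul_mem _ _ (degLT_mono (by omega) hlow)
  · exact ⟨0, by simp, 0, zero_mem _, by simp⟩
  · rintro q₁ q₂ ⟨P₁, h₁, g₁, hg₁, hl₁⟩ ⟨P₂, h₂, g₂, hg₂, hl₂⟩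
    refine ⟨P₁ + P₂, by rw [map_add, add_smul, smul_add, h₁, h₂, map_add], g₁ + g₂,
      add_mem hg₁ hg₂, ?_⟩
    convert add_mem hl₁ hl₂ using 1
    rw [map_add]; ring

theorem exists_normalOrder_eq_sum {I : Type*} [Fintype I] (τ : I → MvPolynomial J S)
    (hd0 : d 0 = 1) (hd : ∀ β j, d (β + Finsupp.single j 1) = d β * Dv j)
    (hd' : ∀ β j, Dv j * d β = d β * Dv j)
    (hD : ∀ j f, Dv j * φ f = φ f * Dv j + φ (der j f))
    (hder : ∀ j a b, der j (a * b) = a * der j b + b * der j a)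
    (hjj : ∀ f a, φ f • jj a = jj (C f * a))
    (hω : ∀ j, ω j ∈ degLT κ S 2)
    (hDjj : ∀ j a, φ G • Dv j • jj a = jj (C G * coeffMap (der j) a + ω j * a))
    (hinj : Function.Injective jj)
    (hτ : ∀ i, (τ i).IsHomogeneous 1)
    (hgτ : ∀ j, C G * X j - rename e (ω j) ∈ Ideal.span (Set.range τ))
    (hreg : ∀ w, C G * w ∈ Ideal.span (Set.range τ) → w ∈ Ideal.span (Set.range τ))
    (hann : ∀ i, normalOrder φ d (τ i) • jj 1 = 0)
    (p : MvPolynomial J S) (hp : normalOrder φ d p • jj 1 = 0) :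
    ∃ q : I → MvPolynomial J S,
      normalOrder φ d p = ∑ i, normalOrder φ d (q i) * normalOrder φ d (τ i) := by
  obtain ⟨n, hn⟩ : ∃ n, p ∈ degLT J S n := ⟨_, mem_degLT_totalDegree p⟩
  induction n generalizing p with
  | zero => exact ⟨0, by simp [degLT_zero hn]⟩
  | succ n ih =>
    obtain ⟨P, hP, g, hg, hlow⟩ := exists_pow_smul_normalOrder_smul φ d Dv der e jj G ω hd0 hd hd'
      hD hder hjj hω hDjj hn
    rw [hp, smul_zero, eq_comm, ← map_zero jj] at hP
    have hP0 := hinj hP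
    subst hP0
    rw [map_zero, sub_zero] at hlow
    have hcomp : ∀ w ∈ Ideal.span (Set.range τ), ∃ b : I → MvPolynomial J S,
        (∀ i, b i ∈ degLT J S n) ∧ homogeneousComponent n w = ∑ i, b i * τ i := by
      intro w hw
      obtain ⟨a, rfl⟩ := Ideal.mem_span_range_iff_exists_fun.1 hw
      refine ⟨fun i => if 1 ≤ n then homogeneousComponent (n - 1) (a i) else 0, fun i => ?_, ?_⟩
      · dsimp only
        split_ifs with h
        · have := (homogeneousComponent_isHomogeneous (n - 1) (a i)).mem_degLT
          rwa [Nat.sub_add_cancel h] at this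
        · exact zero_mem _
      · rw [map_sum]
        refine Finset.sum_congr rfl fun i _ => ?_
        rw [mul_comm, homogeneousComponent_mul_of_isHomogeneous (hτ i)]
        split_ifs <;> ring
    have hpow : ∀ k w, C (G ^ k) * w ∈ Ideal.span (Set.range τ) → w ∈ Ideal.span (Set.range τ) := by
      intro k
      induction k with
      | zero => intro w hw; simpa using hw
      | succ k ih' =>
        intro w hw
        refine ih' w (hreg _ ?_)
        rwa [← mul_assoc, ← C_mul, ← pow_succ']
    have hgspan : g ∈ Ideal.span (Set.range τ) := by
      refine (Ideal.span_le.2 ?_) hg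
      rintro _ ⟨j, rfl⟩; exact hgτ j
    have hc0 : ∀ w ∈ degLT J S n, homogeneousComponent n w = 0 := by
      intro w hw
      refine homogeneousComponent_eq_zero' _ _ fun β hβ => ?_
      have := hw β (mem_support_iff.1 hβ)
      omega
    have htop : homogeneousComponent n p ∈ Ideal.span (Set.range τ) := by
      apply hpow n
      rw [← homogeneousComponent_C_mul]
      have h1 := hc0 _ hlow
      rw [map_sub, sub_eq_zero] at h1
      rw [h1]
      obtain ⟨b, -, hb⟩ := hcomp g hgspan
      rw [hb]
      exact sum_mem fun i _ => Ideal.mul_mem_left _ _ (Ideal.subset_span ⟨i, rfl⟩)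
    obtain ⟨b, hb, hbeq⟩ := hcomp _ htop
    have hidem : homogeneousComponent n (homogeneousComponent n p) = homogeneousComponent n p := by
      rw [homogeneousComponent_of_mem (homogeneousComponent_isHomogeneous n p), if_pos rfl]
    rw [hidem] at hbeq
    have hlows : ∀ i, ∃ low ∈ degLT J S n, normalOrder φ d (b i) * normalOrder φ d (τ i)
        = normalOrder φ d (b i * τ i + low) := by
      intro i
      rcases n with _ | n
      · exact ⟨0, zero_mem _, by rw [degLT_zero (hb i)]; simp⟩
      · obtain ⟨low, h1, h2⟩ := exists_normalOrder_mul φ d Dv der hd0 hd hd' hD (hb i) (hτ i).mem_degLT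
        exact ⟨low, degLT_mono (by omega) h1, h2⟩
    choose low hlowmem hloweq using hlows
    have hrest : p - ∑ i, (b i * τ i + low i) ∈ degLT J S n := by
      rw [Finset.sum_add_distrib, ← hbeq, ← sub_sub]
      refine sub_mem ?_ (sum_mem fun i _ => hlowmem i)
      intro β hβ
      rw [coeff_sub, coeff_homogeneousComponent] at hβ
      by_contra hlt
      split_ifs at hβ with h
      · simp at hβ
      · rw [sub_zero] at hβ
        have := hn β hβ
        omega
    have hNsum : normalOrder φ d (∑ i, (b i * τ i + low i))
        = ∑ i, normalOrder φ d (b i) * normalOrder φ d (τ i) := by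
      rw [map_sum]; exact Finset.sum_congr rfl fun i _ => (hloweq i).symm
    obtain ⟨q, hq⟩ := ih (p - ∑ i, (b i * τ i + low i)) (by
      rw [map_sub, sub_smul, hp, hNsum, Finset.sum_smul, zero_sub, neg_eq_zero]
      refine Finset.sum_eq_zero fun i _ => ?_
      rw [mul_smul, hann, smul_zero]) hrest
    refine ⟨fun i => q i + b i, ?_⟩
    rw [map_sub, hNsum, sub_eq_iff_eq_add] at hq
    rw [hq, ← Finset.sum_add_distrib]
    exact Finset.sum_congr rfl fun i _ => by rw [map_add, add_mul]

end AnnihilatorNormalForm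

section LinearForms
open MvPolynomial

variable {σ : Type*} [Fintype σ]

/-- The linear form with coefficient vector `c`. -/
noncomputable def linForm (c : σ → ℂ) : MvPolynomial σ ℂ := ∑ j, C (c j) * X j

theorem linForm_isHomogeneous (c : σ → ℂ) : (linForm c).IsHomogeneous 1 :=
  IsHomogeneous.sum _ _ _ fun _ _ => isHomogeneous_C_mul_X _ _

theorem coeff_single_linForm (c : σ → ℂ) (j : σ) : (linForm c).coeff (Finsupp.single j 1) = c j := by
  classical
  rw [linForm, coeff_sum, Finset.sum_eq_single j]
  · rw [coeff_C_mul, coeff_X_same]; simp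
  · intro b _ hb
    rw [coeff_C_mul, coeff_single_X, if_neg (by simp [hb]), mul_zero]
  · simp

theorem linForm_injective : Function.Injective (linForm : (σ → ℂ) → MvPolynomial σ ℂ) := by
  intro c c' h
  ext j
  rw [← coeff_single_linForm c, h, coeff_single_linForm]

theorem eval_linForm (c y : σ → ℂ) : eval y (linForm c) = ∑ j, c j * y j := by
  simp [linForm]

theorem pderiv_linForm (c : σ → ℂ) (j : σ) : pderiv j (linForm c) = C (c j) := by
  classical
  rw [linForm, map_sum, Finset.sum_eq_single j]
  · simp
  · intro b _ hb
    rw [pderiv_C_mul, pderiv_X_of_ne hb]; simp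
  · simp

theorem linForm_ne_zero {c : σ → ℂ} (hc : c ≠ 0) : linForm c ≠ 0 := fun h => hc <|
  linForm_injective (h.trans (by simp [linForm]))

theorem irreducible_linForm_add_C {c : σ → ℂ} (hc : c ≠ 0) (a : ℂ) :
    Irreducible (linForm c + C a) := by
  classical
  obtain ⟨j, hj⟩ := Function.ne_iff.1 hc
  have hcoe : (linForm c + C a).coeff (Finsupp.single j 1) = c j := by
    rw [coeff_add, coeff_single_linForm, coeff_C, if_neg, add_zero]
    exact fun h => by simpa using (DFunLike.congr_fun h j).symm
  refine irreducible_of_totalDegree_eq_one (le_antisymm ?_ ?_) ?_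
  · refine (totalDegree_add _ _).trans (max_le ?_ (by simp))
    exact (linForm_isHomogeneous c).totalDegree_le
  · have := le_totalDegree (p := linForm c + C a) (s := Finsupp.single j 1)
      (by rw [mem_support_iff, hcoe]; exact hj)
    simpa using this
  · intro x hx
    have := hx (Finsupp.single j 1)
    rw [hcoe] at this
    exact isUnit_iff_ne_zero.2 fun h => hj (by simpa [h] using this)

theorem irreducible_linForm {c : σ → ℂ} (hc : c ≠ 0) : Irreducible (linForm c) := by
  simpa using irreducible_linForm_add_C hc 0

theorem associated_linForm_add_C {c c' : σ → ℂ} {a a' : ℂ}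
    (h : Associated (linForm c + C a) (linForm c' + C a')) : ∃ t : ℂ, t ≠ 0 ∧ c = t • c' ∧ a = t * a' := by
  classical
  obtain ⟨u, hu⟩ := h.symm
  obtain ⟨t, ht, htu⟩ := MvPolynomial.isUnit_iff_eq_C_of_isReduced.1 u.isUnit
  rw [htu] at hu
  refine ⟨t, ht.ne_zero, ?_, ?_⟩
  · ext j
    have h1 := congrArg (coeff (Finsupp.single j 1)) hu
    have h0 : (0 : σ →₀ ℕ) ≠ Finsupp.single j 1 :=
      fun h => by simpa using (DFunLike.congr_fun h j)
    rw [mul_comm, coeff_C_mul, coeff_add, coeff_add, coeff_single_linForm, coeff_single_linForm, coeff_C,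
      coeff_C, if_neg h0, if_neg h0, add_zero, add_zero] at h1
    simpa using h1.symm
  · have h1 := congrArg (eval 0) hu
    simp only [map_mul, map_add, eval_C, eval_linForm] at h1
    simp at h1
    rw [← h1, mul_comm]

end LinearForms

section LogarithmicFields
open MvPolynomial

variable {q : ℕ} {K : Type*} (c : K → Fin (q + 1) → ℂ)

/-- The vector fields on `ℂ^(q+1)` that are logarithmic along the hyperplanes `c k ⬝ᵥ y = 0`. -/
noncomputable def logFields :
    Submodule (MvPolynomial (Fin (q + 1)) ℂ) (Fin (q + 1) → MvPolynomial (Fin (q + 1)) ℂ) where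
  carrier := {f | ∀ k, linForm (c k) ∣ ∑ j, C (c k j) * f j}
  add_mem' := fun hx hy k => by
    simpa [mul_add, Finset.sum_add_distrib] using dvd_add (hx k) (hy k)
  zero_mem' := fun k => by simp
  smul_mem' := fun r f hf k => by
    have : ∑ j, C (c k j) * (r • f) j = r * ∑ j, C (c k j) * f j := by
      rw [Finset.mul_sum]
      exact Finset.sum_congr rfl fun j _ => by simp; ring
    rw [this]
    exact (hf k).mul_left r

/-- The submodule of `logFields c` generated by the multiples by coordinates. -/
noncomputable def maxSmulLogFields :
    Submodule (MvPolynomial (Fin (q + 1)) ℂ) (Fin (q + 1) → MvPolynomial (Fin (q + 1)) ℂ) :=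
  LinearMap.range (∑ i : Fin (q + 1),
    (X i : MvPolynomial (Fin (q + 1)) ℂ) •
      ((logFields c).subtype ∘ₗ LinearMap.proj (φ := fun _ => logFields c) i))

theorem mem_maxSmulLogFields {f : Fin (q + 1) → MvPolynomial (Fin (q + 1)) ℂ} :
    f ∈ maxSmulLogFields c ↔ ∃ g : Fin (q + 1) → logFields c,
      f = ∑ i, (X i : MvPolynomial (Fin (q + 1)) ℂ) • (g i).1 := by
  rw [maxSmulLogFields, LinearMap.mem_range]
  simp [eq_comm]

theorem smul_mem_maxSmulLogFields {f : Fin (q + 1) → MvPolynomial (Fin (q + 1)) ℂ}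
    (hf : f ∈ logFields c) {p : MvPolynomial (Fin (q + 1)) ℂ} (hp : eval 0 p = 0) :
    p • f ∈ maxSmulLogFields c := by
  have hmem : p ∈ Ideal.span (Set.range (X : Fin (q + 1) → MvPolynomial (Fin (q + 1)) ℂ)) := by
    rw [← Set.image_univ, mem_ideal_span_X_image]
    intro m hm
    by_contra! h
    have h0 : m = 0 := Finsupp.ext fun i => h i (Set.mem_univ i)
    rw [mem_support_iff, h0, ← constantCoeff_eq, ← eval_zero] at hm
    exact hm hp
  obtain ⟨a, rfl⟩ := Ideal.mem_span_range_iff_exists_fun.1 hmem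
  rw [mem_maxSmulLogFields]
  refine ⟨fun i => ⟨a i • f, Submodule.smul_mem _ _ hf⟩, ?_⟩
  rw [Finset.sum_smul]
  exact Finset.sum_congr rfl fun i _ => by rw [mul_comm, mul_smul]

/-- The homogeneous component of a vector of polynomials. -/
noncomputable def vecComponent (d : ℕ) : (Fin (q + 1) → MvPolynomial (Fin (q + 1)) ℂ) →ₗ[ℂ]
    (Fin (q + 1) → MvPolynomial (Fin (q + 1)) ℂ) :=
  LinearMap.pi fun j => homogeneousComponent d ∘ₗ LinearMap.proj j

theorem vecComponent_apply (d : ℕ) (f : Fin (q + 1) → MvPolynomial (Fin (q + 1)) ℂ)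
    (j : Fin (q + 1)) : vecComponent d f j = homogeneousComponent d (f j) := rfl

theorem vecComponent_isHomogeneous (d : ℕ) (f : Fin (q + 1) → MvPolynomial (Fin (q + 1)) ℂ)
    (j : Fin (q + 1)) : (vecComponent d f j).IsHomogeneous d :=
  homogeneousComponent_isHomogeneous _ _

theorem vecComponent_of_isHomogeneous {d e : ℕ} {f : Fin (q + 1) → MvPolynomial (Fin (q + 1)) ℂ}
    (hf : ∀ j, (f j).IsHomogeneous e) : vecComponent d f = if e = d then f else 0 := by
  ext1 j
  rw [vecComponent_apply, homogeneousComponent_of_mem (hf j)]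
  by_cases h : e = d
  · rw [if_pos h.symm, if_pos h]
  · rw [if_neg (Ne.symm h), if_neg h, Pi.zero_apply]

theorem vecComponent_smul {d e : ℕ} {p : MvPolynomial (Fin (q + 1)) ℂ} (hp : p.IsHomogeneous e)
    (f : Fin (q + 1) → MvPolynomial (Fin (q + 1)) ℂ) :
    vecComponent d (p • f) = if e ≤ d then p • vecComponent (d - e) f else 0 := by
  ext1 j
  rw [vecComponent_apply, Pi.smul_apply, smul_eq_mul,
    homogeneousComponent_mul_of_isHomogeneous hp]
  split_ifs <;> simp [vecComponent_apply]

theorem exists_sum_vecComponent (f : Fin (q + 1) → MvPolynomial (Fin (q + 1)) ℂ) :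
    ∃ n, f = ∑ d ∈ Finset.range n, vecComponent d f := by
  refine ⟨(Finset.univ.sup fun j => (f j).totalDegree) + 1, ?_⟩
  ext1 j
  rw [Finset.sum_apply]
  conv_lhs => rw [← sum_homogeneousComponent (f j)]
  refine Finset.sum_subset (fun d hd => ?_) fun d _ hd => ?_
  · rw [Finset.mem_range] at hd ⊢
    have : (f j).totalDegree ≤ _ :=
      Finset.le_sup (f := fun j => (f j).totalDegree) (Finset.mem_univ j)
    omega
  · rw [Finset.mem_range] at hd
    exact homogeneousComponent_eq_zero _ _ (by omega)

theorem vecComponent_mem_logFields {f : Fin (q + 1) → MvPolynomial (Fin (q + 1)) ℂ}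
    (hf : f ∈ logFields c) (d : ℕ) : vecComponent d f ∈ logFields c := by
  intro k
  obtain ⟨g, hg⟩ := hf k
  have : ∑ j, C (c k j) * vecComponent d f j = homogeneousComponent d (∑ j, C (c k j) * f j) := by
    rw [map_sum]
    exact Finset.sum_congr rfl fun j _ => by rw [homogeneousComponent_C_mul, vecComponent_apply]
  rw [this, hg, homogeneousComponent_mul_of_isHomogeneous (linForm_isHomogeneous _)]
  split_ifs
  · exact dvd_mul_right _ _
  · exact dvd_zero _

theorem euler_mem_logFields : (X : Fin (q + 1) → MvPolynomial (Fin (q + 1)) ℂ) ∈ logFields c :=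
  fun _ => dvd_rfl

variable {c}

theorem eq_zero_of_isHomogeneous_zero (hc : ∀ k, c k ≠ 0)
    (hspan : ∀ y, (∀ k, c k ⬝ᵥ y = 0) → y = 0)
    {f : Fin (q + 1) → MvPolynomial (Fin (q + 1)) ℂ}
    (hf : f ∈ logFields c) (hf0 : ∀ j, (f j).IsHomogeneous 0) : f = 0 := by
  have h1 : ∀ j, f j = C (coeff 0 (f j)) := fun j =>
    totalDegree_eq_zero_iff_eq_C.1 (Nat.le_zero.1 (hf0 j).totalDegree_le)
  have h2 : (fun j => coeff 0 (f j)) = 0 := by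
    refine hspan _ fun k => ?_
    have h3 := hf k
    have h4 : ∑ j, C (c k j) * f j = C (c k ⬝ᵥ fun j => coeff 0 (f j)) := by
      rw [dotProduct, map_sum]
      exact Finset.sum_congr rfl fun j _ => by rw [C_mul, ← h1]
    rw [h4] at h3
    by_contra h5
    exact (irreducible_linForm (hc k)).not_isUnit
      (isUnit_of_dvd_unit h3 ((isUnit_iff_ne_zero.2 h5).map C))
  ext1 j
  rw [h1, congrFun h2 j]
  simp

theorem linForm_dvd_linForm {σ : Type*} [Fintype σ] {a b : σ → ℂ} (h : linForm a ∣ linForm b) :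
    ∃ t : ℂ, b = t • a := by
  obtain ⟨g, hg⟩ := h
  have h1 := congrArg (homogeneousComponent 1) hg
  rw [homogeneousComponent_mul_of_isHomogeneous (linForm_isHomogeneous _), if_pos le_rfl,
    homogeneousComponent_of_mem (linForm_isHomogeneous _), if_pos rfl, Nat.sub_self,
    homogeneousComponent_zero] at h1
  refine ⟨coeff 0 g, funext fun j => ?_⟩
  have := congrArg (coeff (Finsupp.single j 1)) h1
  rw [mul_comm, coeff_C_mul, coeff_single_linForm, coeff_single_linForm] at this
  simpa using this

theorem exists_linForm_eq {σ : Type*} [Fintype σ] {f : MvPolynomial σ ℂ} (hf : f.IsHomogeneous 1) :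
    ∃ a, f = linForm a := by
  classical
  refine ⟨fun j => coeff (Finsupp.single j 1) f, ?_⟩
  ext β
  by_cases hβ : β.degree = 1
  · obtain ⟨j, rfl⟩ : ∃ j, β = Finsupp.single j 1 := by
      obtain ⟨j, hj⟩ : ∃ j, β j ≠ 0 := by
        by_contra! h
        rw [show β = 0 from Finsupp.ext h] at hβ
        simp at hβ
      refine ⟨j, ?_⟩
      have h1 : Finsupp.single j 1 ≤ β := by
        rw [Finsupp.single_le_iff]; omega
      obtain ⟨γ, rfl⟩ := exists_add_of_le h1
      rw [map_add, Finsupp.degree_single, Nat.add_eq_left, Finsupp.degree_eq_zero_iff] at hβ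
      rw [hβ, add_zero]
    rw [coeff_single_linForm]
  · rw [hf.coeff_eq_zero hβ, (linForm_isHomogeneous _).coeff_eq_zero hβ]

theorem exists_eq_smul_of_isHomogeneous_one
    (hspan : ∀ y, (∀ k, c k ⬝ᵥ y = 0) → y = 0)
    (hirr : ∀ V₁ V₂ : Submodule ℂ (Fin (q + 1) → ℂ), IsCompl V₁ V₂ →
      (∀ k, (∀ y ∈ V₁, c k ⬝ᵥ y = 0) ∨ ∀ y ∈ V₂, c k ⬝ᵥ y = 0) →
      (∃ k, ∀ y ∈ V₁, c k ⬝ᵥ y = 0) → ¬ ∃ k, ∀ y ∈ V₂, c k ⬝ᵥ y = 0)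
    {f : Fin (q + 1) → MvPolynomial (Fin (q + 1)) ℂ}
    (hf : f ∈ logFields c) (hf1 : ∀ j, (f j).IsHomogeneous 1) : ∃ t : ℂ, f = t • X := by
  choose A hA using fun j => exists_linForm_eq (hf1 j)
  have h1 : ∀ k, ∃ μ : ℂ, ∀ y, c k ⬝ᵥ (Matrix.of A).mulVec y = μ * (c k ⬝ᵥ y) := by
    intro k
    have h2 := hf k
    have h3 : ∑ j, C (c k j) * f j = linForm (Matrix.vecMul (c k) (Matrix.of A)) := by
      simp only [hA, linForm, Finset.mul_sum, Matrix.vecMul, dotProduct, map_sum, Finset.sum_mul]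
      rw [Finset.sum_comm]
      simp [mul_assoc]
    rw [h3] at h2
    obtain ⟨t, ht⟩ := linForm_dvd_linForm h2
    refine ⟨t, fun y => ?_⟩
    rw [Matrix.dotProduct_mulVec, ht, smul_dotProduct, smul_eq_mul]
  choose μ hμ using h1
  obtain ⟨k₀⟩ : Nonempty K := by
    by_contra h
    rw [not_nonempty_iff] at h
    have := congrFun (hspan 1 fun k => h.elim k) 0
    simp at this
  let T : (Fin (q + 1) → ℂ) →ₗ[ℂ] (Fin (q + 1) → ℂ) :=
    (Matrix.of A).mulVecLin - μ k₀ • LinearMap.id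
  have hT : ∀ k y, c k ⬝ᵥ T y = (μ k - μ k₀) * (c k ⬝ᵥ y) := by
    intro k y
    simp only [T, LinearMap.sub_apply, Matrix.mulVecLin_apply, LinearMap.smul_apply,
      LinearMap.id_apply, dotProduct_sub, hμ, dotProduct_smul, smul_eq_mul]
    ring
  have hcompl : IsCompl (LinearMap.ker T) (LinearMap.range T) := by
    have hdis : Disjoint (LinearMap.ker T) (LinearMap.range T) := by
      rw [Submodule.disjoint_def]
      rintro _ hx ⟨y, rfl⟩
      refine hspan _ fun k => ?_
      have h4 : c k ⬝ᵥ T (T y) = 0 := by rw [LinearMap.mem_ker.1 hx]; simp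
      rw [hT, hT, ← mul_assoc] at h4
      rw [hT]
      rcases mul_eq_zero.1 h4 with h | h
      · rw [mul_self_eq_zero.1 h, zero_mul]
      · rw [h, mul_zero]
    refine ⟨hdis, codisjoint_iff.2 (Submodule.eq_top_of_disjoint _ _ ?_ hdis)⟩
    exact (LinearMap.finrank_range_add_finrank_ker T).symm.le.trans (add_comm _ _).le
  have hdich : ∀ k, (μ k ≠ μ k₀ → ∀ y ∈ LinearMap.ker T, c k ⬝ᵥ y = 0) ∧
      (μ k = μ k₀ → ∀ y ∈ LinearMap.range T, c k ⬝ᵥ y = 0) := by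
    refine fun k => ⟨fun h y hy => ?_, ?_⟩
    · have h4 := hT k y
      rw [LinearMap.mem_ker.1 hy, dotProduct_zero, eq_comm, mul_eq_zero] at h4
      exact h4.resolve_left (sub_ne_zero.2 h)
    · rintro h _ ⟨y, rfl⟩
      rw [hT, h, sub_self, zero_mul]
  have hall : ∀ k, μ k = μ k₀ := by
    intro k
    by_contra h
    refine hirr _ _ hcompl (fun k => ?_) ⟨k, (hdich k).1 h⟩ ⟨k₀, (hdich k₀).2 rfl⟩
    by_cases hk : μ k = μ k₀
    · exact Or.inr ((hdich k).2 hk)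
    · exact Or.inl ((hdich k).1 hk)
  refine ⟨μ k₀, funext fun j => ?_⟩
  have hzero : ∀ y, T y = 0 := fun y => hspan _ fun k => by rw [hT, hall, sub_self, zero_mul]
  have hAj : A j = μ k₀ • Pi.single j 1 := by
    ext i
    have h5 := congrFun (hzero (Pi.single i 1)) j
    simp only [T, LinearMap.sub_apply, Matrix.mulVecLin_apply, LinearMap.smul_apply,
      LinearMap.id_apply, Pi.sub_apply, Matrix.mulVec_single_one, Matrix.col_apply, Matrix.of_apply,
      Pi.smul_apply, Pi.zero_apply, sub_eq_zero] at h5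
    rw [h5, Pi.smul_apply, Pi.single_comm]
  rw [hA, hAj, Pi.smul_apply, smul_eq_C_mul]
  rw [linForm, Finset.sum_eq_single j] <;> simp +contextual

end LogarithmicFields

section HomogeneousGenerators
open MvPolynomial

variable {q : ℕ} {K : Type*} {c : K → Fin (q + 1) → ℂ}

theorem vecComponent_succ_of_mem_maxSmulLogFields
    {f : Fin (q + 1) → MvPolynomial (Fin (q + 1)) ℂ} (hf : f ∈ maxSmulLogFields c) (d : ℕ) :
    ∃ g : Fin (q + 1) → logFields c, vecComponent (d + 1) f =
      ∑ i, (X i : MvPolynomial (Fin (q + 1)) ℂ) • vecComponent d (g i).1 := by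
  obtain ⟨g, rfl⟩ := (mem_maxSmulLogFields c).1 hf
  refine ⟨g, ?_⟩
  rw [map_sum]
  refine Finset.sum_congr rfl fun i _ => ?_
  rw [vecComponent_smul (isHomogeneous_X _ i), if_pos (by omega), Nat.add_sub_cancel]

theorem vecComponent_zero_of_mem_maxSmulLogFields
    {f : Fin (q + 1) → MvPolynomial (Fin (q + 1)) ℂ} (hf : f ∈ maxSmulLogFields c) :
    vecComponent 0 f = 0 := by
  obtain ⟨g, rfl⟩ := (mem_maxSmulLogFields c).1 hf
  rw [map_sum]
  refine Finset.sum_eq_zero fun i _ => ?_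
  rw [vecComponent_smul (isHomogeneous_X _ i), if_neg (by omega)]

theorem logFields_le_span_of_generate_mod {I : Type*} [Fintype I]
    (δ : I → Fin (q + 1) → MvPolynomial (Fin (q + 1)) ℂ) (d : I → ℕ)
    (hδ : ∀ i j, (δ i j).IsHomogeneous (d i))
    (hgen : ∀ f ∈ logFields c, ∃ a : I → ℂ, f - ∑ i, a i • δ i ∈ maxSmulLogFields c) :
    logFields c ≤ Submodule.span (MvPolynomial (Fin (q + 1)) ℂ) (Set.range δ) := by
  have key : ∀ e, ∀ f ∈ logFields c,
      vecComponent e f ∈ Submodule.span (MvPolynomial (Fin (q + 1)) ℂ) (Set.range δ) := by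
    intro e
    induction e with
    | zero =>
      intro f hf
      obtain ⟨a, ha⟩ := hgen f hf
      have h1 := vecComponent_zero_of_mem_maxSmulLogFields ha
      rw [map_sub, sub_eq_zero] at h1
      rw [h1, map_sum]
      refine sum_mem fun i _ => ?_
      rw [map_smul, vecComponent_of_isHomogeneous (hδ i)]
      split_ifs
      · rw [← algebraMap_smul (MvPolynomial (Fin (q + 1)) ℂ) (a i)]
        exact Submodule.smul_mem _ _ (Submodule.subset_span ⟨i, rfl⟩)
      · rw [smul_zero]; exact zero_mem _
    | succ e ih =>
      intro f hf
      obtain ⟨a, ha⟩ := hgen f hf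
      obtain ⟨g, hg⟩ := vecComponent_succ_of_mem_maxSmulLogFields ha e
      rw [map_sub, sub_eq_iff_eq_add] at hg
      rw [hg, map_sum]
      refine add_mem (sum_mem fun i _ => Submodule.smul_mem _ _ (ih _ (g i).2))
        (sum_mem fun i _ => ?_)
      rw [map_smul, vecComponent_of_isHomogeneous (hδ i)]
      split_ifs
      · rw [← algebraMap_smul (MvPolynomial (Fin (q + 1)) ℂ) (a i)]
        exact Submodule.smul_mem _ _ (Submodule.subset_span ⟨i, rfl⟩)
      · rw [smul_zero]; exact zero_mem _
  intro f hf
  obtain ⟨n, hn⟩ := exists_sum_vecComponent f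
  rw [hn]
  exact sum_mem fun e _ => key e f hf

theorem exists_padding_of_le {E : Type*} [Zero E] {m n : ℕ} (h : m ≤ n) (g : Fin m → E) :
    ∃ γ : Fin n → E, (∀ i, γ i = 0 ∨ ∃ k, γ i = g k) ∧ ∀ k, ∃ i, γ i = g k := by
  refine ⟨fun i => if h : (i : ℕ) < m then g ⟨i, h⟩ else 0, fun i => ?_, fun k => ?_⟩
  · by_cases hi : (i : ℕ) < m
    · exact Or.inr ⟨⟨i, hi⟩, dif_pos hi⟩
    · exact Or.inl (dif_neg hi)
  · exact ⟨⟨k, k.2.trans_le h⟩, dif_pos k.2⟩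

theorem exists_homogeneous_generators (hc : ∀ k, c k ≠ 0)
    (hspan : ∀ y, (∀ k, c k ⬝ᵥ y = 0) → y = 0)
    (hirr : ∀ V₁ V₂ : Submodule ℂ (Fin (q + 1) → ℂ), IsCompl V₁ V₂ →
      (∀ k, (∀ y ∈ V₁, c k ⬝ᵥ y = 0) ∨ ∀ y ∈ V₂, c k ⬝ᵥ y = 0) →
      (∃ k, ∀ y ∈ V₁, c k ⬝ᵥ y = 0) → ¬ ∃ k, ∀ y ∈ V₂, c k ⬝ᵥ y = 0)
    (T : Fin (q + 1) → Fin (q + 1) → MvPolynomial (Fin (q + 1)) ℂ)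
    (hT : ∀ f ∈ logFields c, ∃ a : Fin (q + 1) → ℂ, f - ∑ i, a i • T i ∈ maxSmulLogFields c) :
    ∃ (δ : Fin (q + 1) → Fin (q + 1) → MvPolynomial (Fin (q + 1)) ℂ) (d : Fin (q + 1) → ℕ),
      δ 0 = X ∧ d 0 = 0 ∧ (∀ i : Fin q, 1 ≤ d i.succ) ∧ (∀ i j, (δ i j).IsHomogeneous (d i + 1)) ∧
      (∀ i, δ i ∈ logFields c) ∧
      logFields c ≤ Submodule.span (MvPolynomial (Fin (q + 1)) ℂ) (Set.range δ) := by
  let E := Fin (q + 1) → MvPolynomial (Fin (q + 1)) ℂ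
  let Eu : E := X
  let N : Submodule ℂ E := (maxSmulLogFields c).restrictScalars ℂ
  let N' : Submodule ℂ E := N ⊔ Submodule.span ℂ {Eu}
  have hEuN : Eu ∈ N' := Submodule.mem_sup_right (Submodule.mem_span_singleton_self _)
  have hNN' : ∀ f ∈ maxSmulLogFields c, f ∈ N' := fun f hf => Submodule.mem_sup_left hf
  let H : Set E := {f | f ∈ logFields c ∧ ∃ d, 1 ≤ d ∧ ∀ j, (f j).IsHomogeneous (d + 1)}
  -- the Euler field is not in the maximal submodule
  have hEu : Eu ∉ maxSmulLogFields c := by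
    intro h
    obtain ⟨g, hg⟩ := vecComponent_succ_of_mem_maxSmulLogFields h 0
    rw [vecComponent_of_isHomogeneous (fun j => isHomogeneous_X ℂ j), if_pos rfl] at hg
    have h0 : Eu = 0 := by
      refine hg.trans (Finset.sum_eq_zero fun i _ => ?_)
      rw [eq_zero_of_isHomogeneous_zero hc hspan (vecComponent_mem_logFields c (g i).2 0)
        (vecComponent_isHomogeneous 0 _), smul_zero]
    exact X_ne_zero (R := ℂ) 0 (congrFun h0 0)
  -- homogeneous elements of higher degree generate modulo `N'`
  have hH : ∀ f ∈ logFields c, N'.mkQ f ∈ Submodule.span ℂ (N'.mkQ '' H) := by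
    intro f hf
    obtain ⟨n, hn⟩ := exists_sum_vecComponent f
    rw [hn, map_sum]
    refine sum_mem fun e _ => ?_
    rcases e with _ | _ | e
    · rw [eq_zero_of_isHomogeneous_zero hc hspan (vecComponent_mem_logFields c hf 0)
        (vecComponent_isHomogeneous 0 _), map_zero]
      exact zero_mem _
    · obtain ⟨t, ht⟩ := exists_eq_smul_of_isHomogeneous_one hspan hirr
        (vecComponent_mem_logFields c hf 1) (vecComponent_isHomogeneous 1 _)
      have h1 := (Submodule.Quotient.mk_eq_zero N').2 (N'.smul_mem t hEuN)
      rw [← Submodule.mkQ_apply] at h1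
      rw [zero_add, ht, h1]
      exact zero_mem _
    · exact Submodule.subset_span ⟨_, ⟨vecComponent_mem_logFields c hf _, e + 1, by omega,
        vecComponent_isHomogeneous _ _⟩, rfl⟩
  -- the dimension bound
  obtain ⟨hfin, hrank⟩ : FiniteDimensional ℂ (Submodule.span ℂ (N'.mkQ '' H)) ∧
      Module.finrank ℂ (Submodule.span ℂ (N'.mkQ '' H)) ≤ q := by
    obtain ⟨a, ha⟩ := hT Eu (euler_mem_logFields c)
    obtain ⟨i₀, hi₀⟩ : ∃ i, a i ≠ 0 := by
      by_contra! h
      simp only [h, zero_smul, Finset.sum_const_zero, sub_zero] at ha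
      exact hEu ha
    let v : Fin q → E ⧸ N' := fun i => N'.mkQ (T (i₀.succAbove i))
    have hv0 : N'.mkQ (T i₀) ∈ Submodule.span ℂ (Set.range v) := by
      have h1 : N'.mkQ (∑ i, a i • T i) = 0 := by
        have h2 := (Submodule.Quotient.mk_eq_zero N').2 (hNN' _ ha)
        have h3 := (Submodule.Quotient.mk_eq_zero N').2 hEuN
        rw [← Submodule.mkQ_apply, map_sub] at h2
        rw [← Submodule.mkQ_apply] at h3
        rwa [h3, zero_sub, neg_eq_zero] at h2
      rw [Fin.sum_univ_succAbove _ i₀, map_add, map_smul, map_sum] at h1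
      have h4 : N'.mkQ (T i₀) = (a i₀)⁻¹ • -(∑ i, N'.mkQ (a (i₀.succAbove i) • T (i₀.succAbove i))) := by
        rw [← eq_neg_of_add_eq_zero_left h1, smul_smul, inv_mul_cancel₀ hi₀, one_smul]
      rw [h4]
      refine Submodule.smul_mem _ _ (neg_mem (sum_mem fun i _ => ?_))
      rw [map_smul]
      exact Submodule.smul_mem _ _ (Submodule.subset_span ⟨i, rfl⟩)
    have hle : Submodule.span ℂ (N'.mkQ '' H) ≤ Submodule.span ℂ (Set.range v) := by
      rw [Submodule.span_le]
      rintro _ ⟨f, ⟨hf, -⟩, rfl⟩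
      obtain ⟨b, hb⟩ := hT f hf
      have h5 : N'.mkQ f = ∑ i, b i • N'.mkQ (T i) := by
        have h2 := (Submodule.Quotient.mk_eq_zero N').2 (hNN' _ hb)
        rw [← Submodule.mkQ_apply, map_sub, sub_eq_zero] at h2
        rw [h2, map_sum]
        exact Finset.sum_congr rfl fun i _ => map_smul _ _ _
      rw [SetLike.mem_coe, h5, Fin.sum_univ_succAbove _ i₀]
      exact add_mem (Submodule.smul_mem _ _ hv0)
        (sum_mem fun i _ => Submodule.smul_mem _ _ (Submodule.subset_span ⟨i, rfl⟩))
    have : FiniteDimensional ℂ (Submodule.span ℂ (Set.range v)) :=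
      FiniteDimensional.span_of_finite ℂ (Set.finite_range v)
    refine ⟨Submodule.finiteDimensional_of_le hle, (Submodule.finrank_mono hle).trans ?_⟩
    have := finrank_range_le_card (R := ℂ) v
    rwa [Fintype.card_fin] at this
  obtain ⟨w, hwH, hwspan, -⟩ := Submodule.exists_fun_fin_finrank_span_eq ℂ (N'.mkQ '' H)
  choose g hgH hgw using hwH
  obtain ⟨γ, hγ0, hγg⟩ := exists_padding_of_le hrank g
  have hγ : ∀ i, γ i ∈ logFields c ∧ ∃ d, 1 ≤ d ∧ ∀ j, (γ i j).IsHomogeneous (d + 1) := by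
    intro i
    rcases hγ0 i with h | ⟨k, h⟩
    · rw [h]
      exact ⟨zero_mem _, 1, le_rfl, fun j => isHomogeneous_zero _ _ _⟩
    · rw [h]
      exact hgH k
  choose hγl dγ hdγ hγh using hγ
  let δ : Fin (q + 1) → E := Fin.cons Eu γ
  let d : Fin (q + 1) → ℕ := Fin.cons 0 dγ
  have hδh : ∀ i j, (δ i j).IsHomogeneous (d i + 1) := by
    intro i j
    refine Fin.cases ?_ (fun i => ?_) i
    · exact isHomogeneous_X ℂ j
    · exact hγh i j
  have hδl : ∀ i, δ i ∈ logFields c := by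
    intro i
    refine Fin.cases ?_ (fun i => ?_) i
    · exact euler_mem_logFields c
    · exact hγl i
  refine ⟨δ, d, rfl, rfl, hdγ, hδh, hδl, ?_⟩
  refine logFields_le_span_of_generate_mod δ (fun i => d i + 1) hδh fun f hf => ?_
  have h1 := hH f hf
  have h2 : Submodule.span ℂ (N'.mkQ '' H) ≤ Submodule.span ℂ (Set.range fun i => N'.mkQ (γ i)) := by
    rw [← hwspan, Submodule.span_le]
    rintro _ ⟨i, rfl⟩
    obtain ⟨k, hk⟩ := hγg i
    exact Submodule.subset_span ⟨k, by rw [← hgw i, ← hk]⟩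
  obtain ⟨b, hb⟩ := (Submodule.mem_span_range_iff_exists_fun ℂ).1 (h2 h1)
  have h3 : f - ∑ i, b i • γ i ∈ N' := by
    rw [← Submodule.Quotient.mk_eq_zero, ← Submodule.mkQ_apply, map_sub, ← hb, map_sum]
    simp
  obtain ⟨x, hx, y, hy, hxy⟩ := Submodule.mem_sup.1 h3
  obtain ⟨t, rfl⟩ := Submodule.mem_span_singleton.1 hy
  refine ⟨Fin.cons t b, ?_⟩
  have h4 : f - ∑ i, (Fin.cons t b : Fin (q + 1) → ℂ) i • δ i = x := by
    rw [Fin.sum_univ_succ]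
    simp only [δ, Fin.cons_zero, Fin.cons_succ]
    rw [← sub_sub, sub_right_comm, ← hxy, add_sub_cancel_right]
  rw [h4]; exact hx

end HomogeneousGenerators

section LogFieldGenerators
open MvPolynomial

variable {q : ℕ} {K : Type*} {c : K → Fin (q + 1) → ℂ}

theorem derivation_prod {A ι : Type*} [CommRing A] [Algebra ℂ A] [DecidableEq ι]
    (D : Derivation ℂ A A) (s : Finset ι) (f : ι → A) :
    D (∏ k ∈ s, f k) = ∑ k ∈ s, (∏ k' ∈ s.erase k, f k') * D (f k) := by
  induction s using Finset.induction_on with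
  | empty => simp
  | insert a s ha ih =>
    rw [Finset.prod_insert ha, Derivation.leibniz, ih, Finset.sum_insert ha,
      Finset.erase_insert ha, smul_eq_mul, smul_eq_mul, add_comm, Finset.mul_sum]
    congr 1
    refine Finset.sum_congr rfl fun k hk => ?_
    have hka : k ≠ a := fun h => ha (h ▸ hk)
    rw [Finset.erase_insert_of_ne hka.symm, Finset.prod_insert (fun h => ha (Finset.mem_of_mem_erase h)),
      mul_assoc]

theorem exists_isHomogeneous_quotient {η : Fin (q + 1) → MvPolynomial (Fin (q + 1)) ℂ} {d : ℕ}
    (hη : η ∈ logFields c) (hηh : ∀ j, (η j).IsHomogeneous (d + 1)) (k : K) :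
    ∃ Λ : MvPolynomial (Fin (q + 1)) ℂ, Λ.IsHomogeneous d ∧
      ∑ j, C (c k j) * η j = linForm (c k) * Λ := by
  obtain ⟨h, hh⟩ := hη k
  refine ⟨homogeneousComponent d h, homogeneousComponent_isHomogeneous _ _, ?_⟩
  have h1 := congrArg (homogeneousComponent (d + 1)) hh
  rw [homogeneousComponent_mul_of_isHomogeneous (linForm_isHomogeneous _), if_pos (by omega),
    Nat.add_sub_cancel, homogeneousComponent_of_mem, if_pos rfl] at h1
  · exact h1
  · rw [mem_homogeneousSubmodule]
    exact IsHomogeneous.sum _ _ _ fun j _ => (hηh j).C_mul _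

variable {δ : Fin (q + 1) → Fin (q + 1) → MvPolynomial (Fin (q + 1)) ℂ}
  {lam : Fin (q + 1) → K → MvPolynomial (Fin (q + 1)) ℂ}

theorem exists_coeff_of_mem_logFields (hc : ∀ k, c k ≠ 0)
    (hgen : logFields c ≤ Submodule.span (MvPolynomial (Fin (q + 1)) ℂ) (Set.range δ))
    (hlam : ∀ i k, ∑ j, C (c k j) * δ i j = linForm (c k) * lam i k)
    {η : Fin (q + 1) → MvPolynomial (Fin (q + 1)) ℂ} {Λ : K → MvPolynomial (Fin (q + 1)) ℂ}
    (hη : ∀ k, ∑ j, C (c k j) * η j = linForm (c k) * Λ k) :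
    ∃ a : Fin (q + 1) → MvPolynomial (Fin (q + 1)) ℂ, (∀ j, η j = ∑ i, a i * δ i j) ∧
      ∀ k, Λ k = ∑ i, a i * lam i k := by
  have hmem : η ∈ logFields c := fun k => ⟨Λ k, hη k⟩
  obtain ⟨a, ha⟩ := (Submodule.mem_span_range_iff_exists_fun _).1 (hgen hmem)
  have ha' : ∀ j, η j = ∑ i, a i * δ i j := fun j => by
    rw [← ha, Finset.sum_apply]; rfl
  refine ⟨a, ha', fun k => ?_⟩
  apply mul_left_cancel₀ (linForm_ne_zero (hc k))
  rw [← hη k, Finset.mul_sum]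
  have : ∀ i, linForm (c k) * (a i * lam i k) = ∑ j, C (c k j) * (a i * δ i j) := fun i => by
    rw [mul_left_comm, ← hlam, Finset.mul_sum]
    exact Finset.sum_congr rfl fun j _ => by ring
  simp only [this, ha', Finset.mul_sum]
  exact Finset.sum_comm

theorem prod_linForm_smul_single_quotient [Fintype K] [DecidableEq K] (j₀ : Fin (q + 1)) (k : K) :
    ∑ j, C (c k j) * (Pi.single j₀ (∏ k, linForm (c k)) : Fin (q + 1) → MvPolynomial _ ℂ) j =
      linForm (c k) * (C (c k j₀) * ∏ k' ∈ Finset.univ.erase k, linForm (c k')) := by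
  rw [Finset.sum_eq_single j₀ (by simp +contextual) (by simp), Pi.single_eq_same,
    ← Finset.mul_prod_erase _ _ (Finset.mem_univ k)]
  ring

theorem card_le_sum_degree [Fintype K] (hc : ∀ k, c k ≠ 0)
    (hprop : ∀ k k', k ≠ k' → ∀ t : ℂ, c k ≠ t • c k')
    (hgen : logFields c ≤ Submodule.span (MvPolynomial (Fin (q + 1)) ℂ) (Set.range δ))
    (hlam : ∀ i k, ∑ j, C (c k j) * δ i j = linForm (c k) * lam i k)
    {d : Fin (q + 1) → ℕ} (hδh : ∀ i j, (δ i j).IsHomogeneous (d i)) :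
    Fintype.card K ≤ ∑ i, d i := by
  classical
  set F := ∏ k, linForm (c k) with hF
  have hF0 : F ≠ 0 := Finset.prod_ne_zero_iff.2 fun k _ => linForm_ne_zero (hc k)
  choose G hG _ using fun j => exists_coeff_of_mem_logFields hc hgen hlam
    (prod_linForm_smul_single_quotient (c := c) j)
  have hdet : F ^ (q + 1) = (Matrix.of G).det * (Matrix.of δ).det := by
    rw [← Matrix.det_mul]
    have : Matrix.of G * Matrix.of δ = Matrix.diagonal fun _ => F := by
      ext1 i j
      rw [Matrix.mul_apply, Matrix.diagonal_apply]
      simp only [Matrix.of_apply]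
      rw [← hG i j, Pi.single_apply, ← hF]
      simp only [eq_comm]
    rw [this, Matrix.det_diagonal]; simp
  have hne : (Matrix.of δ).det ≠ 0 := by
    rintro h
    rw [h, mul_zero] at hdet
    exact pow_ne_zero _ hF0 hdet
  have hdvd : ∀ k, linForm (c k) ∣ (Matrix.of δ).det := by
    intro k
    obtain ⟨j, hj⟩ := Function.ne_iff.1 (hc k)
    have h1 : (Matrix.of δ).mulVec (fun j => C (c k j)) = linForm (c k) • fun i => lam i k := by
      ext1 i
      simp only [Matrix.mulVec, dotProduct, Matrix.of_apply, Pi.smul_apply, smul_eq_mul]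
      rw [← hlam]
      exact Finset.sum_congr rfl fun j _ => mul_comm _ _
    have h2 := congrArg (fun v => (Matrix.of δ).adjugate.mulVec v) h1
    simp only [Matrix.mulVec_mulVec, Matrix.adjugate_mul, Matrix.mulVec_smul, Matrix.smul_mulVec,
      Matrix.one_mulVec] at h2
    have h3 := congrFun h2 j
    simp only [Pi.smul_apply, smul_eq_mul] at h3
    have h4 : linForm (c k) ∣ (Matrix.of δ).det * C (c k j) := ⟨_, h3⟩
    exact ((isUnit_iff_ne_zero.2 hj).map C).dvd_mul_right.1 h4
  have hFdvd : F ∣ (Matrix.of δ).det := by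
    refine Fintype.prod_dvd_of_isRelPrime (fun k k' hkk' => ?_) hdvd
    rw [Function.onFun, (irreducible_linForm (hc k)).isRelPrime_iff_not_dvd]
    intro h
    obtain ⟨t, ht⟩ := linForm_dvd_linForm h
    exact hprop k' k hkk'.symm t ht
  have hdeth : ((Matrix.of δ).det).IsHomogeneous (∑ i, d i) := by
    rw [Matrix.det_apply]
    refine IsHomogeneous.sum _ _ _ fun σ _ => ?_
    rw [Units.smul_def, zsmul_eq_mul, ← map_intCast (C : ℂ →+* MvPolynomial (Fin (q + 1)) ℂ)]
    refine IsHomogeneous.C_mul ?_ _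
    rw [← Equiv.sum_comp σ d]
    exact IsHomogeneous.prod _ _ _ fun i _ => hδh _ _
  have hFh : F.IsHomogeneous (Fintype.card K) := by
    have := IsHomogeneous.prod Finset.univ (fun k => linForm (c k)) (fun _ => 1)
      fun k _ => linForm_isHomogeneous (c k)
    simpa using this
  obtain ⟨g, hg⟩ := hFdvd
  have h5 := hdeth.totalDegree hne
  have hg0 : g ≠ 0 := by rintro rfl; exact hne (by rw [hg, mul_zero])
  rw [hg, totalDegree_mul_of_isDomain hF0 hg0, hFh.totalDegree hF0] at h5
  omega

theorem sum_mul_pderiv_prod_linForm [Fintype K]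
    (hlam : ∀ i k, ∑ j, C (c k j) * δ i j = linForm (c k) * lam i k) (i : Fin (q + 1)) :
    ∑ j, δ i j * pderiv j (∏ k, linForm (c k)) = (∑ k, lam i k) * ∏ k, linForm (c k) := by
  classical
  have h1 : ∀ j, δ i j * pderiv j (∏ k, linForm (c k)) =
      ∑ k, (∏ k' ∈ Finset.univ.erase k, linForm (c k')) * (C (c k j) * δ i j) := by
    intro j
    rw [derivation_prod, Finset.mul_sum]
    refine Finset.sum_congr rfl fun k _ => ?_
    rw [pderiv_linForm]; ring
  simp only [h1]
  rw [Finset.sum_comm, Finset.sum_mul]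
  refine Finset.sum_congr rfl fun k _ => ?_
  rw [← Finset.mul_sum, hlam, ← Finset.mul_prod_erase _ _ (Finset.mem_univ k)]
  ring

theorem exists_bracket_coeff (hc : ∀ k, c k ≠ 0)
    (hgen : logFields c ≤ Submodule.span (MvPolynomial (Fin (q + 1)) ℂ) (Set.range δ))
    (hlam : ∀ i k, ∑ j, C (c k j) * δ i j = linForm (c k) * lam i k) (i i' : Fin (q + 1)) :
    ∃ a : Fin (q + 1) → MvPolynomial (Fin (q + 1)) ℂ,
      (∀ b, ∑ j, (δ i j * pderiv j (δ i' b) - δ i' j * pderiv j (δ i b)) = ∑ m, a m * δ m b) ∧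
      ∀ k, ∑ j, (δ i j * pderiv j (lam i' k) - δ i' j * pderiv j (lam i k))
        = ∑ m, a m * lam m k := by
  refine exists_coeff_of_mem_logFields hc hgen hlam fun k => ?_
  have happ : ∀ i i', ∑ j, δ i j * pderiv j (linForm (c k) * lam i' k)
      = linForm (c k) * lam i k * lam i' k + linForm (c k) * ∑ j, δ i j * pderiv j (lam i' k) := by
    intro i i'
    rw [← hlam i k, Finset.sum_mul, Finset.mul_sum, ← Finset.sum_add_distrib]
    refine Finset.sum_congr rfl fun j _ => ?_
    rw [Derivation.leibniz, pderiv_linForm, smul_eq_mul, smul_eq_mul]; ring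
  have happ' : ∀ i i', ∑ j, δ i j * pderiv j (linForm (c k) * lam i' k)
      = ∑ b, C (c k b) * ∑ j, δ i j * pderiv j (δ i' b) := by
    intro i i'
    simp only [← hlam i' k, map_sum, pderiv_C_mul, Finset.mul_sum]
    rw [Finset.sum_comm]
    exact Finset.sum_congr rfl fun b _ => Finset.sum_congr rfl fun j _ => by ring
  simp only [Finset.sum_sub_distrib, mul_sub]
  rw [← happ', ← happ', happ, happ]
  ring

section Pointwise

variable [Fintype K] {y ξ : Fin (q + 1) → ℂ} {s : K → ℂ}

theorem eval_relation_of_logField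
    (hc : ∀ k, c k ≠ 0)
    (hgen : logFields c ≤ Submodule.span (MvPolynomial (Fin (q + 1)) ℂ) (Set.range δ))
    (hlam : ∀ i k, ∑ j, C (c k j) * δ i j = linForm (c k) * lam i k)
    (h : ∀ i, ∑ j, eval y (δ i j) * ξ j = ∑ k, eval y (lam i k) * s k)
    {η : Fin (q + 1) → MvPolynomial (Fin (q + 1)) ℂ} {Λ : K → MvPolynomial (Fin (q + 1)) ℂ}
    (hη : ∀ k, ∑ j, C (c k j) * η j = linForm (c k) * Λ k) :
    ∑ j, eval y (η j) * ξ j = ∑ k, eval y (Λ k) * s k := by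
  obtain ⟨a, ha, ha'⟩ := exists_coeff_of_mem_logFields hc hgen hlam hη
  simp only [ha, ha', map_sum, map_mul, Finset.sum_mul, mul_assoc]
  rw [Finset.sum_comm, Finset.sum_comm (s := Finset.univ (α := K))]
  simp only [← Finset.mul_sum, h]

open Classical in
theorem sum_eq_zero_of_eval_relation
    (hc : ∀ k, c k ≠ 0)
    (hgen : logFields c ≤ Submodule.span (MvPolynomial (Fin (q + 1)) ℂ) (Set.range δ))
    (hlam : ∀ i k, ∑ j, C (c k j) * δ i j = linForm (c k) * lam i k)
    (h : ∀ i, ∑ j, eval y (δ i j) * ξ j = ∑ k, eval y (lam i k) * s k) : ∑ k with c k ⬝ᵥ y = 0, s k = 0 := by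
  obtain ⟨φ, hφ⟩ : ∃ φ : MvPolynomial (Fin (q + 1)) ℂ, y = 0 ∨ eval y φ = 1 := by
    by_cases hy : y = 0
    · exact ⟨0, Or.inl hy⟩
    · obtain ⟨j, hj⟩ := Function.ne_iff.1 hy
      refine ⟨C (y j)⁻¹ * X j, Or.inr ?_⟩
      rw [map_mul, eval_C, eval_X]; exact inv_mul_cancel₀ hj
  set φ' : MvPolynomial (Fin (q + 1)) ℂ := if y = 0 then 0 else φ with hφ'
  set Z : Finset K := Finset.univ.filter fun k => ¬ c k ⬝ᵥ y = 0 with hZ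
  set u := ∏ k ∈ Z, linForm (c k) with hu
  have hu0 : eval y u ≠ 0 := by
    rw [hu, map_prod, Finset.prod_ne_zero_iff]
    intro k hk
    rw [eval_linForm]
    exact (Finset.mem_filter.1 hk).2
  have hrel := eval_relation_of_logField hc hgen hlam h
    (η := fun j => u * (X j - φ' * C (y j)))
    (Λ := fun k => if c k ⬝ᵥ y = 0 then u else
      (∏ k' ∈ Z.erase k, linForm (c k')) * (linForm (c k) - φ' * C (c k ⬝ᵥ y))) (by
    intro k
    have h1 : ∑ j, C (c k j) * (u * (X j - φ' * C (y j))) =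
        u * (linForm (c k) - φ' * C (c k ⬝ᵥ y)) := by
      simp only [linForm, dotProduct, map_sum, C_mul, Finset.mul_sum, ← Finset.sum_sub_distrib]
      exact Finset.sum_congr rfl fun j _ => by ring
    rw [h1]
    split_ifs with hk
    · rw [hk]; simp; ring
    · rw [hu, ← Finset.mul_prod_erase Z _ (Finset.mem_filter.2 ⟨Finset.mem_univ k, hk⟩)]; ring)
  have hη0 : ∀ j, eval y (u * (X j - φ' * C (y j))) = 0 := by
    intro j
    rw [map_mul, map_sub, map_mul, eval_X, eval_C, hφ']
    rcases hφ with h0 | h1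
    · simp [h0]
    · split_ifs with h0
      · simp [h0]
      · rw [h1]; ring
  have hΛ : ∀ k, eval y (if c k ⬝ᵥ y = 0 then u else
      (∏ k' ∈ Z.erase k, linForm (c k')) * (linForm (c k) - φ' * C (c k ⬝ᵥ y)))
        = if c k ⬝ᵥ y = 0 then eval y u else 0 := by
    intro k
    split_ifs with hk
    · rfl
    · have hy : y ≠ 0 := by rintro rfl; exact hk (by simp)
      rw [hφ', if_neg hy, map_mul, map_sub, map_mul, hφ.resolve_left hy, eval_C, eval_linForm]
      simp [dotProduct]
  simp only [hη0, zero_mul, Finset.sum_const_zero, hΛ, ite_mul] at hrel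
  rw [← Finset.sum_filter, ← Finset.mul_sum, eq_comm, mul_eq_zero] at hrel
  exact hrel.resolve_left hu0

open Classical in
theorem dotProduct_eq_zero_of_eval_relation
    (hc : ∀ k, c k ≠ 0)
    (hgen : logFields c ≤ Submodule.span (MvPolynomial (Fin (q + 1)) ℂ) (Set.range δ))
    (hlam : ∀ i k, ∑ j, C (c k j) * δ i j = linForm (c k) * lam i k)
    (h : ∀ i, ∑ j, eval y (δ i j) * ξ j = ∑ k, eval y (lam i k) * s k)
    (hs : s = 0) (v : Fin (q + 1) → ℂ)
    (hv : ∀ k, c k ⬝ᵥ y = 0 → c k ⬝ᵥ v = 0) : v ⬝ᵥ ξ = 0 := by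
  set Z : Finset K := Finset.univ.filter fun k => ¬ c k ⬝ᵥ y = 0 with hZ
  set u := ∏ k ∈ Z, linForm (c k) with hu
  have hu0 : eval y u ≠ 0 := by
    rw [hu, map_prod, Finset.prod_ne_zero_iff]
    intro k hk
    rw [eval_linForm]
    exact (Finset.mem_filter.1 hk).2
  have hrel := eval_relation_of_logField hc hgen hlam h
    (η := fun j => u * C (v j))
    (Λ := fun k => if c k ⬝ᵥ y = 0 then 0 else
      (∏ k' ∈ Z.erase k, linForm (c k')) * C (c k ⬝ᵥ v)) (by
    intro k
    have h1 : ∑ j, C (c k j) * (u * C (v j)) = u * C (c k ⬝ᵥ v) := by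
      simp only [dotProduct, map_sum, C_mul, Finset.mul_sum]
      exact Finset.sum_congr rfl fun j _ => by ring
    rw [h1]
    split_ifs with hk
    · rw [hv k hk]; simp
    · rw [hu, ← Finset.mul_prod_erase Z _ (Finset.mem_filter.2 ⟨Finset.mem_univ k, hk⟩)]; ring)
  simp only [hs, Pi.zero_apply, mul_zero, Finset.sum_const_zero, map_mul, eval_C, mul_assoc,
    ← Finset.mul_sum] at hrel
  exact (mul_eq_zero.1 hrel).resolve_left hu0

end Pointwise

end LogFieldGenerators

section Nondegenerate
open MvPolynomial

theorem exists_eval_ne_zero_of_family {σ Z : Type*} [Fintype Z] (p : Z → MvPolynomial σ ℂ)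
    (hp : ∀ z, p z ≠ 0) : ∃ x : σ → ℂ, ∀ z, eval x (p z) ≠ 0 := by
  have h0 : ∏ z, p z ≠ 0 := Finset.prod_ne_zero_iff.2 fun z _ => hp z
  by_contra! h
  refine h0 (MvPolynomial.funext fun x => ?_)
  obtain ⟨z, hz⟩ := h x
  rw [map_prod, map_zero]
  exact Finset.prod_eq_zero (Finset.mem_univ z) hz

theorem exists_nondegenerate_matrix {n : ℕ} {Z : Type*} [Fintype Z]
    (Y : Z → Submodule ℂ (Fin n → ℂ)) :
    ∃ M : Matrix (Fin n) (Fin n) ℂ, ∀ z, ∀ y ∈ Y z,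
      (∀ v ∈ Y z, v ⬝ᵥ M.mulVec y = 0) → y = 0 := by
  set d : Z → ℕ := fun z => Module.finrank ℂ (Y z) with hd
  set B : ∀ z, Matrix (Fin n) (Fin (d z)) ℂ := fun z =>
    Matrix.of fun i a => (Module.finBasis ℂ (Y z) a : Fin n → ℂ) i with hB
  have hBmul : ∀ z (x : Fin (d z) → ℂ), (B z).mulVec x =
      ((∑ a, x a • Module.finBasis ℂ (Y z) a : Y z) : Fin n → ℂ) := by
    intro z x
    ext i
    simp [B, Matrix.mulVec, dotProduct, Finset.sum_apply, mul_comm]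
  have hBinj : ∀ z, ∃ L : Matrix (Fin (d z)) (Fin n) ℂ, L * B z = 1 := by
    intro z
    obtain ⟨g, hg⟩ := LinearMap.exists_leftInverse_of_injective (B z).mulVecLin (by
      rw [LinearMap.ker_eq_bot]
      intro x x' hxx
      rw [Matrix.mulVecLin_apply, Matrix.mulVecLin_apply, hBmul, hBmul, Subtype.coe_inj] at hxx
      have := congrArg (Module.finBasis ℂ (Y z)).repr hxx
      ext a
      simpa [Finsupp.single_apply] using DFunLike.congr_fun this a)
    refine ⟨LinearMap.toMatrix' g, ?_⟩
    have := congrArg LinearMap.toMatrix' hg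
    rwa [LinearMap.toMatrix'_comp, LinearMap.toMatrix'_id,
      ← Matrix.toLin'_apply', LinearMap.toMatrix'_toLin'] at this
  choose L hL using hBinj
  set U : Matrix (Fin n) (Fin n) (MvPolynomial (Fin n × Fin n) ℂ) :=
    Matrix.of fun i j => X (i, j) with hU
  let Bt : ∀ z, Matrix (Fin (d z)) (Fin n) (MvPolynomial (Fin n × Fin n) ℂ) :=
    fun z => Matrix.map (Matrix.transpose (B z)) C
  let Bp : ∀ z, Matrix (Fin n) (Fin (d z)) (MvPolynomial (Fin n × Fin n) ℂ) :=
    fun z => Matrix.map (B z) C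
  have hev : ∀ (x : Fin n × Fin n → ℂ) z, eval x (Bt z * U * Bp z).det
      = ((B z).transpose * (Matrix.of fun i j => x (i, j)) * B z).det := by
    intro x z
    rw [RingHom.map_det]
    congr 1
    ext i j
    simp [Matrix.mul_apply, Bt, Bp, U]
  obtain ⟨x, hx⟩ := exists_eval_ne_zero_of_family (fun z => (Bt z * U * Bp z).det) (by
      intro z h0
      have h1 := hev (fun ij : Fin n × Fin n => ((L z).transpose * L z) ij.1 ij.2) z
      have h2 : (Matrix.of fun i j => ((L z).transpose * L z) i j) = (L z).transpose * L z := rfl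
      have h3 : (B z).transpose * ((L z).transpose * L z) * B z = 1 := by
        rw [← Matrix.mul_assoc, ← Matrix.transpose_mul, Matrix.mul_assoc, hL]; simp
      rw [h0, h2, h3] at h1
      simp at h1)
  refine ⟨Matrix.of fun i j => x (i, j), fun z y hy hv => ?_⟩
  have hx' := hx z
  rw [hev] at hx'
  obtain ⟨a, rfl⟩ : ∃ a, y = (B z).mulVec a := by
    refine ⟨(Module.finBasis ℂ (Y z)).repr ⟨y, hy⟩, ?_⟩
    rw [hBmul, Module.Basis.sum_repr]
  have ha : a = 0 := by
    refine Matrix.eq_zero_of_mulVec_eq_zero hx' ?_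
    rw [← Matrix.mulVec_mulVec, ← Matrix.mulVec_mulVec]
    ext i
    exact hv _ (Module.finBasis ℂ (Y z) i).2
  rw [ha, Matrix.mulVec_zero]
end Nondegenerate

section SymbolRegular
open MvPolynomial RingTheory.Sequence

theorem isWeightedHomogeneous_rename {σ τ : Type*} (e : σ → τ) (w : τ → ℕ) (hw : ∀ i, w (e i) = 1)
    {f : MvPolynomial σ ℂ} {d : ℕ} (hf : f.IsHomogeneous d) :
    IsWeightedHomogeneous w (rename e f) d := by
  conv => rw [← MvPolynomial.support_sum_monomial_coeff f]
  rw [map_sum]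
  refine IsWeightedHomogeneous.sum _ _ _ fun m hm => ?_
  rw [rename_monomial]
  refine isWeightedHomogeneous_monomial _ _ _ ?_
  have h1 := hf (mem_support_iff.1 hm)
  rw [← h1, Finsupp.weight_apply, Finsupp.weight_apply, Finsupp.sum_mapDomain_index]
  · simp [hw]
  · simp
  · intros; simp [add_mul]

variable {q : ℕ} {K : Type*} {c : K → Fin (q + 1) → ℂ}
  {δ : Fin (q + 1) → Fin (q + 1) → MvPolynomial (Fin (q + 1)) ℂ}
  {lam : Fin (q + 1) → K → MvPolynomial (Fin (q + 1)) ℂ}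

theorem mem_span_range_of_C_mul_mem [Fintype K] [Nonempty K] (hc : ∀ k, c k ≠ 0)
    (hgen : logFields c ≤ Submodule.span (MvPolynomial (Fin (q + 1)) ℂ) (Set.range δ))
    (hlam : ∀ i k, ∑ j, C (c k j) * δ i j = linForm (c k) * lam i k)
    {d : Fin (q + 1) → ℕ} (hδh : ∀ i j, (δ i j).IsHomogeneous (d i + 1))
    (hlamh : ∀ i k, (lam i k).IsHomogeneous (d i))
    {τ : Fin (q + 1) → MvPolynomial (Fin (q + 1) ⊕ K) (MvPolynomial (Fin (q + 1)) ℂ)}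
    (hτ : ∀ i, τ i = ∑ j, C (δ i j) * X (Sum.inl j) - ∑ k, C (lam i k) * X (Sum.inr k))
    (w : MvPolynomial (Fin (q + 1) ⊕ K) (MvPolynomial (Fin (q + 1)) ℂ))
    (hw : C (∏ k, linForm (c k)) * w ∈ Ideal.span (Set.range τ)) :
    w ∈ Ideal.span (Set.range τ) := by
  classical
  obtain ⟨k₀⟩ := ‹Nonempty K›
  obtain ⟨M, hM⟩ := exists_nondegenerate_matrix
    (fun Z : Finset K => ⨅ k ∈ Z, LinearMap.ker (Matrix.mulVecLin (Matrix.of fun _ : Unit => c k)))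
  have hmemY : ∀ (Z : Finset K) y, y ∈ (⨅ k ∈ Z, LinearMap.ker
      (Matrix.mulVecLin (Matrix.of fun _ : Unit => c k))) ↔ ∀ k ∈ Z, c k ⬝ᵥ y = 0 := by
    intro Z y
    simp only [Submodule.mem_iInf, LinearMap.mem_ker, Matrix.mulVecLin_apply]
    refine forall₂_congr fun k _ => ?_
    rw [funext_iff]
    simp [Matrix.mulVec]
  simp only [hmemY] at hM
  set E := sumAlgEquiv ℂ (Fin (q + 1) ⊕ K) (Fin (q + 1))
  have hEC : ∀ f, E.symm (C f) = rename Sum.inr f := by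
    intro f
    rw [AlgEquiv.symm_apply_eq]
    exact (DFunLike.congr_fun (sumAlgEquiv_comp_rename_inr (R := ℂ) (S₁ := Fin (q + 1) ⊕ K)
      (S₂ := Fin (q + 1))) f).symm
  set W : (Fin (q + 1) ⊕ K) ⊕ Fin (q + 1) → ℕ :=
    Sum.elim (Sum.elim (fun _ => 1) fun _ => 2) fun _ => 1 with hW
  set F := ∏ k, linForm (c k) with hF
  have hFh : F.IsHomogeneous (Fintype.card K) := by
    have := IsHomogeneous.prod Finset.univ (fun k => linForm (c k)) (fun _ => 1)
      fun k _ => linForm_isHomogeneous (c k)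
    simpa using this
  set L₂ : List (MvPolynomial ((Fin (q + 1) ⊕ K) ⊕ Fin (q + 1)) ℂ) :=
    List.ofFn (fun j => X (Sum.inl (Sum.inl j)) - ∑ a, C (M j a) * X (Sum.inr a)) with hL₂
  set L₃ : List (MvPolynomial ((Fin (q + 1) ⊕ K) ⊕ Fin (q + 1)) ℂ) :=
    (Finset.univ.erase k₀).toList.map
      (fun k => X (Sum.inl (Sum.inr k)) - X (Sum.inl (Sum.inr k₀))) with hL₃
  have hEτ : ∀ i, E.symm (τ i) = ∑ j, rename Sum.inr (δ i j) * X (Sum.inl (Sum.inl j)) -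
      ∑ k, rename Sum.inr (lam i k) * X (Sum.inl (Sum.inr k)) := by
    intro i
    rw [hτ, map_sub, map_sum, map_sum]
    simp only [map_mul, hEC]
    congr 1
    · exact Finset.sum_congr rfl fun j _ => by rw [sumAlgEquiv_symm_X]
    · exact Finset.sum_congr rfl fun j _ => by rw [sumAlgEquiv_symm_X]
  have hreg : IsWeaklyRegular (MvPolynomial ((Fin (q + 1) ⊕ K) ⊕ Fin (q + 1)) ℂ)
      (List.ofFn (fun i => E.symm (τ i)) ++ (E.symm (C F) :: (L₂ ++ L₃))) := by
    refine isWeaklyRegular_of_isWeightedHomogeneous W ?_ _ ?_ ?_ ?_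
    · rintro ((j | k) | a) <;> simp [W]
    · have : 0 < Fintype.card K := Fintype.card_pos_iff.2 ⟨k₀⟩
      simp [hL₂, hL₃, Finset.card_erase_of_mem, Finset.card_univ]
      omega
    · intro g hg
      rw [List.mem_append, List.mem_cons, List.mem_append, List.mem_ofFn, hL₂, List.mem_ofFn, hL₃,
        List.mem_map] at hg
      rcases hg with ⟨i, rfl⟩ | rfl | ⟨j, rfl⟩ | ⟨k, -, rfl⟩
      · refine ⟨d i + 2, by omega, ?_⟩
        rw [hEτ]
        refine IsWeightedHomogeneous.sub ?_ ?_
        · refine IsWeightedHomogeneous.sum _ _ _ fun j _ => ?_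
          exact (isWeightedHomogeneous_rename _ W (fun _ => rfl) (hδh i j)).mul
            (isWeightedHomogeneous_X _ W (Sum.inl (Sum.inl j)))
        · refine IsWeightedHomogeneous.sum _ _ _ fun k _ => ?_
          exact (isWeightedHomogeneous_rename _ W (fun _ => rfl) (hlamh i k)).mul
            (isWeightedHomogeneous_X _ W (Sum.inl (Sum.inr k)))
      · refine ⟨Fintype.card K, Fintype.card_pos_iff.2 ⟨k₀⟩, ?_⟩
        rw [hEC]
        exact isWeightedHomogeneous_rename _ W (fun _ => rfl) hFh
      · refine ⟨1, one_pos, ?_⟩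
        refine IsWeightedHomogeneous.sub (isWeightedHomogeneous_X _ W (Sum.inl (Sum.inl j)))
          (IsWeightedHomogeneous.sum _ _ _ fun a _ => ?_)
        exact IsWeightedHomogeneous.C_mul (isWeightedHomogeneous_X _ W (Sum.inr a)) _
      · refine ⟨2, two_pos, ?_⟩
        exact IsWeightedHomogeneous.sub (isWeightedHomogeneous_X _ W (Sum.inl (Sum.inr k)))
          (isWeightedHomogeneous_X _ W (Sum.inl (Sum.inr k₀)))
    · intro x hx
      set y : Fin (q + 1) → ℂ := fun a => x (Sum.inr a) with hy
      set ξ : Fin (q + 1) → ℂ := fun j => x (Sum.inl (Sum.inl j)) with hξ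
      set s : K → ℂ := fun k => x (Sum.inl (Sum.inr k)) with hs
      have hren : ∀ f : MvPolynomial (Fin (q + 1)) ℂ, eval x (rename Sum.inr f) = eval y f := by
        intro f; rw [eval_rename]; rfl
      have h1 : ∀ i, ∑ j, eval y (δ i j) * ξ j = ∑ k, eval y (lam i k) * s k := by
        intro i
        have := hx (E.symm (τ i)) (List.mem_append_left _ (List.mem_ofFn.2 ⟨i, rfl⟩))
        rw [hEτ, map_sub, map_sum, map_sum, sub_eq_zero] at this
        simpa only [map_mul, hren, eval_X] using this
      have h2 : eval y F = 0 := by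
        rw [← hren, ← hEC]
        exact hx _ (List.mem_append_right _ List.mem_cons_self)
      have h3 : ∀ j, ξ j = M.mulVec y j := by
        intro j
        have := hx (X (Sum.inl (Sum.inl j)) - ∑ a, C (M j a) * X (Sum.inr a))
          (List.mem_append_right _ (List.mem_cons_of_mem _ (List.mem_append_left _
            (List.mem_ofFn.2 ⟨j, rfl⟩))))
        rw [map_sub, sub_eq_zero, eval_X, map_sum] at this
        simp only [map_mul, eval_C, eval_X] at this
        exact this
      have h4 : ∀ k, s k = s k₀ := by
        intro k
        by_cases hk : k = k₀
        · rw [hk]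
        have := hx (X (Sum.inl (Sum.inr k)) - X (Sum.inl (Sum.inr k₀)))
          (List.mem_append_right _ (List.mem_cons_of_mem _ (List.mem_append_right _
            (List.mem_map.2 ⟨k, by simp [hk], rfl⟩))))
        rwa [map_sub, sub_eq_zero, eval_X, eval_X] at this
      have h5 := sum_eq_zero_of_eval_relation hc hgen hlam h1
      have hs0 : s = 0 := by
        rw [Finset.sum_congr rfl fun k _ => h4 k, Finset.sum_const, nsmul_eq_mul, mul_eq_zero] at h5
        rcases h5 with h5 | h5
        · exfalso
          rw [hF, map_prod, Finset.prod_eq_zero_iff] at h2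
          obtain ⟨k, -, hk⟩ := h2
          rw [eval_linForm] at hk
          rw [Nat.cast_eq_zero, Finset.card_eq_zero] at h5
          have : k ∈ (Finset.univ.filter fun k => c k ⬝ᵥ y = 0) :=
            Finset.mem_filter.2 ⟨Finset.mem_univ k, hk⟩
          rw [h5] at this
          simp at this
        · exact funext fun k => (h4 k).trans h5
      have hy0 : y = 0 := by
        refine hM (Finset.univ.filter fun k => c k ⬝ᵥ y = 0) y (by simp) fun v hv => ?_
        rw [← funext h3]
        exact dotProduct_eq_zero_of_eval_relation hc hgen hlam h1 hs0 v fun k hk =>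
          hv k (by simp [hk])
      funext z
      rcases z with (j | k) | a
      · exact (h3 j).trans (by rw [hy0]; simp)
      · exact congrFun hs0 k
      · exact congrFun hy0 a
  have hspan : ∀ z, z ∈ Ideal.span (Set.range τ) ↔
      E.symm z ∈ Ideal.ofList (List.ofFn fun i => E.symm (τ i)) := by
    intro z
    rw [mem_ofList_ofFn, Ideal.mem_span_range_iff_exists_fun]
    constructor
    · rintro ⟨a, rfl⟩
      exact ⟨fun i => E.symm (a i), by simp⟩
    · rintro ⟨b, hb⟩
      refine ⟨fun i => E (b i), ?_⟩
      have := congrArg E hb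
      simpa using this.symm
  rw [hspan] at hw ⊢
  rw [isWeaklyRegular_iff_forall_mul_mem] at hreg
  have := hreg (q + 1) (by simp) (E.symm w)
  rw [List.take_append_of_le_length (by simp), List.take_of_length_le (by simp)] at this
  refine this ?_
  rw [List.getElem_append_right (by simp)]
  simpa using hw
end SymbolRegular

section DualLogOperators
open MvPolynomial RingTheory.Sequence

theorem coeff_sum_monomial_map {S : Type*} [CommRing S] [Algebra ℂ S] (L : S →ₗ[ℂ] S)
    (f : Polynomial S) (m : ℕ) :
    (∑ n ∈ f.support, Polynomial.monomial n (L (f.coeff n))).coeff m = L (f.coeff m) := by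
  rw [Polynomial.finsetSum_coeff]
  simp only [Polynomial.coeff_monomial, Finset.sum_ite_eq']
  split_ifs with h
  · rfl
  · rw [Polynomial.notMem_support_iff.1 h, map_zero]

/-- Apply a linear map to every coefficient of a polynomial. -/
noncomputable def coeffwise {S : Type*} [CommRing S] [Algebra ℂ S] (L : S →ₗ[ℂ] S) :
    Polynomial S →ₗ[ℂ] Polynomial S where
  toFun f := ∑ n ∈ f.support, Polynomial.monomial n (L (f.coeff n))
  map_add' f g := by
    ext1 m
    rw [Polynomial.coeff_add]
    rw [coeff_sum_monomial_map, coeff_sum_monomial_map, coeff_sum_monomial_map,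
      Polynomial.coeff_add, map_add]
  map_smul' r f := by
    ext1 m
    rw [RingHom.id_apply, Polynomial.coeff_smul]
    rw [coeff_sum_monomial_map, coeff_sum_monomial_map, Polynomial.coeff_smul, map_smul]

section Coeffwise

variable {S : Type*} [CommRing S] [Algebra ℂ S]

theorem coeff_coeffwise (L : S →ₗ[ℂ] S) (f : Polynomial S) (m : ℕ) :
    (coeffwise L f).coeff m = L (f.coeff m) :=
  coeff_sum_monomial_map L f m

theorem coeffwise_mem_degreeLT (L : S →ₗ[ℂ] S) {f : Polynomial S} {e : ℕ}
    (hf : f ∈ Polynomial.degreeLT S e) : coeffwise L f ∈ Polynomial.degreeLT S e := by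
  rw [Polynomial.mem_degreeLT, Polynomial.degree_lt_iff_coeff_zero] at hf ⊢
  intro m hm
  rw [coeff_coeffwise, hf m hm, map_zero]

theorem coeffwise_derivation_C_mul (D : Derivation ℂ S S) (a : S) (f : Polynomial S) :
    coeffwise D.toLinearMap (Polynomial.C a * f) =
      Polynomial.C a * coeffwise D.toLinearMap f + Polynomial.C (D a) * f := by
  ext m
  simp [coeff_coeffwise, mul_comm]

theorem coeffwise_X_mul (L : S →ₗ[ℂ] S) (f : Polynomial S) :
    coeffwise L (Polynomial.X * f) = Polynomial.X * coeffwise L f := by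
  ext m
  cases m <;> simp [coeff_coeffwise]

end Coeffwise

theorem homogeneousComponent_pderiv {σ : Type*} (e : ℕ) (i : σ) (f : MvPolynomial σ ℂ) :
    homogeneousComponent e (pderiv i f) = pderiv i (homogeneousComponent (e + 1) f) := by
  conv_lhs => rw [← sum_homogeneousComponent f]
  rw [map_sum, map_sum]
  have h1 : ∀ n, homogeneousComponent e (pderiv i (homogeneousComponent n f)) =
      if n = e + 1 then pderiv i (homogeneousComponent (e + 1) f) else 0 := by
    intro n
    rcases n with _ | n
    · rw [homogeneousComponent_zero, pderiv_C, map_zero, if_neg (by omega)]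
    · have := (homogeneousComponent_isHomogeneous (n + 1) f).pderiv (i := i)
      rw [homogeneousComponent_of_mem this]
      simp only [Nat.add_sub_cancel, Nat.add_right_cancel_iff]
      by_cases h : n = e
      · simp [h]
      · simp [h, Ne.symm h]
  simp only [h1, Finset.sum_ite_eq']
  split_ifs with h
  · rfl
  · rw [homogeneousComponent_eq_zero, map_zero]
    simp at h; omega

theorem homogeneousComponent_sum_pderiv_X_mul {q : ℕ} (e : ℕ)
    (f : MvPolynomial (Fin q) ℂ) :
    homogeneousComponent e (∑ j, pderiv j (X j * f)) =
      ((e : ℂ) + q) • homogeneousComponent e f := by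
  have h2 : ∀ j : Fin q, homogeneousComponent (e + 1) (X j * f) =
      X j * homogeneousComponent e f := by
    intro j
    rw [homogeneousComponent_mul_of_isHomogeneous (isHomogeneous_X _ _), if_pos (by omega)]
    rfl
  rw [map_sum]
  simp only [homogeneousComponent_pderiv, h2]
  simp only [Derivation.leibniz, smul_eq_mul, pderiv_X_self, mul_one, Finset.sum_add_distrib]
  rw [(homogeneousComponent_isHomogeneous e f).sum_X_mul_pderiv, add_smul]
  simp [Nat.cast_smul_eq_nsmul]

variable {q : ℕ}

/-- The transpose of the logarithmic operator `∑ δⱼ ∂ⱼ - (L₀ + t L₁)`. -/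
noncomputable def dualLogOp (δ : Fin (q + 1) → MvPolynomial (Fin (q + 1)) ℂ)
    (L₀ L₁ : MvPolynomial (Fin (q + 1)) ℂ) :
    Polynomial (MvPolynomial (Fin (q + 1)) ℂ) →ₗ[ℂ] Polynomial (MvPolynomial (Fin (q + 1)) ℂ) :=
  -(∑ j, coeffwise (pderiv j).toLinearMap ∘ₗ LinearMap.mulLeft ℂ (Polynomial.C (δ j)))
    - LinearMap.mulLeft ℂ (Polynomial.C L₀)
    - LinearMap.mulLeft ℂ (Polynomial.X * Polynomial.C L₁)

theorem coeff_dualLogOp (δ : Fin (q + 1) → MvPolynomial (Fin (q + 1)) ℂ)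
    (L₀ L₁ : MvPolynomial (Fin (q + 1)) ℂ) (f : Polynomial (MvPolynomial (Fin (q + 1)) ℂ)) (m : ℕ) :
    (dualLogOp δ L₀ L₁ f).coeff m = -(∑ j, pderiv j (δ j * f.coeff m)) - L₀ * f.coeff m
      - L₁ * (Polynomial.X * f).coeff m := by
  simp [dualLogOp, coeff_coeffwise, Polynomial.finsetSum_coeff]

theorem coeffwise_dualLogOp {δ : Fin (q + 1) → MvPolynomial (Fin (q + 1)) ℂ}
    {L₀ L₁ : MvPolynomial (Fin (q + 1)) ℂ} {d : ℕ} (hδ : ∀ j, (δ j).IsHomogeneous (d + 1))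
    (h₀ : L₀.IsHomogeneous d) (h₁ : L₁.IsHomogeneous d) (e : ℕ)
    (f : Polynomial (MvPolynomial (Fin (q + 1)) ℂ)) :
    coeffwise (homogeneousComponent e) (dualLogOp δ L₀ L₁ f) =
      if d ≤ e then dualLogOp δ L₀ L₁ (coeffwise (homogeneousComponent (e - d)) f) else 0 := by
  ext1 m
  rw [coeff_coeffwise, coeff_dualLogOp, map_sub, map_sub, map_neg, map_sum]
  simp only [homogeneousComponent_pderiv, homogeneousComponent_mul_of_isHomogeneous (hδ _),
    homogeneousComponent_mul_of_isHomogeneous h₀, homogeneousComponent_mul_of_isHomogeneous h₁,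
    Nat.add_le_add_iff_right, Nat.add_sub_add_right]
  split_ifs with h
  · rw [coeff_dualLogOp, ← coeffwise_X_mul]
    simp only [coeff_coeffwise]
  · simp

theorem dualLogOp_apply (δ : Fin (q + 1) → MvPolynomial (Fin (q + 1)) ℂ)
    (L₀ L₁ : MvPolynomial (Fin (q + 1)) ℂ) (f : Polynomial (MvPolynomial (Fin (q + 1)) ℂ)) :
    dualLogOp δ L₀ L₁ f = dualLogOp δ L₀ 0 f - Polynomial.X * (Polynomial.C L₁ * f) := by
  simp only [dualLogOp, LinearMap.sub_apply, LinearMap.neg_apply, LinearMap.mulLeft_apply, map_zero,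
    mul_zero, zero_mul, sub_zero, mul_assoc]

theorem dualLogOp_zero_mem_degreeLT (δ : Fin (q + 1) → MvPolynomial (Fin (q + 1)) ℂ)
    (L₀ : MvPolynomial (Fin (q + 1)) ℂ) {f : Polynomial (MvPolynomial (Fin (q + 1)) ℂ)} {e : ℕ}
    (hf : f ∈ Polynomial.degreeLT _ e) : dualLogOp δ L₀ 0 f ∈ Polynomial.degreeLT _ e := by
  rw [Polynomial.mem_degreeLT, Polynomial.degree_lt_iff_coeff_zero] at hf ⊢
  intro m hm
  rw [coeff_dualLogOp, hf m hm]
  simp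

theorem coeff_zero_of_forall_exists_dualLogOp {K : Type*} [Fintype K] {c : K → Fin (q + 1) → ℂ}
    (hc : ∀ k, c k ≠ 0)
    (hprop : ∀ k k', k ≠ k' → ∀ t : ℂ, c k ≠ t • c k')
    (hspan : ∀ y, (∀ k, c k ⬝ᵥ y = 0) → y = 0)
    {δ : Fin (q + 1) → Fin (q + 1) → MvPolynomial (Fin (q + 1)) ℂ} {d : Fin (q + 1) → ℕ}
    (hδ0 : δ 0 = X) (hd0 : d 0 = 0) (hd : ∀ i : Fin q, 1 ≤ d i.succ)
    (hδh : ∀ i j, (δ i j).IsHomogeneous (d i + 1))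
    (hgen : logFields c ≤ Submodule.span (MvPolynomial (Fin (q + 1)) ℂ) (Set.range δ))
    {lam : Fin (q + 1) → K → MvPolynomial (Fin (q + 1)) ℂ}
    (hlam : ∀ i k, ∑ j, C (c k j) * δ i j = linForm (c k) * lam i k)
    (hlamh : ∀ i k, (lam i k).IsHomogeneous (d i))
    {s₀ a : K → ℂ} (ha : ∑ k, a k = 0)
    (ha' : ∀ Z : Finset K, Z.Nonempty → ∑ k ∈ Z, a k = 0 → Z = Finset.univ)
    {j : ℕ} (hj : (∑ k, s₀ k) + ((q : ℂ) + 1 + j) = 0) (hjle : j ≤ 2 * (Fintype.card K - (q + 1)))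
    {E : Fin (q + 1) → Polynomial (MvPolynomial (Fin (q + 1)) ℂ) →ₗ[ℂ]
      Polynomial (MvPolynomial (Fin (q + 1)) ℂ)}
    (hE : ∀ i, E i = dualLogOp (δ i) (∑ k, C (s₀ k) * lam i k) (∑ k, C (a k) * lam i k))
    (hcomm : ∀ i k, ∃ b : Fin (q + 1) → MvPolynomial (Fin (q + 1)) ℂ,
      ∀ f, E i (E k f) - E k (E i f) = ∑ m, E m (Polynomial.C (b m) * f))
    (hG : ∀ i, ∃ μ, ∀ f, E i (Polynomial.C (∏ k, linForm (c k)) * f) =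
      Polynomial.C (∏ k, linForm (c k)) * (E i f - Polynomial.C μ * f))
    {v : MvPolynomial (Fin (q + 1)) ℂ} (hv : coeff 0 v ≠ 0) (β : Polynomial ℂ)
    (h : ∀ g, ∃ f₀, ∃ f : Fin (q + 1) → Polynomial (MvPolynomial (Fin (q + 1)) ℂ),
      Polynomial.C v * β.map (algebraMap ℂ (MvPolynomial (Fin (q + 1)) ℂ)) * g =
      Polynomial.C (∏ k, linForm (c k)) * f₀ + ∑ i, E i (f i)) : β = 0 := by
  classical
  by_contra hβ
  set F := ∏ k, linForm (c k) with hF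
  have hKne : Nonempty K := by
    by_contra hne
    rw [not_nonempty_iff] at hne
    have := congrFun (hspan (fun _ => 1) fun k => hne.elim k) 0
    simp at this
  have hFh : F.IsHomogeneous (Fintype.card K) := by
    have := IsHomogeneous.prod Finset.univ (fun k => linForm (c k)) (fun _ => 1)
      fun k _ => linForm_isHomogeneous (c k)
    simpa using this
  have hlam0 : ∀ k, lam 0 k = 1 := by
    intro k
    have h1 := hlam 0 k
    rw [hδ0] at h1
    exact (mul_left_cancel₀ (linForm_ne_zero (hc k)) ((mul_one _).trans h1)).symm
  set L : (K → ℂ) → Fin (q + 1) → MvPolynomial (Fin (q + 1)) ℂ :=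
    fun a i => ∑ k, C (a k) * lam i k with hL
  have hLh : ∀ a i, (L a i).IsHomogeneous (d i) := fun a i =>
    IsHomogeneous.sum _ _ _ fun k _ => (hlamh i k).C_mul _
  have hLa0 : L a 0 = 0 := by
    simp only [hL, hlam0, mul_one]
    rw [← map_sum, ha, map_zero]
  set gs : Fin (q + 1) → MvPolynomial (Fin (q + 1)) ℂ := Fin.cons F fun i => L a i.succ with hgs
  set D : Fin (q + 1) → ℕ := Fin.cons (Fintype.card K) fun i => d i.succ with hD
  have hcard : 0 < Fintype.card K := Fintype.card_pos
  have hD1 : ∀ i, 1 ≤ D i := by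
    intro i
    refine Fin.cases ?_ (fun i => ?_) i
    · exact hcard
    · simpa [hD] using hd i
  have hgsh : ∀ i, (gs i).IsHomogeneous (D i) := by
    intro i
    refine Fin.cases ?_ (fun i => ?_) i
    · simpa [hD, hgs] using hFh
    · simpa [hD, hgs] using hLh a i.succ
  have hreg : IsWeaklyRegular (MvPolynomial (Fin (q + 1)) ℂ) (List.ofFn gs) := by
    refine isWeaklyRegular_of_isWeightedHomogeneous (fun _ => 1) (fun _ => one_pos) _ (by simp) ?_ ?_
    · intro g hg
      obtain ⟨i, rfl⟩ := (List.mem_ofFn ..).1 hg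
      exact ⟨D i, hD1 i, hgsh i⟩
    · intro y hy
      have hy' : ∀ i, eval y (gs i) = 0 := fun i => hy _ ((List.mem_ofFn ..).2 ⟨i, rfl⟩)
      have hyF : eval y F = 0 := by simpa [hgs] using hy' 0
      have hyL : ∀ i, eval y (L a i) = 0 := by
        intro i
        refine Fin.cases ?_ (fun i => ?_) i
        · rw [hLa0, map_zero]
        · simpa [hgs] using hy' i.succ
      have h5 := sum_eq_zero_of_eval_relation (y := y) (ξ := 0) (s := a) hc hgen hlam (by
        intro i
        have := hyL i
        simp only [hL, map_sum, map_mul, eval_C] at this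
        simp only [Pi.zero_apply, mul_zero, Finset.sum_const_zero]
        rw [← this]
        exact Finset.sum_congr rfl fun k _ => mul_comm _ _)
      have h6 := ha' _ (by
        rw [hF, map_prod, Finset.prod_eq_zero_iff] at hyF
        obtain ⟨k, -, hk⟩ := hyF
        rw [eval_linForm] at hk
        exact ⟨k, Finset.mem_filter.2 ⟨Finset.mem_univ k, hk⟩⟩) h5
      exact hspan y fun k => (Finset.mem_filter.1
        (h6.symm ▸ Finset.mem_univ k : k ∈ Finset.univ.filter fun k => c k ⬝ᵥ y = 0)).2
  have hjD : j ≤ ∑ i, (D i - 1) := by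
    have h7 := card_le_sum_degree hc hprop hgen hlam hδh
    rw [Fin.sum_univ_succ] at h7 ⊢
    have h8 : ∑ i : Fin q, (d i.succ + 1) = ∑ i : Fin q, (d i.succ - 1) + 2 * q := by
      rw [show 2 * q = ∑ _i : Fin q, 2 by simp [mul_comm], ← Finset.sum_add_distrib]
      exact Finset.sum_congr rfl fun i _ => by have := hd i; omega
    rw [h8, hd0] at h7
    simp only [hD, Fin.cons_zero, Fin.cons_succ]
    omega
  refine not_homogeneousSubmodule_le_of_isWeaklyRegular gs hreg D hgsh hD1 j hjD fun g hg => ?_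
  set π := coeffwise (S := MvPolynomial (Fin (q + 1)) ℂ) (homogeneousComponent j) with hπ
  have hπE : ∀ i (e : ℕ), ∀ f ∈ Polynomial.degreeLT (MvPolynomial (Fin (q + 1)) ℂ) e,
      ∃ f' ∈ Polynomial.degreeLT (MvPolynomial (Fin (q + 1)) ℂ) e, π (E i f) = E i f' := by
    intro i e f hf
    rw [hπ, hE, coeffwise_dualLogOp (hδh i) (hLh s₀ i) (hLh a i)]
    split_ifs with h9
    · exact ⟨_, coeffwise_mem_degreeLT _ hf, rfl⟩
    · exact ⟨0, zero_mem _, (map_zero _).symm⟩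
  have hπG : ∀ (e : ℕ), ∀ f ∈ Polynomial.degreeLT (MvPolynomial (Fin (q + 1)) ℂ) e,
      ∃ f' ∈ Polynomial.degreeLT (MvPolynomial (Fin (q + 1)) ℂ) e,
        π (Polynomial.C F * f) = Polynomial.C F * f' := by
    intro e f hf
    refine ⟨if Fintype.card K ≤ j then coeffwise (homogeneousComponent (j - Fintype.card K)) f
      else 0, ?_, ?_⟩
    · split_ifs
      · exact coeffwise_mem_degreeLT _ hf
      · exact zero_mem _
    · ext1 m
      rw [hπ, coeff_coeffwise, Polynomial.coeff_C_mul, Polynomial.coeff_C_mul,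
        homogeneousComponent_mul_of_isHomogeneous hFh]
      split_ifs
      · rw [coeff_coeffwise]
      · simp
  obtain ⟨f₀, f, hf⟩ := h (Polynomial.C g * Polynomial.X)
  set h₀ : Polynomial (MvPolynomial (Fin (q + 1)) ℂ) :=
    Polynomial.C (C (coeff 0 v) * g) * β.map (algebraMap ℂ _) * Polynomial.X with hh₀
  have hπh : π (Polynomial.C v * β.map (algebraMap ℂ (MvPolynomial (Fin (q + 1)) ℂ)) *
      (Polynomial.C g * Polynomial.X)) = h₀ := by
    ext1 m
    rw [hπ, coeff_coeffwise, hh₀]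
    have hcoef : ∀ p : MvPolynomial (Fin (q + 1)) ℂ, ∀ x : ℂ,
        homogeneousComponent j (p * C x) = homogeneousComponent j p * C x := by
      intro p x
      rw [mul_comm, homogeneousComponent_C_mul, mul_comm]
    have hvg : homogeneousComponent j (v * g) = C (coeff 0 v) * g := by
      rw [mul_comm, homogeneousComponent_mul_of_isHomogeneous hg, if_pos le_rfl, Nat.sub_self,
        homogeneousComponent_zero, mul_comm]
    rw [show Polynomial.C v * β.map (algebraMap ℂ (MvPolynomial (Fin (q + 1)) ℂ)) *
      (Polynomial.C g * Polynomial.X) = Polynomial.C (v * g) * β.map (algebraMap ℂ _) *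
        Polynomial.X by rw [Polynomial.C_mul]; ring]
    rcases m with _ | m
    · simp
    · rw [Polynomial.coeff_mul_X, Polynomial.coeff_mul_X, Polynomial.coeff_C_mul,
        Polynomial.coeff_C_mul, Polynomial.coeff_map, algebraMap_eq, hcoef, hvg]
  have hππ : ∀ p, π (π p) = π p := by
    intro p
    ext1 m
    simp only [hπ, coeff_coeffwise]
    rw [homogeneousComponent_of_mem (homogeneousComponent_isHomogeneous _ _), if_pos rfl]
  obtain ⟨e, he₀, he⟩ : ∃ e, f₀ ∈ Polynomial.degreeLT (MvPolynomial (Fin (q + 1)) ℂ) e ∧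
      ∀ i, f i ∈ Polynomial.degreeLT (MvPolynomial (Fin (q + 1)) ℂ) e := by
    refine ⟨f₀.natDegree + 1 + ∑ i, ((f i).natDegree + 1), ?_, fun i => ?_⟩
    · rw [Polynomial.mem_degreeLT]
      refine lt_of_le_of_lt Polynomial.degree_le_natDegree ?_
      exact_mod_cast (by omega)
    · rw [Polynomial.mem_degreeLT]
      refine lt_of_le_of_lt Polynomial.degree_le_natDegree ?_
      have := Finset.single_le_sum (f := fun i => (f i).natDegree + 1) (fun _ _ => Nat.zero_le _)
        (Finset.mem_univ i)
      exact_mod_cast (by omega)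
  have hmem : h₀ ∈ boundedRange F E (β.natDegree + 1 + e) := by
    rw [← hπh, hf, map_add, map_sum]
    obtain ⟨f₀', hf₀', hf₀''⟩ := hπG _ _ he₀
    choose f' hf' hf'' using fun i => hπE i _ _ (he i)
    refine ⟨f₀', Polynomial.degreeLT_mono (by omega) hf₀', f',
      fun i => Polynomial.degreeLT_mono (by omega) (hf' i), ?_⟩
    simp only [hf₀'', hf'']
  have hdeg : h₀ ∈ Polynomial.degreeLT (MvPolynomial (Fin (q + 1)) ℂ) (β.natDegree + 2) := by
    rw [Polynomial.mem_degreeLT, Polynomial.degree_lt_iff_coeff_zero]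
    intro m hm
    obtain ⟨m, rfl⟩ : ∃ m', m = m' + 1 := ⟨m - 1, by omega⟩
    rw [hh₀, Polynomial.coeff_mul_X, Polynomial.coeff_C_mul, Polynomial.coeff_map,
      Polynomial.coeff_eq_zero_of_natDegree_lt (by omega)]
    simp
  have key := coeff_mem_of_mem_boundedRange (E := E) (G := F) (lam := L a) (π := π)
    (P := fun i => dualLogOp (δ i) (L s₀ i) 0)
    (fun i f => by rw [hE]; exact dualLogOp_apply _ _ _ _)
    (fun i e f hf => dualLogOp_zero_mem_degreeLT _ _ hf) hcomm hG hreg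
    (fun f => by
      rw [hπ, hE, hδ0]
      ext1 m
      rw [coeff_coeffwise, coeff_dualLogOp]
      have e1 : ∑ k, C (s₀ k) * lam 0 k = C (∑ k, s₀ k) := by
        simp only [hlam0, mul_one, map_sum]
      have e2 : ∑ k, C (a k) * lam 0 k = 0 := hLa0
      rw [e1, e2, zero_mul, sub_zero, map_sub, map_neg, homogeneousComponent_sum_pderiv_X_mul,
        homogeneousComponent_C_mul, ← smul_eq_C_mul, ← neg_smul, ← sub_smul, Polynomial.coeff_zero]
      rw [show -((j : ℂ) + ((q + 1 : ℕ) : ℂ)) - ∑ k, s₀ k = 0 by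
        push_cast; linear_combination -hj, zero_smul])
    hπE hπG (by rw [← hπh, hππ]) hmem hdeg
  rw [hh₀, Polynomial.coeff_mul_X, Polynomial.coeff_C_mul, Polynomial.coeff_map, algebraMap_eq] at key
  have hne : coeff 0 v * β.leadingCoeff ≠ 0 :=
    mul_ne_zero hv (Polynomial.leadingCoeff_ne_zero.2 hβ)
  have key' := Ideal.mul_mem_left _ (C (coeff 0 v * β.leadingCoeff)⁻¹) key
  convert key' using 1
  calc g = C ((coeff 0 v * β.leadingCoeff)⁻¹ * (coeff 0 v * β.leadingCoeff)) * g := by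
        rw [inv_mul_cancel₀ hne, C_1, one_mul]
    _ = _ := by rw [C_mul, C_mul (a := coeff 0 v), Polynomial.leadingCoeff]; ring

end DualLogOperators

section LogarithmicReduction
open MvPolynomial

section Abstract

variable {J κ S B M : Type*} [CommRing S] [Ring B] [AddCommGroup M] [Module B M]
  (φ : S →+* B) (d : (J →₀ ℕ) → B) (Dv : J → B) (der : J → S →+ S)
  (e : κ → J) (jj : MvPolynomial κ S →+ M) (G : S) (ω : J → MvPolynomial κ S)

theorem coeffMap_zero (p : MvPolynomial κ S) : coeffMap (0 : S →+ S) p = 0 := by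
  ext; rw [coeff_coeffMap]; rfl

theorem normalOrder_rename_mul_X
    (hd : ∀ β j, d (β + Finsupp.single j 1) = d β * Dv j)
    (hd' : ∀ β j, Dv j * d β = d β * Dv j)
    (hD : ∀ j f, Dv j * φ f = φ f * Dv j + φ (der j f))
    (hder0 : ∀ k, der (e k) = 0) (k : κ) (a : MvPolynomial κ S) :
    normalOrder φ d (rename e (a * X k)) = Dv (e k) * normalOrder φ d (rename e a) := by
  rw [mul_normalOrder φ d Dv der hd hd' hD, hder0, coeffMap_zero, add_zero, map_mul, rename_X, mul_comm]

theorem normalOrder_rename_smul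
    (hd0 : d 0 = 1) (hd : ∀ β j, d (β + Finsupp.single j 1) = d β * Dv j)
    (hd' : ∀ β j, Dv j * d β = d β * Dv j)
    (hD : ∀ j f, Dv j * φ f = φ f * Dv j + φ (der j f))
    (hder0 : ∀ k, der (e k) = 0)
    (hjj : ∀ f a, φ f • jj a = jj (C f * a))
    (hDe : ∀ k a, Dv (e k) • jj a = jj (X k * a)) (a : MvPolynomial κ S) :
    normalOrder φ d (rename e a) • jj 1 = jj a := by
  induction a using MvPolynomial.induction_on with
  | C f => rw [rename_C, normalOrder_C φ d hd0, hjj, mul_one]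
  | add p q hp hq => rw [map_add, map_add, add_smul, hp, hq, map_add]
  | mul_X p k hp =>
    rw [normalOrder_rename_mul_X φ d Dv der e hd hd' hD hder0, mul_smul, hp, hDe, mul_comm]

theorem exists_normalOrder_rename_eq {I : Type*} [Fintype I] (τ : I → MvPolynomial J S)
    (hd0 : d 0 = 1) (hd : ∀ β j, d (β + Finsupp.single j 1) = d β * Dv j)
    (hd' : ∀ β j, Dv j * d β = d β * Dv j)
    (hD : ∀ j f, Dv j * φ f = φ f * Dv j + φ (der j f))
    (hder : ∀ j a b, der j (a * b) = a * der j b + b * der j a)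
    (hder0 : ∀ k, der (e k) = 0)
    (hjj : ∀ f a, φ f • jj a = jj (C f * a))
    (hDe : ∀ k a, Dv (e k) • jj a = jj (X k * a))
    (hω : ∀ j, ω j ∈ degLT κ S 2)
    (hDjj : ∀ j a, φ G • Dv j • jj a = jj (C G * coeffMap (der j) a + ω j * a))
    (hinj : Function.Injective jj)
    (hτ : ∀ i, (τ i).IsHomogeneous 1)
    (hgτ : ∀ j, C G * X j - rename e (ω j) ∈ Ideal.span (Set.range τ))
    (hreg : ∀ w, C G * w ∈ Ideal.span (Set.range τ) → w ∈ Ideal.span (Set.range τ))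
    (hann : ∀ i, normalOrder φ d (τ i) • jj 1 = 0)
    {a : MvPolynomial κ S}
    (ha : ∀ N : AddSubgroup M, jj (C G) ∈ N → (∀ f, ∀ m ∈ N, φ f • m ∈ N) →
      (∀ j, ∀ m ∈ N, Dv j • m ∈ N) → jj a ∈ N) :
    ∃ P : B, ∃ Q : I → B,
      normalOrder φ d (rename e a) = P * φ G + ∑ i, Q i * normalOrder φ d (τ i) := by
  obtain ⟨p, hp⟩ : ∃ p, normalOrder φ d p • jj (C G) = jj a := by
    refine ha ((((AddMonoidHom.flip (smulAddHom B M)) (jj (C G))).comp (normalOrder φ d)).range)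
      ⟨1, ?_⟩ ?_ ?_
    · change normalOrder φ d 1 • jj (C G) = _
      rw [← C_1, normalOrder_C φ d hd0, map_one, one_smul]
    · rintro f _ ⟨p, rfl⟩
      refine ⟨C f * p, ?_⟩
      change normalOrder φ d _ • jj (C G) = φ f • normalOrder φ d p • jj (C G)
      rw [normalOrder_C_mul, mul_smul]
    · rintro j _ ⟨p, rfl⟩
      refine ⟨X j * p + coeffMap (der j) p, ?_⟩
      change normalOrder φ d _ • jj (C G) = Dv j • normalOrder φ d p • jj (C G)
      rw [← mul_normalOrder φ d Dv der hd hd' hD, mul_smul]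
  obtain ⟨low, -, hlow⟩ := exists_normalOrder_mul φ d Dv der hd0 hd hd' hD
    (mem_degLT_totalDegree p) (mem_degLT_totalDegree (C G : MvPolynomial J S))
  rw [normalOrder_C φ d hd0] at hlow
  obtain ⟨q, hq⟩ := exists_normalOrder_eq_sum φ d Dv der e jj G ω τ hd0 hd hd' hD hder hjj hω hDjj
    hinj hτ hgτ hreg hann (rename e a - (p * C G + low)) (by
      rw [map_sub, ← hlow, sub_smul, mul_smul, hjj, mul_one, hp,
        normalOrder_rename_smul φ d Dv der e jj hd0 hd hd' hD hder0 hjj hDe, sub_self])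
  refine ⟨normalOrder φ d p, fun i => normalOrder φ d (q i), ?_⟩
  rw [← hq, map_sub, hlow]
  abel

theorem commutator_sum_mul {I : Type*} [Fintype I] [Fintype J] (t : I → J → S)
    (hcomm : ∀ x y, Dv x * Dv y = Dv y * Dv x)
    (hD : ∀ j f, Dv j * φ f = φ f * Dv j + φ (der j f)) (i k : I) {b : I → S}
    (hb : ∀ y, ∑ x, (t i x * der x (t k y) - t k x * der x (t i y)) = ∑ m, b m * t m y) :
    (∑ x, φ (t i x) * Dv x) * (∑ x, φ (t k x) * Dv x)
      - (∑ x, φ (t k x) * Dv x) * (∑ x, φ (t i x) * Dv x)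
      = ∑ m, φ (b m) * ∑ x, φ (t m x) * Dv x := by
  have key : ∀ i k, (∑ x, φ (t i x) * Dv x) * (∑ x, φ (t k x) * Dv x) =
      ∑ x, ∑ y, φ (t i x * t k y) * (Dv x * Dv y) +
        ∑ y, φ (∑ x, t i x * der x (t k y)) * Dv y := by
    intro i k
    rw [Finset.sum_mul_sum]
    simp only [map_sum, Finset.sum_mul]
    rw [Finset.sum_comm (f := fun y x => φ (t i x * der x (t k y)) * Dv y),
      ← Finset.sum_add_distrib]
    refine Finset.sum_congr rfl fun x _ => ?_
    rw [← Finset.sum_add_distrib]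
    refine Finset.sum_congr rfl fun y _ => ?_
    rw [show φ (t i x) * Dv x * (φ (t k y) * Dv y) = φ (t i x) * (Dv x * φ (t k y)) * Dv y by
      simp only [mul_assoc], hD, map_mul, map_mul]
    simp only [mul_add, add_mul, mul_assoc]
  have hsymm : ∑ x, ∑ y, φ (t i x * t k y) * (Dv x * Dv y) =
      ∑ x, ∑ y, φ (t k x * t i y) * (Dv x * Dv y) := by
    rw [Finset.sum_comm]
    refine Finset.sum_congr rfl fun x _ => Finset.sum_congr rfl fun y _ => ?_
    rw [hcomm, mul_comm (t i y)]
  rw [key, key, hsymm, add_sub_add_left_eq_sub, ← Finset.sum_sub_distrib]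
  simp only [Finset.mul_sum, ← mul_assoc, ← map_mul]
  rw [Finset.sum_comm]
  refine Finset.sum_congr rfl fun y _ => ?_
  rw [← sub_mul, ← map_sub, ← Finset.sum_sub_distrib, hb, map_sum, Finset.sum_mul]

theorem sum_mul_mul_map [Fintype J] (t : J → S)
    (hD : ∀ j f, Dv j * φ f = φ f * Dv j + φ (der j f)) :
    (∑ x, φ (t x) * Dv x) * φ G =
      φ G * (∑ x, φ (t x) * Dv x) + φ (∑ x, t x * der x G) := by
  rw [Finset.sum_mul, Finset.mul_sum, map_sum, ← Finset.sum_add_distrib]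
  refine Finset.sum_congr rfl fun x _ => ?_
  rw [mul_assoc, hD, mul_add, map_mul, ← mul_assoc, ← mul_assoc, ← map_mul, ← map_mul, ← map_mul,
    mul_comm G]

theorem normalOrder_sub_linear {J₁ J₂ : Type*} [Fintype J₁] [Fintype J₂]
    {d : ((J₁ ⊕ J₂) →₀ ℕ) → B} {Dv : J₁ ⊕ J₂ → B} (hd0 : d 0 = 1)
    (hd : ∀ β j, d (β + Finsupp.single j 1) = d β * Dv j) (f : J₁ → S) (g : J₂ → S) :
    normalOrder φ d (∑ j, C (f j) * X (Sum.inl j) - ∑ k, C (g k) * X (Sum.inr k)) =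
      ∑ x, φ (Sum.elim f (-g) x) * Dv x := by
  rw [Fintype.sum_sum_type, map_sub, map_sum, map_sum, sub_eq_add_neg, ← Finset.sum_neg_distrib]
  simp only [normalOrder_C_mul, normalOrder_X φ d Dv hd0 hd, Sum.elim_inl, Sum.elim_inr,
    Pi.neg_apply, map_neg, neg_mul]

end Abstract

end LogarithmicReduction

section PolarizedReduction
open MvPolynomial

variable {q : ℕ} {K : Type*}

local notation "S" => MvPolynomial (Fin (q + 1)) ℂ

/-- Operators on functions `(K → ℕ) → S` paired with transposed operators on `S[X]`. -/
abbrev PairEnd (q : ℕ) (K : Type*) : Type _ :=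
  Module.End ℂ ((K → ℕ) → MvPolynomial (Fin (q + 1)) ℂ) ×
    (Module.End ℂ (Polynomial (MvPolynomial (Fin (q + 1)) ℂ)))ᵐᵒᵖ

/-- Multiplication by a polynomial, on both sides. -/
noncomputable def pairCoeff (q : ℕ) (K : Type*) : MvPolynomial (Fin (q + 1)) ℂ →+* PairEnd q K :=
  RingHom.prod (Algebra.lsmul ℂ ℂ ((K → ℕ) → MvPolynomial (Fin (q + 1)) ℂ)).toRingHom
    ((Algebra.lsmul ℂ ℂ (Polynomial (MvPolynomial (Fin (q + 1)) ℂ))).toRingHom.toOpposite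
      fun a b => by
        change _ * _ = _ * _
        rw [← map_mul, ← map_mul, mul_comm])

theorem pairCoeff_fst (f : S) (m : (K → ℕ) → S) (s : K → ℕ) :
    (pairCoeff q K f).1 m s = f * m s := rfl

theorem pairCoeff_snd (f : S) (m : Polynomial S) :
    (pairCoeff q K f).2.unop m = Polynomial.C f * m := by
  change f • m = _
  rw [Polynomial.smul_eq_C_mul]

/-- The derivations `∂ⱼ` and the variables `sₖ`, acting on functions of `s`, together with their
transposes specialised at the line `s₀ + t a`. -/
noncomputable def pairOp (s₀ a : K → ℂ) : Fin (q + 1) ⊕ K → PairEnd q K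
  | Sum.inl j => ((pderiv j).toLinearMap.compLeft (K → ℕ),
      MulOpposite.op (-coeffwise (pderiv j).toLinearMap))
  | Sum.inr k => (LinearMap.pi fun s => (s k : ℂ) • LinearMap.proj s,
      MulOpposite.op (LinearMap.mulLeft ℂ
        (Polynomial.C (C (s₀ k)) + Polynomial.C (C (a k)) * Polynomial.X)))

/-- The derivation of coefficients attached to each operator. -/
noncomputable def pairDer (q : ℕ) (K : Type*) : Fin (q + 1) ⊕ K →
    MvPolynomial (Fin (q + 1)) ℂ →+ MvPolynomial (Fin (q + 1)) ℂ
  | Sum.inl j => AddMonoidHomClass.toAddMonoidHom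
      (pderiv j : Derivation ℂ (MvPolynomial (Fin (q + 1)) ℂ) (MvPolynomial (Fin (q + 1)) ℂ))
  | Sum.inr _ => 0

variable (s₀ a : K → ℂ)

theorem pderiv_comm_apply {σ : Type*} (i j : σ) (f : MvPolynomial σ ℂ) :
    pderiv i (pderiv j f) = pderiv j (pderiv i f) := by
  classical
  have : ⁅(pderiv i : Derivation ℂ (MvPolynomial σ ℂ) (MvPolynomial σ ℂ)),
      (pderiv j : Derivation ℂ (MvPolynomial σ ℂ) (MvPolynomial σ ℂ))⁆ = 0 := by
    refine derivation_ext fun k => ?_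
    rw [Derivation.commutator_apply]
    simp only [pderiv_X, Pi.single_apply]
    split_ifs <;> simp
  rw [← sub_eq_zero, ← Derivation.commutator_apply, this]; rfl

theorem pairOp_inl_fst (j : Fin (q + 1)) (m : (K → ℕ) → S) (s : K → ℕ) :
    (pairOp s₀ a (Sum.inl j)).1 m s = pderiv j (m s) := rfl

theorem pairOp_inr_fst (k : K) (m : (K → ℕ) → S) (s : K → ℕ) :
    (pairOp (q := q) s₀ a (Sum.inr k)).1 m s = (s k : ℂ) • m s := rfl

theorem pairOp_inl_snd (j : Fin (q + 1)) (m : Polynomial S) :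
    (pairOp s₀ a (Sum.inl j)).2.unop m = -coeffwise (pderiv j).toLinearMap m := rfl

theorem pairOp_inr_snd (k : K) (m : Polynomial S) :
    (pairOp (q := q) s₀ a (Sum.inr k)).2.unop m =
      (Polynomial.C (C (s₀ k)) + Polynomial.C (C (a k)) * Polynomial.X) * m := rfl

theorem PairEnd.mul_fst (x y : PairEnd q K) (m : (K → ℕ) → S) :
    (x * y).1 m = x.1 (y.1 m) := rfl

theorem PairEnd.mul_snd (x y : PairEnd q K) (m : Polynomial S) :
    (x * y).2.unop m = y.2.unop (x.2.unop m) := rfl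

theorem PairEnd.add_fst (x y : PairEnd q K) (m : (K → ℕ) → S) :
    (x + y).1 m = x.1 m + y.1 m := rfl

theorem PairEnd.add_snd (x y : PairEnd q K) (m : Polynomial S) :
    (x + y).2.unop m = x.2.unop m + y.2.unop m := rfl

theorem PairEnd.ext' {x y : PairEnd q K} (h₁ : ∀ m s, x.1 m s = y.1 m s)
    (h₂ : ∀ m, x.2.unop m = y.2.unop m) : x = y :=
  Prod.ext (LinearMap.ext fun m => funext fun s => h₁ m s)
    (MulOpposite.unop_injective (LinearMap.ext h₂))

theorem pairOp_comm (x y : Fin (q + 1) ⊕ K) :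
    pairOp s₀ a x * pairOp s₀ a y = pairOp s₀ a y * pairOp s₀ a x := by
  have hmix : ∀ (j : Fin (q + 1)) (k : K) (m : Polynomial S),
      coeffwise (pderiv j).toLinearMap
        ((Polynomial.C (C (s₀ k)) + Polynomial.C (C (a k)) * Polynomial.X) * m) =
      (Polynomial.C (C (s₀ k)) + Polynomial.C (C (a k)) * Polynomial.X) *
        coeffwise (pderiv j).toLinearMap m := by
    intro j k m
    rw [add_mul, add_mul, map_add, coeffwise_derivation_C_mul, mul_assoc,
      coeffwise_derivation_C_mul, coeffwise_X_mul, pderiv_C, pderiv_C]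
    simp only [map_zero, zero_mul, add_zero]
    ring
  refine PairEnd.ext' (fun m s => ?_) fun m => ?_
  · rw [PairEnd.mul_fst, PairEnd.mul_fst]
    rcases x with x | x <;> rcases y with y | y <;>
      simp only [pairOp_inl_fst, pairOp_inr_fst, Derivation.map_smul]
    · exact pderiv_comm_apply _ _ _
    · exact smul_comm _ _ _
  · rw [PairEnd.mul_snd, PairEnd.mul_snd]
    rcases x with x | x <;> rcases y with y | y <;>
      simp only [pairOp_inl_snd, pairOp_inr_snd, hmix, map_neg]
    · ext1 n
      rw [Polynomial.coeff_neg, Polynomial.coeff_neg, Polynomial.coeff_neg, Polynomial.coeff_neg,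
        coeff_coeffwise, coeff_coeffwise, coeff_coeffwise, coeff_coeffwise]
      simp only [neg_neg]
      exact pderiv_comm_apply _ _ _
    · ring

theorem pairDer_inl (j : Fin (q + 1)) (f : S) : pairDer q K (Sum.inl j) f = pderiv j f := rfl

theorem pairDer_inr (k : K) : pairDer q K (Sum.inr k) = 0 := rfl

theorem pairOp_mul_pairCoeff (x : Fin (q + 1) ⊕ K) (f : S) :
    pairOp s₀ a x * pairCoeff q K f = pairCoeff q K f * pairOp s₀ a x +
      pairCoeff q K (pairDer q K x f) := by
  refine PairEnd.ext' (fun m s => ?_) fun m => ?_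
  · rw [PairEnd.add_fst, PairEnd.mul_fst, PairEnd.mul_fst, Pi.add_apply]
    rcases x with x | x <;>
      simp only [pairOp_inl_fst, pairOp_inr_fst, pairCoeff_fst, pderiv_mul, pairDer_inl, pairDer_inr,
        AddMonoidHom.zero_apply, zero_mul, add_zero, mul_smul_comm]
    ring
  · rw [PairEnd.add_snd, PairEnd.mul_snd, PairEnd.mul_snd]
    rcases x with x | x
    · simp only [pairOp_inl_snd, pairCoeff_snd, coeffwise_derivation_C_mul, pairDer_inl]
      ring
    · simp only [pairOp_inr_snd, pairCoeff_snd, pairDer_inr, AddMonoidHom.zero_apply, zero_mul,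
        Polynomial.C_0]
      ring

theorem pairDer_mul (x : Fin (q + 1) ⊕ K) (f g : S) :
    pairDer q K x (f * g) = f * pairDer q K x g + g * pairDer q K x f := by
  rcases x with x | x
  · simp only [pairDer_inl, pderiv_mul]; ring
  · simp [pairDer_inr]

/-- The function `s ↦ a(s) ∏ lₖ ^ sₖ` attached to a polynomial in the variables `sₖ`. -/
noncomputable def powerFunction [Fintype K] (l : K → MvPolynomial (Fin (q + 1)) ℂ) :
    MvPolynomial K (MvPolynomial (Fin (q + 1)) ℂ) →+ ((K → ℕ) → MvPolynomial (Fin (q + 1)) ℂ) where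
  toFun a s := eval (fun k => (s k : S)) a * ∏ k, l k ^ s k
  map_zero' := by ext1 s; simp
  map_add' a b := by ext1 s; simp [add_mul]

theorem powerFunction_apply [Fintype K] (l : K → S) (a : MvPolynomial K S) (s : K → ℕ) :
    powerFunction l a s = eval (fun k => (s k : S)) a * ∏ k, l k ^ s k := rfl

theorem powerFunction_injective [Fintype K] {l : K → S} (hl : ∀ k, l k ≠ 0) :
    Function.Injective (powerFunction l) := by
  intro p p' h
  refine funext_set (fun _ => Set.range fun n : ℕ => (n : S))
    (fun _ => Set.infinite_range_of_injective Nat.cast_injective) fun x hx => ?_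
  choose s hs using fun k => hx k (Set.mem_univ k)
  obtain rfl : (fun k => (s k : S)) = x := funext hs
  exact mul_right_cancel₀ (Finset.prod_ne_zero_iff.2 fun k _ => pow_ne_zero _ (hl k)) (congrFun h s)

theorem pderiv_eval_natCast (j : Fin (q + 1)) (s : K → ℕ) (p : MvPolynomial K S) :
    pderiv j (eval (fun k => (s k : S)) p) =
      eval (fun k => (s k : S)) (coeffMap (pairDer q K (Sum.inl j)) p) := by
  induction p using MvPolynomial.induction_on' with
  | monomial β c =>
    rw [coeffMap_monomial, eval_monomial, eval_monomial, pderiv_mul,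
      show (β.prod fun k n => ((s k : S)) ^ n) = ((β.prod fun k n => (s k) ^ n : ℕ) : S) by
        rw [Nat.cast_finsuppProd]; simp only [Nat.cast_pow]]
    rw [show pderiv j ((β.prod fun k n => (s k) ^ n : ℕ) : S) = 0 from Derivation.map_natCast _ _,
      mul_zero, add_zero]
    rfl
  | add p p' hp hp' => rw [map_add, map_add, hp, hp', map_add, map_add]

theorem prod_mul_pderiv_prod_pow [Fintype K] [DecidableEq K] (c : K → Fin (q + 1) → ℂ) (s : K → ℕ)
    (j : Fin (q + 1)) :
    (∏ k, linForm (c k)) * pderiv j (∏ k, linForm (c k) ^ s k) =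
      (∑ k, (C (c k j) * ∏ k' ∈ Finset.univ.erase k, linForm (c k')) * (s k : S)) *
        ∏ k, linForm (c k) ^ s k := by
  rw [derivation_prod, Finset.mul_sum, Finset.sum_mul]
  refine Finset.sum_congr rfl fun k _ => ?_
  rw [← Finset.mul_prod_erase _ _ (Finset.mem_univ k),
    ← Finset.mul_prod_erase _ (fun k => linForm (c k) ^ s k) (Finset.mem_univ k), pderiv_pow,
    pderiv_linForm]
  rcases Nat.eq_zero_or_pos (s k) with h | h
  · simp [h]
  · conv_rhs => rw [← Nat.sub_add_cancel h, pow_succ]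
    rw [Nat.sub_add_cancel h]
    ring

end PolarizedReduction

section CentralFactor
open MvPolynomial

variable {q : ℕ} {K : Type*}

local notation "S" => MvPolynomial (Fin (q + 1)) ℂ

theorem snd_normalOrder_rename (s₀ a : K → ℂ) {d : ((Fin (q + 1) ⊕ K) →₀ ℕ) → PairEnd q K}
    (hd0 : d 0 = 1) (hd : ∀ β j, d (β + Finsupp.single j 1) = d β * pairOp s₀ a j)
    (hd' : ∀ β j, pairOp s₀ a j * d β = d β * pairOp s₀ a j) (p : MvPolynomial K S)
    (m : Polynomial S) :
    (normalOrder (pairCoeff q K) d (rename Sum.inr p)).2.unop m =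
      eval₂ Polynomial.C
        (fun k => Polynomial.C (C (s₀ k)) + Polynomial.C (C (a k)) * Polynomial.X) p * m := by
  induction p using MvPolynomial.induction_on generalizing m with
  | C f => rw [rename_C, normalOrder_C _ _ hd0, pairCoeff_snd, eval₂_C]
  | add p p' hp hp' => rw [map_add, map_add, PairEnd.add_snd, hp, hp', eval₂_add, add_mul]
  | mul_X p k hp =>
    rw [normalOrder_rename_mul_X (pairCoeff q K) d (pairOp s₀ a) (pairDer q K) Sum.inr hd hd'
      (pairOp_mul_pairCoeff s₀ a) pairDer_inr, PairEnd.mul_snd, hp, pairOp_inr_snd, eval₂_mul,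
      eval₂_X]
    ring

theorem sum_mul_pderiv_prod_pow [Fintype K] {c : K → Fin (q + 1) → ℂ} (hc : ∀ k, c k ≠ 0)
    {η : Fin (q + 1) → S} {Λ : K → S} (hη : ∀ k, ∑ j, C (c k j) * η j = linForm (c k) * Λ k)
    (s : K → ℕ) :
    ∑ j, η j * pderiv j (∏ k, linForm (c k) ^ s k) =
      ∑ k, Λ k * ((s k : ℂ) • ∏ k, linForm (c k) ^ s k) := by
  classical
  apply mul_left_cancel₀ (Finset.prod_ne_zero_iff.2 fun k (_ : k ∈ Finset.univ) =>
    linForm_ne_zero (hc k))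
  set G := ∏ k, linForm (c k) with hG
  set P := ∏ k, linForm (c k) ^ s k
  calc G * ∑ j, η j * pderiv j P = ∑ j, η j * (G * pderiv j P) := by
        rw [Finset.mul_sum]
        exact Finset.sum_congr rfl fun j _ => by ring
    _ = ∑ j, ∑ k, (C (c k j) * η j) * ((∏ k' ∈ Finset.univ.erase k, linForm (c k')) *
          (s k : S) * P) := by
        refine Finset.sum_congr rfl fun j _ => ?_
        rw [hG, prod_mul_pderiv_prod_pow, Finset.sum_mul, Finset.mul_sum]
        exact Finset.sum_congr rfl fun k _ => by ring
    _ = ∑ k, (linForm (c k) * Λ k) * ((∏ k' ∈ Finset.univ.erase k, linForm (c k')) *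
          (s k : S) * P) := by
        rw [Finset.sum_comm]
        refine Finset.sum_congr rfl fun k _ => ?_
        rw [← Finset.sum_mul, hη]
    _ = _ := by
        rw [Finset.mul_sum]
        refine Finset.sum_congr rfl fun k _ => ?_
        rw [hG, ← Finset.mul_prod_erase _ _ (Finset.mem_univ k), smul_eq_C_mul,
          show (C (s k : ℂ) : S) = (s k : S) from map_natCast C _]
        ring

theorem prod_mul_pderiv_powerFunction [Fintype K] [DecidableEq K] (c : K → Fin (q + 1) → ℂ)
    (j : Fin (q + 1)) (p : MvPolynomial K S) (s : K → ℕ) :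
    (∏ k, linForm (c k)) * pderiv j (powerFunction (fun k => linForm (c k)) p s) =
      powerFunction (fun k => linForm (c k)) (C (∏ k, linForm (c k)) *
        coeffMap (pairDer q K (Sum.inl j)) p +
        (∑ k, C (C (c k j) * ∏ k' ∈ Finset.univ.erase k, linForm (c k')) * X k) * p) s := by
  rw [powerFunction_apply, powerFunction_apply, pderiv_mul, pderiv_eval_natCast, mul_add, map_add,
    map_mul, map_mul, eval_C, add_mul, ← mul_assoc]
  congr 1
  rw [mul_left_comm, prod_mul_pderiv_prod_pow, map_sum]
  simp only [map_mul (eval _), eval_C, eval_X]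
  ring

theorem symbol_sub_mem_span [Fintype K] [DecidableEq K] {c : K → Fin (q + 1) → ℂ}
    {δ : Fin (q + 1) → Fin (q + 1) → MvPolynomial (Fin (q + 1)) ℂ}
    {lam : Fin (q + 1) → K → MvPolynomial (Fin (q + 1)) ℂ} (hc : ∀ k, c k ≠ 0)
    (hgen : logFields c ≤ Submodule.span (MvPolynomial (Fin (q + 1)) ℂ) (Set.range δ))
    (hlam : ∀ i k, ∑ j, C (c k j) * δ i j = linForm (c k) * lam i k)
    {τ : Fin (q + 1) → MvPolynomial (Fin (q + 1) ⊕ K) (MvPolynomial (Fin (q + 1)) ℂ)}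
    (hτ : ∀ i, τ i = ∑ j, C (δ i j) * X (Sum.inl j) - ∑ k, C (lam i k) * X (Sum.inr k))
    (j : Fin (q + 1)) :
    C (∏ k, linForm (c k)) * X (Sum.inl j) - rename Sum.inr
      (∑ k, C (C (c k j) * ∏ k' ∈ Finset.univ.erase k, linForm (c k')) * X k) ∈
      Ideal.span (Set.range τ) := by
  obtain ⟨b, hb1, hb2⟩ := exists_coeff_of_mem_logFields hc hgen hlam
    (prod_linForm_smul_single_quotient (c := c) j)
  rw [Ideal.mem_span_range_iff_exists_fun]
  refine ⟨fun i => C (b i), ?_⟩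
  have e1 : C (∏ k, linForm (c k)) * X (Sum.inl j) =
      ∑ j', C ((Pi.single j (∏ k, linForm (c k)) : Fin (q + 1) → S) j') *
        (X (Sum.inl j') : MvPolynomial (Fin (q + 1) ⊕ K) S) := by
    rw [Finset.sum_eq_single j (by simp +contextual) (by simp), Pi.single_eq_same]
  rw [e1, map_sum]
  simp only [map_mul (rename _), rename_C, rename_X, hb1, hb2, hτ, mul_sub, map_sum,
    Finset.sum_sub_distrib, Finset.mul_sum, Finset.sum_mul, C_mul, mul_assoc]
  rw [Finset.sum_comm]
  congr 1
  rw [Finset.sum_comm]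

/-- The pair of operators attached to a logarithmic derivation and its logarithmic quotients. -/
noncomputable def pairLog [Fintype K] (s₀ a : K → ℂ) (δ : Fin (q + 1) → S) (lam : K → S) :
    PairEnd q K :=
  ∑ x, pairCoeff q K (Sum.elim δ (-lam) x) * pairOp s₀ a x

theorem snd_sum_unop {I : Type*} (s : Finset I) (T : I → PairEnd q K) (f : Polynomial S) :
    (∑ i ∈ s, T i).2.unop f = ∑ i ∈ s, (T i).2.unop f := by
  classical
  induction s using Finset.induction_on with
  | empty => rfl
  | insert i s hi hs => rw [Finset.sum_insert hi, Finset.sum_insert hi, PairEnd.add_snd, hs]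

theorem pairLog_snd [Fintype K] (s₀ a : K → ℂ) (δ : Fin (q + 1) → S) (lam : K → S)
    (f : Polynomial S) : (pairLog s₀ a δ lam).2.unop f =
      dualLogOp δ (∑ k, C (s₀ k) * lam k) (∑ k, C (a k) * lam k) f := by
  rw [pairLog, snd_sum_unop, Fintype.sum_sum_type]
  simp only [PairEnd.mul_snd, pairOp_inl_snd, pairOp_inr_snd, pairCoeff_snd, Sum.elim_inl,
    Sum.elim_inr, dualLogOp, LinearMap.sub_apply, LinearMap.neg_apply, LinearMap.mulLeft_apply,
    LinearMap.sum_apply, LinearMap.comp_apply, Finset.sum_neg_distrib, Pi.neg_apply]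
  rw [sub_sub, sub_eq_add_neg]
  congr 1
  simp only [Polynomial.C_neg, map_sum, Polynomial.C_mul, Finset.mul_sum, Finset.sum_mul]
  rw [← Finset.sum_add_distrib, ← Finset.sum_neg_distrib]
  exact Finset.sum_congr rfl fun k _ => by ring

theorem pairLog_snd_commutator [Fintype K] {c : K → Fin (q + 1) → ℂ}
    {δ : Fin (q + 1) → Fin (q + 1) → MvPolynomial (Fin (q + 1)) ℂ}
    {lam : Fin (q + 1) → K → MvPolynomial (Fin (q + 1)) ℂ} (hc : ∀ k, c k ≠ 0)
    (hgen : logFields c ≤ Submodule.span (MvPolynomial (Fin (q + 1)) ℂ) (Set.range δ))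
    (hlam : ∀ i k, ∑ j, C (c k j) * δ i j = linForm (c k) * lam i k)
    (s₀ a : K → ℂ) (i k : Fin (q + 1)) :
    ∃ b : Fin (q + 1) → MvPolynomial (Fin (q + 1)) ℂ, ∀ f,
      (pairLog s₀ a (δ i) (lam i)).2.unop ((pairLog s₀ a (δ k) (lam k)).2.unop f) -
      (pairLog s₀ a (δ k) (lam k)).2.unop ((pairLog s₀ a (δ i) (lam i)).2.unop f) =
      ∑ m, (pairLog s₀ a (δ m) (lam m)).2.unop (Polynomial.C (b m) * f) := by
  obtain ⟨b, hb1, hb2⟩ := exists_bracket_coeff hc hgen hlam k i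
  refine ⟨b, fun f => ?_⟩
  have := commutator_sum_mul (pairCoeff q K) (pairOp s₀ a) (pairDer q K)
    (fun i => Sum.elim (δ i) (-lam i)) (pairOp_comm s₀ a) (pairOp_mul_pairCoeff s₀ a) k i (b := b)
    (by
      rintro (y | y)
      · rw [Fintype.sum_sum_type]
        simp only [Sum.elim_inl, pairDer_inl, pairDer_inr, AddMonoidHom.zero_apply, mul_zero,
          sub_zero, Finset.sum_const_zero, add_zero]
        exact hb1 y
      · rw [Fintype.sum_sum_type]
        simp only [Sum.elim_inl, Sum.elim_inr, pairDer_inl, pairDer_inr, AddMonoidHom.zero_apply,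
          mul_zero, Finset.sum_const_zero, add_zero, Pi.neg_apply, map_neg, mul_neg,
          Finset.sum_neg_distrib, sub_self]
        rw [← hb2 y, ← Finset.sum_neg_distrib]
        simp only [neg_sub_neg, neg_sub])
  have h2 := congrArg (fun x : PairEnd q K => x.2.unop f) (sub_eq_iff_eq_add.1 this)
  simp only [PairEnd.add_snd, PairEnd.mul_snd, snd_sum_unop, pairCoeff_snd] at h2
  rw [sub_eq_iff_eq_add]
  simpa only [pairLog, PairEnd.mul_snd, snd_sum_unop, pairCoeff_snd] using h2

theorem pairLog_snd_mul [Fintype K] {c : K → Fin (q + 1) → ℂ}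
    {δ : Fin (q + 1) → Fin (q + 1) → MvPolynomial (Fin (q + 1)) ℂ}
    {lam : Fin (q + 1) → K → MvPolynomial (Fin (q + 1)) ℂ}
    (hlam : ∀ i k, ∑ j, C (c k j) * δ i j = linForm (c k) * lam i k)
    (s₀ a : K → ℂ) (i : Fin (q + 1)) :
    ∃ μ, ∀ f, (pairLog s₀ a (δ i) (lam i)).2.unop (Polynomial.C (∏ k, linForm (c k)) * f) =
      Polynomial.C (∏ k, linForm (c k)) *
        ((pairLog s₀ a (δ i) (lam i)).2.unop f - Polynomial.C μ * f) := by
  refine ⟨∑ k, lam i k, fun f => ?_⟩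
  have := sum_mul_mul_map (pairCoeff q K) (pairOp s₀ a) (pairDer q K) (∏ k, linForm (c k))
    (Sum.elim (δ i) (-lam i)) (pairOp_mul_pairCoeff s₀ a)
  rw [Fintype.sum_sum_type (fun x => Sum.elim (δ i) (-lam i) x * _)] at this
  simp only [Sum.elim_inl, pairDer_inl, pairDer_inr, AddMonoidHom.zero_apply, mul_zero,
    Finset.sum_const_zero, add_zero] at this
  rw [sum_mul_pderiv_prod_linForm hlam] at this
  have h2 := congrArg (fun x : PairEnd q K => x.2.unop f) this
  simp only [PairEnd.add_snd, PairEnd.mul_snd, pairCoeff_snd] at h2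
  change _ = (pairLog s₀ a (δ i) (lam i)).2.unop _ + _ at h2
  change _ * (pairLog s₀ a (δ i) (lam i)).2.unop f = _ at h2
  rw [mul_sub, h2, Polynomial.C_mul]
  ring

end CentralFactor

section CentralFactor
open MvPolynomial

variable {q : ℕ} {K : Type*}

local notation "S" => MvPolynomial (Fin (q + 1)) ℂ

/-- Functions `(K → ℕ) → S` as a module over pairs of operators. -/
noncomputable abbrev functionModule (q : ℕ) (K : Type*) :
    Module (PairEnd q K) ((K → ℕ) → MvPolynomial (Fin (q + 1)) ℂ) :=
  Module.compHom _ (RingHom.fst (Module.End ℂ ((K → ℕ) → MvPolynomial (Fin (q + 1)) ℂ))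
    (Module.End ℂ (Polynomial (MvPolynomial (Fin (q + 1)) ℂ)))ᵐᵒᵖ)

attribute [local instance] functionModule

theorem PairEnd.smul_apply (x : PairEnd q K) (m : (K → ℕ) → S) (s : K → ℕ) :
    (x • m) s = x.1 m s := rfl

theorem pairCoeff_smul_powerFunction [Fintype K] (l : K → S) (f : S) (p : MvPolynomial K S) :
    pairCoeff q K f • powerFunction l p = powerFunction l (C f * p) := by
  funext s
  rw [PairEnd.smul_apply, pairCoeff_fst, powerFunction_apply, powerFunction_apply, map_mul,
    eval_C, mul_assoc]

theorem pairOp_inr_smul_powerFunction [Fintype K] (s₀ a : K → ℂ) (l : K → S) (k : K)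
    (p : MvPolynomial K S) :
    pairOp (q := q) s₀ a (Sum.inr k) • powerFunction l p = powerFunction l (X k * p) := by
  funext s
  rw [PairEnd.smul_apply, pairOp_inr_fst, powerFunction_apply, powerFunction_apply, map_mul,
    eval_X, smul_eq_C_mul, show (C (s k : ℂ) : S) = (s k : S) from map_natCast C _, mul_assoc]

theorem pairLog_smul_powerFunction_one [Fintype K] {c : K → Fin (q + 1) → ℂ} (hc : ∀ k, c k ≠ 0)
    (s₀ a : K → ℂ) {η : Fin (q + 1) → S} {Λ : K → S}
    (hη : ∀ k, ∑ j, C (c k j) * η j = linForm (c k) * Λ k) :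
    pairLog s₀ a η Λ • powerFunction (fun k => linForm (c k)) 1 = 0 := by
  rw [pairLog, Finset.sum_smul]
  funext s
  rw [Finset.sum_apply, Fintype.sum_sum_type, Pi.zero_apply]
  simp only [mul_smul]
  simp only [PairEnd.smul_apply, pairCoeff_fst, pairOp_inl_fst, pairOp_inr_fst, Sum.elim_inl,
    Sum.elim_inr, powerFunction_apply, map_one, one_mul, Pi.neg_apply, neg_mul,
    Finset.sum_neg_distrib]
  rw [sum_mul_pderiv_prod_pow hc hη, add_neg_cancel]

/-- The symbols, over the common denominator `∏ₖ lₖ`, by which the operators act on `l^s`. -/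
noncomputable def pairSymbol [Fintype K] [DecidableEq K] (c : K → Fin (q + 1) → ℂ) :
    Fin (q + 1) ⊕ K → MvPolynomial K S
  | Sum.inl j => ∑ k, C (C (c k j) * ∏ k' ∈ Finset.univ.erase k, linForm (c k')) * X k
  | Sum.inr k => C (∏ k, linForm (c k)) * X k

theorem pairSymbol_mem [Fintype K] [DecidableEq K] (c : K → Fin (q + 1) → ℂ) :
    ∀ x, pairSymbol c x ∈ degLT K S 2
  | Sum.inl _ => Submodule.sum_mem _ fun k _ => ((isHomogeneous_X _ k).C_mul _).mem_degLT
  | Sum.inr k => ((isHomogeneous_X _ k).C_mul _).mem_degLT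

theorem pairOp_smul_powerFunction [Fintype K] [DecidableEq K] (s₀ a : K → ℂ)
    (c : K → Fin (q + 1) → ℂ) (x : Fin (q + 1) ⊕ K) (p : MvPolynomial K S) :
    pairCoeff q K (∏ k, linForm (c k)) • pairOp s₀ a x •
        powerFunction (fun k => linForm (c k)) p =
      powerFunction (fun k => linForm (c k)) (C (∏ k, linForm (c k)) *
        coeffMap (pairDer q K x) p + pairSymbol c x * p) := by
  rcases x with j | k
  · exact funext fun s => prod_mul_pderiv_powerFunction c j p s
  · rw [pairDer_inr, coeffMap_zero, mul_zero, zero_add, pairOp_inr_smul_powerFunction,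
      pairCoeff_smul_powerFunction, pairSymbol, mul_assoc]

theorem pairSymbol_sub_mem_span [Fintype K] [DecidableEq K] {c : K → Fin (q + 1) → ℂ}
    {δ : Fin (q + 1) → Fin (q + 1) → MvPolynomial (Fin (q + 1)) ℂ}
    {lam : Fin (q + 1) → K → MvPolynomial (Fin (q + 1)) ℂ} (hc : ∀ k, c k ≠ 0)
    (hgen : logFields c ≤ Submodule.span (MvPolynomial (Fin (q + 1)) ℂ) (Set.range δ))
    (hlam : ∀ i k, ∑ j, C (c k j) * δ i j = linForm (c k) * lam i k) (x : Fin (q + 1) ⊕ K) :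
    C (∏ k, linForm (c k)) * X x - rename Sum.inr (pairSymbol c x) ∈
      Ideal.span (Set.range fun i =>
        ∑ j, C (δ i j) * X (Sum.inl j) - ∑ k, C (lam i k) * X (Sum.inr k)) := by
  rcases x with j | k
  · exact symbol_sub_mem_span hc hgen hlam (fun _ => rfl) j
  · rw [pairSymbol, map_mul, rename_C, rename_X, sub_self]
    exact zero_mem _

theorem exists_pairLog_decomposition [Fintype K] [Nonempty K] {c : K → Fin (q + 1) → ℂ}
    {δ : Fin (q + 1) → Fin (q + 1) → MvPolynomial (Fin (q + 1)) ℂ} {d : Fin (q + 1) → ℕ}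
    {lam : Fin (q + 1) → K → MvPolynomial (Fin (q + 1)) ℂ} (hc : ∀ k, c k ≠ 0)
    (hgen : logFields c ≤ Submodule.span (MvPolynomial (Fin (q + 1)) ℂ) (Set.range δ))
    (hlam : ∀ i k, ∑ j, C (c k j) * δ i j = linForm (c k) * lam i k)
    (hδh : ∀ i j, (δ i j).IsHomogeneous (d i + 1)) (hlamh : ∀ i k, (lam i k).IsHomogeneous (d i))
    (s₀ a : K → ℂ) {D : ((Fin (q + 1) ⊕ K) →₀ ℕ) → PairEnd q K}
    (hD0 : D 0 = 1) (hD1 : ∀ β j, D (β + Finsupp.single j 1) = D β * pairOp s₀ a j)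
    (hD2 : ∀ β j, pairOp s₀ a j * D β = D β * pairOp s₀ a j) (p : MvPolynomial K S)
    (h : ∀ N : AddSubgroup ((K → ℕ) → MvPolynomial (Fin (q + 1)) ℂ),
      powerFunction (fun k => linForm (c k)) (C (∏ k, linForm (c k))) ∈ N →
      (∀ f : MvPolynomial (Fin (q + 1)) ℂ, ∀ m ∈ N, (fun s => f * m s) ∈ N) →
      (∀ k, ∀ m ∈ N, (fun s => (s k : ℂ) • m s) ∈ N) →
      (∀ j, ∀ m ∈ N, (fun s => pderiv j (m s)) ∈ N) →
      powerFunction (fun k => linForm (c k)) p ∈ N) :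
    ∃ P : PairEnd q K, ∃ Q : Fin (q + 1) → PairEnd q K,
      normalOrder (pairCoeff q K) D (rename Sum.inr p) =
        P * pairCoeff q K (∏ k, linForm (c k)) + ∑ i, Q i * pairLog s₀ a (δ i) (lam i) := by
  classical
  have hNτ : ∀ i, normalOrder (pairCoeff q K) D
      (∑ j, C (δ i j) * X (Sum.inl j) - ∑ k, C (lam i k) * X (Sum.inr k)) =
      pairLog s₀ a (δ i) (lam i) := fun i =>
    normalOrder_sub_linear _ hD0 hD1 (δ i) (lam i)
  obtain ⟨P, Q, hPQ⟩ := exists_normalOrder_rename_eq (pairCoeff q K) D (pairOp s₀ a) (pairDer q K)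
    Sum.inr (powerFunction fun k => linForm (c k)) (∏ k, linForm (c k)) (pairSymbol c)
    (fun i => ∑ j, C (δ i j) * X (Sum.inl j) - ∑ k, C (lam i k) * X (Sum.inr k)) hD0 hD1
    hD2 (pairOp_mul_pairCoeff s₀ a) pairDer_mul pairDer_inr
    (pairCoeff_smul_powerFunction _) (pairOp_inr_smul_powerFunction s₀ a _) (pairSymbol_mem c)
    (pairOp_smul_powerFunction s₀ a c)
    (powerFunction_injective fun k => linForm_ne_zero (hc k))
    (fun i => (IsHomogeneous.sum _ _ _ fun j _ => (isHomogeneous_X _ _).C_mul _).sub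
      (IsHomogeneous.sum _ _ _ fun j _ => (isHomogeneous_X _ _).C_mul _))
    (pairSymbol_sub_mem_span hc hgen hlam)
    (mem_span_range_of_C_mul_mem hc hgen hlam hδh hlamh fun i => rfl)
    (fun i => by rw [hNτ, pairLog_smul_powerFunction_one hc s₀ a (hlam i)]) (a := p)
    (fun N hN1 hN2 hN3 => h N hN1 hN2 (fun k => hN3 (Sum.inr k)) fun j => hN3 (Sum.inl j))
  exact ⟨P, Q, hPQ.trans (by simp only [hNτ])⟩

set_option maxHeartbeats 1000000 in
/-- The functional equation for a central arrangement with homogeneous free generators forces the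
vanishing of `b` on the hyperplanes attached to the centre. -/
theorem eval_eq_zero_of_powerFunction_mem [Fintype K] {c : K → Fin (q + 1) → ℂ}
    (hc : ∀ k, c k ≠ 0) (hprop : ∀ k k', k ≠ k' → ∀ t : ℂ, c k ≠ t • c k')
    (hspan : ∀ y, (∀ k, c k ⬝ᵥ y = 0) → y = 0)
    (hirr : ∀ V₁ V₂ : Submodule ℂ (Fin (q + 1) → ℂ), IsCompl V₁ V₂ →
      (∀ k, (∀ y ∈ V₁, c k ⬝ᵥ y = 0) ∨ ∀ y ∈ V₂, c k ⬝ᵥ y = 0) →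
      (∃ k, ∀ y ∈ V₁, c k ⬝ᵥ y = 0) → ¬ ∃ k, ∀ y ∈ V₂, c k ⬝ᵥ y = 0)
    (T : Fin (q + 1) → Fin (q + 1) → MvPolynomial (Fin (q + 1)) ℂ)
    (hT : ∀ f ∈ logFields c, ∃ a : Fin (q + 1) → ℂ, f - ∑ i, a i • T i ∈ maxSmulLogFields c)
    {s₀ : K → ℂ} {j : ℕ} (hj : (∑ k, s₀ k) + ((q : ℂ) + 1 + j) = 0)
    (hjle : j ≤ 2 * (Fintype.card K - (q + 1)))
    {v : MvPolynomial (Fin (q + 1)) ℂ} (hv : coeff 0 v ≠ 0) (b : MvPolynomial K ℂ)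
    (h : ∀ N : AddSubgroup ((K → ℕ) → MvPolynomial (Fin (q + 1)) ℂ),
      powerFunction (fun k => linForm (c k)) (C (∏ k, linForm (c k))) ∈ N →
      (∀ f : MvPolynomial (Fin (q + 1)) ℂ, ∀ m ∈ N, (fun s => f * m s) ∈ N) →
      (∀ k, ∀ m ∈ N, (fun s => (s k : ℂ) • m s) ∈ N) →
      (∀ j, ∀ m ∈ N, (fun s => pderiv j (m s)) ∈ N) →
      powerFunction (fun k => linForm (c k)) (C v * map C b) ∈ N) :
    eval s₀ b = 0 := by
  classical
  obtain ⟨δ, d, hδ0, hd0, hd, hδh, hδ, hgen⟩ := exists_homogeneous_generators hc hspan hirr T hT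
  choose lam hlamh hlam using fun i => exists_isHomogeneous_quotient (hδ i) (hδh i)
  have hKne : Nonempty K := by
    by_contra hne
    rw [not_nonempty_iff] at hne
    have := congrFun (hspan (fun _ => 1) fun k => hne.elim k) 0
    simp at this
  obtain ⟨k₀⟩ := id hKne
  set a : K → ℂ := fun k => 1 - if k = k₀ then (Fintype.card K : ℂ) else 0 with ha_def
  have hsum : ∀ Z : Finset K, ∑ k ∈ Z, a k =
      (Z.card : ℂ) - if k₀ ∈ Z then (Fintype.card K : ℂ) else 0 := by
    intro Z
    simp only [ha_def, Finset.sum_sub_distrib, Finset.sum_const, nsmul_eq_mul, mul_one,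
      Finset.sum_ite_eq']
  have ha : ∑ k, a k = 0 := by rw [hsum]; simp
  have ha' : ∀ Z : Finset K, Z.Nonempty → ∑ k ∈ Z, a k = 0 → Z = Finset.univ := by
    intro Z hZ hZ0
    rw [hsum] at hZ0
    split_ifs at hZ0 with hk
    · rw [sub_eq_zero, Nat.cast_inj] at hZ0
      exact (Finset.card_eq_iff_eq_univ Z).1 hZ0
    · rw [sub_zero, Nat.cast_eq_zero, Finset.card_eq_zero] at hZ0
      exact absurd hZ0 hZ.ne_empty
  set G : S := ∏ k, linForm (c k) with hG
  have hG0 : G ≠ 0 := Finset.prod_ne_zero_iff.2 fun k _ => linForm_ne_zero (hc k)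
  obtain ⟨D, hD0, hD1, hD2⟩ := exists_commuting_monomials (pairOp (q := q) s₀ a) (pairOp_comm s₀ a)
  obtain ⟨P, Q, hPQ⟩ := exists_pairLog_decomposition hc hgen hlam hδh hlamh s₀ a hD0 hD1 hD2 _ h
  set β : Polynomial ℂ := aeval (fun k => Polynomial.C (s₀ k) + Polynomial.C (a k) * Polynomial.X) b
    with hβ
  have hβ0 : β = 0 := by
    refine coeff_zero_of_forall_exists_dualLogOp hc hprop hspan hδ0 hd0 hd hδh hgen hlam hlamh ha ha'
      hj hjle (E := fun i => dualLogOp (δ i) (∑ k, C (s₀ k) * lam i k) (∑ k, C (a k) * lam i k))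
      (fun i => rfl) (fun i k => ?_) (fun i => ?_) hv β fun g => ?_
    · simp only [← pairLog_snd]
      exact pairLog_snd_commutator hc hgen hlam s₀ a i k
    · simp only [← pairLog_snd]
      exact pairLog_snd_mul hlam s₀ a i
    · refine ⟨P.2.unop g, fun i => (Q i).2.unop g, ?_⟩
      have h2 := congrArg (fun x : PairEnd q K => x.2.unop g) hPQ
      simp only [PairEnd.add_snd, PairEnd.mul_snd, snd_sum_unop, pairCoeff_snd, pairLog_snd] at h2
      rw [snd_normalOrder_rename s₀ a hD0 hD1 hD2] at h2
      rw [← h2, eval₂_mul, eval₂_C, eval₂_map]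
      congr 2
      rw [hβ, ← Polynomial.coe_mapRingHom]
      change (Polynomial.mapRingHom _) (eval₂ _ _ b) = _
      rw [hom_eval₂]
      congr 1
      · ext x; simp
      · funext k; simp
  have hev : ∀ b : MvPolynomial K ℂ, (aeval (fun k => Polynomial.C (s₀ k) +
      Polynomial.C (a k) * Polynomial.X) b).eval 0 = eval s₀ b := by
    intro b
    induction b using MvPolynomial.induction_on with
    | C x => simp
    | add p p' hp hp' => rw [map_add, Polynomial.eval_add, hp, hp', map_add]
    | mul_X p k hp => rw [map_mul, Polynomial.eval_mul, hp, map_mul, aeval_X, eval_X]; simp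
  rw [← hev, ← hβ, hβ0, Polynomial.eval_zero]

end CentralFactor

section SliceTransfer
open MvPolynomial

variable {n q : ℕ} {ι : Type*} {J : Finset ι}

local notation "S" => MvPolynomial (Fin (q + 1)) ℂ

/-- The ring homomorphism pulling back polynomials along the forms `π j`. -/
noncomputable def pullback (J : Finset ι) (π : Fin (q + 1) → MvPolynomial (Fin n) ℂ) :
    MvPolynomial {k // k ∈ J} S →+* MvPolynomial (Fin n ⊕ ι) ℂ :=
  eval₂Hom ((rename Sum.inl).toRingHom.comp (aeval π).toRingHom) fun k => X (Sum.inr k.1)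

theorem pullback_C (π : Fin (q + 1) → MvPolynomial (Fin n) ℂ) (f : S) :
    pullback J π (C f) = rename Sum.inl (aeval π f) :=
  eval₂Hom_C _ _ _

theorem pullback_X (π : Fin (q + 1) → MvPolynomial (Fin n) ℂ) (k : {k // k ∈ J}) :
    pullback J π (X k) = X (Sum.inr k.1) :=
  eval₂Hom_X' _ _ _

open Classical in
/-- Specialisation of the parameters outside `J`. -/
noncomputable def specialize (J : Finset ι) (s₀ : ι → ℂ) :
    MvPolynomial ι ℂ →ₐ[ℂ] MvPolynomial {k // k ∈ J} ℂ :=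
  aeval fun k => if h : k ∈ J then X ⟨k, h⟩ else C (s₀ k)

open Classical in
/-- Restriction to a slice, together with specialisation of the parameters outside `J`. -/
noncomputable def restrictSlice (J : Finset ι) (ρ : MvPolynomial (Fin n) ℂ →ₐ[ℂ] S) (s₀ : ι → ℂ) :
    MvPolynomial (Fin n ⊕ ι) ℂ →ₐ[ℂ] MvPolynomial {k // k ∈ J} S :=
  aeval (Sum.elim (fun x => C (ρ (X x)))
    fun k => if h : k ∈ J then X ⟨k, h⟩ else C (C (s₀ k)))

theorem restrictSlice_rename_inl (ρ : MvPolynomial (Fin n) ℂ →ₐ[ℂ] S) (s₀ : ι → ℂ)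
    (f : MvPolynomial (Fin n) ℂ) : restrictSlice J ρ s₀ (rename Sum.inl f) = C (ρ f) := by
  have : (restrictSlice J ρ s₀).comp (rename Sum.inl) =
      (IsScalarTower.toAlgHom ℂ S (MvPolynomial {k // k ∈ J} S)).comp ρ := by
    refine algHom_ext fun x => ?_
    simp [restrictSlice, algebraMap_eq]
  exact DFunLike.congr_fun this f

theorem restrictSlice_rename_inr (ρ : MvPolynomial (Fin n) ℂ →ₐ[ℂ] S) (s₀ : ι → ℂ)
    (b : MvPolynomial ι ℂ) :
    restrictSlice J ρ s₀ (rename Sum.inr b) = map C (specialize J s₀ b) := by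
  have : ((restrictSlice J ρ s₀).toRingHom.comp (rename Sum.inr).toRingHom) =
      (map C).comp (specialize J s₀).toRingHom := by
    refine ringHom_ext (fun a => ?_) fun k => ?_
    · change restrictSlice J ρ s₀ (rename Sum.inr (C a)) = map C (specialize J s₀ (C a))
      rw [rename_C, restrictSlice, specialize, aeval_C, aeval_C, algebraMap_eq, map_C]
      rfl
    · change restrictSlice J ρ s₀ (rename Sum.inr (X k)) = map C (specialize J s₀ (X k))
      rw [rename_X, restrictSlice, specialize, aeval_X, aeval_X, Sum.elim_inr]
      split_ifs
      · rw [map_X]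
      · rw [map_C]
  exact DFunLike.congr_fun this b

theorem coeffMap_C {σ A : Type*} [CommRing A] (δ : A →+ A) (a : A) :
    coeffMap δ (C a : MvPolynomial σ A) = C (δ a) :=
  coeffMap_monomial δ 0 a

theorem coeffMap_mul_X {σ A : Type*} [CommRing A] (δ : A →+ A) (p : MvPolynomial σ A) (k : σ) :
    coeffMap δ (p * X k) = coeffMap δ p * X k := by
  classical
  ext β
  rw [coeff_coeffMap, coeff_mul_X', coeff_mul_X', apply_ite δ, map_zero, coeff_coeffMap]

theorem restrictSlice_pullback {π : Fin (q + 1) → MvPolynomial (Fin n) ℂ}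
    {ρ : MvPolynomial (Fin n) ℂ →ₐ[ℂ] S} (hρ : ∀ j, ρ (π j) = X j) (s₀ : ι → ℂ)
    (p : MvPolynomial {k // k ∈ J} S) : restrictSlice J ρ s₀ (pullback J π p) = p := by
  induction p using MvPolynomial.induction_on with
  | C f =>
    rw [pullback_C, restrictSlice_rename_inl]
    have : ρ.comp (aeval π) = AlgHom.id ℂ S := algHom_ext fun j => by simp [hρ]
    rw [show ρ (aeval π f) = f from DFunLike.congr_fun this f]
  | add p p' hp hp' => simp only [map_add, hp, hp']
  | mul_X p k hp =>
    rw [map_mul, map_mul, hp, pullback_X, restrictSlice, aeval_X, Sum.elim_inr, dif_pos k.2]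

theorem pderiv_rename_inl (i : Fin n) (f : MvPolynomial (Fin n) ℂ) :
    pderiv (Sum.inl i) (rename (Sum.inl : Fin n → Fin n ⊕ ι) f) = rename Sum.inl (pderiv i f) :=
  pderiv_rename Sum.inl_injective i f

theorem pderiv_aeval (π : Fin (q + 1) → MvPolynomial (Fin n) ℂ) (i : Fin n) (f : S) :
    pderiv i (aeval π f) = ∑ j, pderiv i (π j) * aeval π (pderiv j f) := by
  classical
  induction f using MvPolynomial.induction_on with
  | C a => simp
  | add p p' hp hp' => simp only [map_add, hp, hp', mul_add, Finset.sum_add_distrib]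
  | mul_X p k hp =>
    rw [map_mul, aeval_X, pderiv_mul, hp]
    simp only [pderiv_mul, map_add, map_mul, aeval_X, pderiv_X, mul_add, Finset.sum_add_distrib]
    congr 1
    · rw [Finset.sum_mul]
      exact Finset.sum_congr rfl fun j _ => by ring
    · rw [Finset.sum_eq_single k (by
        intro j _ hj
        rw [Pi.single_eq_of_ne hj.symm, map_zero, mul_zero, mul_zero]) (by simp)]
      rw [Pi.single_eq_same, map_one]
      ring

theorem pderiv_pullback (π : Fin (q + 1) → MvPolynomial (Fin n) ℂ) (i : Fin n)
    (p : MvPolynomial {k // k ∈ J} S) :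
    pderiv (Sum.inl i) (pullback J π p) = ∑ j, rename Sum.inl (pderiv i (π j)) *
      pullback J π (coeffMap (pairDer q {k // k ∈ J} (Sum.inl j)) p) := by
  induction p using MvPolynomial.induction_on with
  | C f =>
    rw [pullback_C, pderiv_rename_inl, pderiv_aeval, map_sum]
    refine Finset.sum_congr rfl fun j _ => ?_
    rw [coeffMap_C, pullback_C, map_mul, pairDer_inl]
  | add p p' hp hp' => simp only [map_add, hp, hp', mul_add, Finset.sum_add_distrib]
  | mul_X p k hp =>
    rw [map_mul, pullback_X, pderiv_mul, hp, pderiv_X_of_ne (by simp), mul_zero, add_zero,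
      Finset.sum_mul]
    refine Finset.sum_congr rfl fun j _ => ?_
    rw [coeffMap_mul_X, map_mul, pullback_X, mul_assoc]

end SliceTransfer

section SliceTransferLocal
open MvPolynomial

variable {n q : ℕ} {ι : Type*} {J : Finset ι}

local notation "S" => MvPolynomial (Fin (q + 1)) ℂ

theorem prod_univ_erase_coe [DecidableEq ι] {A : Type*} [CommMonoid A] (f : ι → A) (k : {k // k ∈ J}) :
    ∏ k' ∈ Finset.univ.erase k, f k'.1 = ∏ k' ∈ J.erase k.1, f k' := by
  have : J.erase k.1 = (Finset.univ.erase k).map (Function.Embedding.subtype (· ∈ J)) := by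
    ext x
    simp only [Finset.mem_erase, Finset.mem_map, Finset.mem_univ, and_true,
      Function.Embedding.subtype_apply]
    constructor
    · rintro ⟨h1, h2⟩
      exact ⟨⟨x, h2⟩, fun h => h1 (congrArg Subtype.val h), rfl⟩
    · rintro ⟨y, h1, rfl⟩
      exact ⟨fun h => h1 (Subtype.ext h), y.2⟩
  rw [this, Finset.prod_map]
  rfl

theorem pullback_prod_linForm {π : Fin (q + 1) → MvPolynomial (Fin n) ℂ}
    {l : ι → MvPolynomial (Fin n) ℂ} {c : {k // k ∈ J} → Fin (q + 1) → ℂ}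
    (hl : ∀ k : {k // k ∈ J}, aeval π (linForm (c k)) = l k.1) :
    pullback J π (C (∏ k, linForm (c k))) = rename Sum.inl (∏ k ∈ J, l k) := by
  rw [pullback_C, map_prod]
  simp only [hl]
  rw [Finset.prod_coe_sort J l]

theorem pderiv_aeval_linForm (π : Fin (q + 1) → MvPolynomial (Fin n) ℂ) (i : Fin n)
    (c : Fin (q + 1) → ℂ) :
    pderiv i (aeval π (linForm c)) = ∑ j, C (c j) * pderiv i (π j) := by
  rw [pderiv_aeval]
  simp only [pderiv_linForm]
  exact Finset.sum_congr rfl fun j _ => by rw [aeval_C, algebraMap_eq, mul_comm]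

theorem pullback_pairSymbol [DecidableEq ι] {π : Fin (q + 1) → MvPolynomial (Fin n) ℂ}
    {l : ι → MvPolynomial (Fin n) ℂ} {c : {k // k ∈ J} → Fin (q + 1) → ℂ}
    (hl : ∀ k : {k // k ∈ J}, aeval π (linForm (c k)) = l k.1) (i : Fin n) :
    ∑ j, rename Sum.inl (pderiv i (π j)) * pullback J π (pairSymbol c (Sum.inl j)) =
      ∑ k ∈ J, X (Sum.inr k) * rename Sum.inl (pderiv i (l k) * ∏ k' ∈ J.erase k, l k') := by
  rw [← Finset.sum_coe_sort J]
  simp only [pairSymbol, map_sum, map_mul (pullback J π), pullback_C, pullback_X, Finset.mul_sum]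
  rw [Finset.sum_comm]
  refine Finset.sum_congr rfl fun k _ => ?_
  rw [← prod_univ_erase_coe, ← hl, pderiv_aeval_linForm]
  simp only [map_mul, map_prod, hl, Finset.sum_mul, Finset.mul_sum, map_sum, aeval_C, algebraMap_eq]
  exact Finset.sum_congr rfl fun j _ => by ring

theorem sum_twist_eq [Fintype ι] [DecidableEq ι] {π : Fin (q + 1) → MvPolynomial (Fin n) ℂ}
    {l : ι → MvPolynomial (Fin n) ℂ} {c : {k // k ∈ J} → Fin (q + 1) → ℂ}
    (hl : ∀ k : {k // k ∈ J}, aeval π (linForm (c k)) = l k.1) (i : Fin n) :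
    (∑ k, X (Sum.inr k) * rename Sum.inl (pderiv i (l k) * ∏ k' ∈ Finset.univ.erase k, l k') :
      MvPolynomial (Fin n ⊕ ι) ℂ) =
      rename Sum.inl (∏ k ∈ Jᶜ, l k) * (∑ j, rename Sum.inl (pderiv i (π j)) *
        pullback J π (pairSymbol c (Sum.inl j))) +
      pullback J π (C (∏ k, linForm (c k))) *
        ∑ k ∈ Jᶜ, X (Sum.inr k) * rename Sum.inl (pderiv i (l k) * ∏ k' ∈ Jᶜ.erase k, l k') := by
  rw [pullback_pairSymbol hl, pullback_prod_linForm hl, ← Finset.sum_add_sum_compl J,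
    Finset.mul_sum, Finset.mul_sum]
  have split : ∀ k, Finset.univ.erase k = J.erase k ∪ Jᶜ.erase k := fun k => by
    rw [← Finset.erase_union_distrib, Finset.union_compl]
  have hd : ∀ k, Disjoint (J.erase k) (Jᶜ.erase k) := fun k =>
    disjoint_compl_right.mono (Finset.erase_subset _ _) (Finset.erase_subset _ _)
  congr 1
  · refine Finset.sum_congr rfl fun k hk => ?_
    rw [split, Finset.prod_union (hd k), Finset.erase_eq_of_notMem (s := Jᶜ) (by simpa using hk)]
    simp only [map_mul]
    ring
  · refine Finset.sum_congr rfl fun k hk => ?_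
    rw [split, Finset.prod_union (hd k),
      Finset.erase_eq_of_notMem (s := J) (by simpa using hk)]
    simp only [map_mul]
    ring

/-- Action of a twisted derivation on a quotient of a pulled back polynomial. -/
theorem twisted_apply_eq [Fintype ι] [DecidableEq ι] {π : Fin (q + 1) → MvPolynomial (Fin n) ℂ}
    {l : ι → MvPolynomial (Fin n) ℂ} {c : {k // k ∈ J} → Fin (q + 1) → ℂ}
    (hl : ∀ k : {k // k ∈ J}, aeval π (linForm (c k)) = l k.1)
    {M : Type*} [CommRing M] (α : MvPolynomial (Fin n ⊕ ι) ℂ →+* M) (i : Fin n) (D : M → M)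
    (hD1 : ∀ r m, D (α r * m) = α (pderiv (Sum.inl i) r) * m + α r * D m)
    (hD2 : α (rename Sum.inl (∏ k, l k)) * D 1 =
      α (∑ k, X (Sum.inr k) * rename Sum.inl (pderiv i (l k) * ∏ k' ∈ Finset.univ.erase k, l k')))
    (hF : IsUnit (α (pullback J π (C (∏ k, linForm (c k))))))
    {x : M} {L : ℕ} {g : MvPolynomial {k // k ∈ J} S}
    (hx : α (pullback J π (C (∏ k, linForm (c k)))) ^ L * x = α (pullback J π g))
    {y : Fin (q + 1) → M} (hy : ∀ j, α (pullback J π (C (∏ k, linForm (c k)))) ^ (L + 1) * y j =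
      α (pullback J π (C (∏ k, linForm (c k)) * coeffMap (pairDer q {k // k ∈ J} (Sum.inl j)) g -
        (L : MvPolynomial {k // k ∈ J} S) * C (pderiv j (∏ k, linForm (c k))) * g +
        pairSymbol c (Sum.inl j) * g))) :
    α (rename Sum.inl (∏ k ∈ Jᶜ, l k)) * D x =
      ∑ j, α (rename Sum.inl (∏ k ∈ Jᶜ, l k) * rename Sum.inl (pderiv i (π j))) * y j +
      α (∑ k ∈ Jᶜ, X (Sum.inr k) * rename Sum.inl (pderiv i (l k) * ∏ k' ∈ Jᶜ.erase k, l k')) *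
        x := by
  apply (hF.pow (L + 1)).mul_left_cancel
  set u : MvPolynomial (Fin n ⊕ ι) ℂ := rename Sum.inl (∏ k ∈ Jᶜ, l k) with hu
  rw [sum_twist_eq hl i] at hD2
  set V : MvPolynomial (Fin n ⊕ ι) ℂ := ∑ k ∈ Jᶜ, X (Sum.inr k) *
    rename Sum.inl (pderiv i (l k) * ∏ k' ∈ Jᶜ.erase k, l k') with hV
  have hFu : (rename Sum.inl (∏ k, l k) : MvPolynomial (Fin n ⊕ ι) ℂ) =
      u * pullback J π (C (∏ k, linForm (c k))) := by
    rw [hu, pullback_prod_linForm hl, ← map_mul, mul_comm, Finset.prod_mul_prod_compl]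
  rw [hFu] at hD2
  have e1 := hD1 (pullback J π g) 1
  have e2 := hD1 (pullback J π (C (∏ k, linForm (c k))) ^ L) x
  have e3 := pderiv_pullback π i (C (∏ k, linForm (c k)) : MvPolynomial {k // k ∈ J} S)
  rw [pderiv_pullback] at e1
  rw [pderiv_pow, e3, map_pow, hx] at e2
  rw [mul_one, e2, mul_one] at e1
  have e4 := congrArg (α (pullback J π (C (∏ k, linForm (c k)))) * α u * ·) e1
  set f := pullback J π (C (∏ k, linForm (c k))) with hf
  have e5 : ∀ j, α (u * rename Sum.inl (pderiv i (π j))) * (α f ^ (L + 1) * y j) = _ :=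
    fun j => congrArg _ (hy j)
  rw [mul_add, Finset.mul_sum]
  simp only [mul_left_comm (α f ^ (L + 1)) _ (y _), e5]
  have e6 : α f * (α f ^ (L - 1) * L * x) = L * α (pullback J π g) := by
    rw [← hx]
    rcases L with _ | L
    · simp
    · rw [Nat.add_sub_cancel, pow_succ]
      ring
  have e7 : ∑ j, α (u * rename Sum.inl (pderiv i (π j))) * α (pullback J π
      (C (∏ k, linForm (c k)) * coeffMap (pairDer q {k // k ∈ J} (Sum.inl j)) g -
        (L : MvPolynomial {k // k ∈ J} S) * C (pderiv j (∏ k, linForm (c k))) * g +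
        pairSymbol c (Sum.inl j) * g)) =
      α u * (α f * (∑ j, α (rename Sum.inl (pderiv i (π j))) *
          α (pullback J π (coeffMap (pairDer q {k // k ∈ J} (Sum.inl j)) g))) -
        L * (∑ j, α (rename Sum.inl (pderiv i (π j))) *
          α (pullback J π (C (pderiv j (∏ k, linForm (c k)))))) * α (pullback J π g) +
        (∑ j, α (rename Sum.inl (pderiv i (π j))) *
          α (pullback J π (pairSymbol c (Sum.inl j)))) * α (pullback J π g)) := by
    simp only [map_mul, map_add, map_sub, map_natCast, ← hf, Finset.mul_sum, Finset.sum_mul,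
      ← Finset.sum_add_distrib, ← Finset.sum_sub_distrib]
    exact Finset.sum_congr rfl fun j _ => by ring
  rw [e7]
  simp only [coeffMap_C, pairDer_inl, map_add, map_mul, map_sum, map_pow, map_natCast] at e4 hD2
  linear_combination e4 - α u * (∑ j, α (rename Sum.inl (pderiv i (π j))) *
          α (pullback J π (C (pderiv j (∏ k, linForm (c k)))))) * e6 +
    α (pullback J π g) * hD2 - α V * α f * hx

end SliceTransferLocal

section SliceTransferConclusion
open MvPolynomial

variable {n q : ℕ} {ι : Type*} {J : Finset ι}

local notation "S" => MvPolynomial (Fin (q + 1)) ℂ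

theorem eval_mul_mem_of_closed {K : Type*} {N : AddSubgroup ((K → ℕ) → S)}
    (hN2 : ∀ f : S, ∀ m ∈ N, (fun s => f * m s) ∈ N)
    (hN3 : ∀ k, ∀ m ∈ N, (fun s => (s k : ℂ) • m s) ∈ N) (p : MvPolynomial K S) :
    ∀ m ∈ N, (fun s => eval (fun k => (s k : S)) p * m s) ∈ N := by
  induction p using MvPolynomial.induction_on with
  | C f => exact fun m hm => by simpa only [eval_C] using hN2 f m hm
  | add p p' hp hp' =>
    intro m hm
    convert N.add_mem (hp m hm) (hp' m hm) using 1
    funext s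
    rw [Pi.add_apply, map_add, add_mul]
  | mul_X p k hp =>
    intro m hm
    have := hp _ (hN3 k m hm)
    simpa only [map_mul, eval_X, mul_assoc, smul_eq_C_mul,
      show ∀ s : K → ℕ, (C (s k : ℂ) : S) = (s k : S) from fun s => map_natCast C _] using this

theorem pow_mul_pderiv_eq {A : Type*} [CommRing A] (G G' m m' p p' : A) {L : ℕ}
    (hm : G ^ L * m = p) (hp : p' = L * G ^ (L - 1) * G' * m + G ^ L * m') :
    G ^ (L + 1) * m' = G * p' - L * G' * p := by
  rw [hp, ← hm]
  rcases L with _ | L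
  · simp
  · rw [Nat.add_sub_cancel, pow_succ]
    ring

/-- Elements of `M` represented by pulled back quotients whose power function lies in `N`. -/
def sliceRel {M : Type*} [CommRing M] [Algebra (MvPolynomial (Fin n ⊕ ι) ℂ) M]
    (π : Fin (q + 1) → MvPolynomial (Fin n) ℂ) (c : {k // k ∈ J} → Fin (q + 1) → ℂ)
    (N : AddSubgroup (({k // k ∈ J} → ℕ) → S)) : Set M :=
  {x | ∃ L : ℕ, ∃ g : MvPolynomial {k // k ∈ J} S,
    algebraMap _ M (pullback J π (C (∏ k, linForm (c k)))) ^ L * x =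
      algebraMap _ M (pullback J π g) ∧
    ∃ m ∈ N, ∀ s, (∏ k, linForm (c k)) ^ L * m s = powerFunction (fun k => linForm (c k)) g s}

variable {M : Type*} [CommRing M] [Algebra (MvPolynomial (Fin n ⊕ ι) ℂ) M]
  {π : Fin (q + 1) → MvPolynomial (Fin n) ℂ} {c : {k // k ∈ J} → Fin (q + 1) → ℂ}
  {N : AddSubgroup (({k // k ∈ J} → ℕ) → MvPolynomial (Fin (q + 1)) ℂ)}

theorem powerFunction_sub_natCast_mul {K : Type*} [Fintype K] (l : K → S)
    (p r g : MvPolynomial K S) (f : S) (L : ℕ) (s : K → ℕ) :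
    powerFunction l (p + r) s - L * f * powerFunction l g s =
      powerFunction l (p - (L : MvPolynomial K S) * C f * g + r) s := by
  simp only [powerFunction_apply, map_add, map_sub, map_mul, eval_C, map_natCast]
  ring

theorem exists_sliceRel_pderiv
    (hF : IsUnit (algebraMap _ M (pullback J π (C (∏ k, linForm (c k))))))
    (hN4 : ∀ j, ∀ m ∈ N, (fun s => pderiv j (m s)) ∈ N)
    {L : ℕ} {g : MvPolynomial {k // k ∈ J} S} {m : ({k // k ∈ J} → ℕ) → S} (hm : m ∈ N)
    (hmg : ∀ s, (∏ k, linForm (c k)) ^ L * m s = powerFunction (fun k => linForm (c k)) g s)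
    [DecidableEq {k // k ∈ J}] (j : Fin (q + 1)) :
    ∃ y ∈ sliceRel (M := M) π c N,
      algebraMap _ M (pullback J π (C (∏ k, linForm (c k)))) ^ (L + 1) * y =
      algebraMap _ M (pullback J π (C (∏ k, linForm (c k)) *
        coeffMap (pairDer q {k // k ∈ J} (Sum.inl j)) g -
        (L : MvPolynomial {k // k ∈ J} S) * C (pderiv j (∏ k, linForm (c k))) * g +
        pairSymbol c (Sum.inl j) * g)) := by
  obtain ⟨v, hv⟩ := (hF.pow (L + 1)).exists_right_inv
  set Y := algebraMap _ M (pullback J π (C (∏ k, linForm (c k)) *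
        coeffMap (pairDer q {k // k ∈ J} (Sum.inl j)) g -
        (L : MvPolynomial {k // k ∈ J} S) * C (pderiv j (∏ k, linForm (c k))) * g +
        pairSymbol c (Sum.inl j) * g)) with hY
  have key : algebraMap _ M (pullback J π (C (∏ k, linForm (c k)))) ^ (L + 1) * (v * Y) = Y := by
    rw [← mul_assoc, hv, one_mul]
  refine ⟨v * Y, ⟨L + 1, _, key, _, hN4 j m hm, fun s => ?_⟩, key⟩
  have h1 := prod_mul_pderiv_powerFunction c j g s
  have h2 : pderiv j (powerFunction (fun k => linForm (c k)) g s) =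
      L * (∏ k, linForm (c k)) ^ (L - 1) * pderiv j (∏ k, linForm (c k)) * m s +
        (∏ k, linForm (c k)) ^ L * pderiv j (m s) := by
    rw [← hmg, pderiv_mul, pderiv_pow]
  rw [pow_mul_pderiv_eq _ _ _ _ _ _ (hmg s) h2, h1]
  exact powerFunction_sub_natCast_mul _ _ _ _ _ _ _

theorem twisted_sliceRel_mem [Fintype ι] [DecidableEq ι] {l : ι → MvPolynomial (Fin n) ℂ}
    (hl : ∀ k : {k // k ∈ J}, aeval π (linForm (c k)) = l k.1)
    (hF : IsUnit (algebraMap _ M (pullback J π (C (∏ k, linForm (c k))))))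
    (hN4 : ∀ j, ∀ m ∈ N, (fun s => pderiv j (m s)) ∈ N) (i : Fin n) (D : M →+ M)
    (hD1 : ∀ r m, D (algebraMap (MvPolynomial (Fin n ⊕ ι) ℂ) M r * m) =
      algebraMap _ M (pderiv (Sum.inl i) r) * m + algebraMap _ M r * D m)
    (hD2 : algebraMap (MvPolynomial (Fin n ⊕ ι) ℂ) M (rename Sum.inl (∏ k, l k)) * D 1 =
      algebraMap _ M (∑ k, X (Sum.inr k) *
        rename Sum.inl (pderiv i (l k) * ∏ k' ∈ Finset.univ.erase k, l k')))
    {x : M} (hx : x ∈ Submodule.span (MvPolynomial (Fin n ⊕ ι) ℂ) (sliceRel (M := M) π c N)) :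
    algebraMap (MvPolynomial (Fin n ⊕ ι) ℂ) M (rename Sum.inl (∏ k ∈ Jᶜ, l k)) * D x ∈
      Submodule.span (MvPolynomial (Fin n ⊕ ι) ℂ) (sliceRel (M := M) π c N) := by
  induction hx using Submodule.span_induction with
  | mem x hx =>
    obtain ⟨L, g, hxg, m, hm, hmg⟩ := id hx
    choose y hy hy' using exists_sliceRel_pderiv hF hN4 hm hmg
    rw [twisted_apply_eq hl (algebraMap _ M) i D hD1 hD2 hF hxg hy']
    simp only [← Algebra.smul_def]
    exact add_mem (Submodule.sum_mem _ fun j _ =>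
      Submodule.smul_mem _ _ (Submodule.subset_span (hy j)))
      (Submodule.smul_mem _ _ (Submodule.subset_span hx))
  | zero => rw [map_zero, mul_zero]; exact zero_mem _
  | add x y _ _ hx hy => rw [map_add, mul_add]; exact add_mem hx hy
  | smul r x hx hx' =>
    rw [Algebra.smul_def, hD1, mul_add, ← mul_assoc, mul_left_comm, ← map_mul]
    simp only [← Algebra.smul_def] at hx' ⊢
    exact add_mem (Submodule.smul_mem _ _ hx) (Submodule.smul_mem _ _ hx')

theorem exists_powerFunction_of_mem_span {ρ : MvPolynomial (Fin n) ℂ →ₐ[ℂ] S}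
    (hρ : ∀ j, ρ (π j) = X j) (s₀ : ι → ℂ)
    (hN2 : ∀ f : S, ∀ m ∈ N, (fun s => f * m s) ∈ N)
    (hN3 : ∀ k, ∀ m ∈ N, (fun s => (s k : ℂ) • m s) ∈ N) {x : M}
    (hx : x ∈ Submodule.span (MvPolynomial (Fin n ⊕ ι) ℂ) (sliceRel (M := M) π c N)) :
    ∃ L : ℕ, ∃ h : MvPolynomial (Fin n ⊕ ι) ℂ,
      algebraMap _ M (pullback J π (C (∏ k, linForm (c k)))) ^ L * x = algebraMap _ M h ∧
      ∃ m ∈ N, ∀ s, (∏ k, linForm (c k)) ^ L * m s =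
        powerFunction (fun k => linForm (c k)) (restrictSlice J ρ s₀ h) s := by
  induction hx using Submodule.span_induction with
  | mem x hx =>
    obtain ⟨L, g, hxg, m, hm, hmg⟩ := hx
    exact ⟨L, _, hxg, m, hm, fun s => by rw [hmg, restrictSlice_pullback hρ]⟩
  | zero => exact ⟨0, 0, by simp, 0, zero_mem _, fun s => by simp⟩
  | add x y _ _ hx hy =>
    obtain ⟨L, h, hxh, m, hm, hmh⟩ := hx
    obtain ⟨L', h', hxh', m', hm', hmh'⟩ := hy
    refine ⟨L + L', pullback J π (C (∏ k, linForm (c k))) ^ L' * h +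
      pullback J π (C (∏ k, linForm (c k))) ^ L * h', ?_, m + m', add_mem hm hm', fun s => ?_⟩
    · rw [map_add, map_mul, map_mul, ← hxh, ← hxh', map_pow, map_pow]
      ring
    · rw [map_add, map_mul, map_mul, map_pow, map_pow, restrictSlice_pullback hρ, map_add,
        Pi.add_apply, Pi.add_apply]
      have e := hmh s
      have e' := hmh' s
      rw [powerFunction_apply] at e e' ⊢
      rw [powerFunction_apply, map_mul, map_mul, map_pow, map_pow, eval_C]
      linear_combination (∏ k, linForm (c k)) ^ L' * e + (∏ k, linForm (c k)) ^ L * e'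
  | smul r x _ hx =>
    obtain ⟨L, h, hxh, m, hm, hmh⟩ := hx
    refine ⟨L, r * h, ?_, _, eval_mul_mem_of_closed hN2 hN3 (restrictSlice J ρ s₀ r) m hm,
      fun s => ?_⟩
    · rw [Algebra.smul_def, mul_left_comm, hxh, map_mul]
    · have e := hmh s
      rw [powerFunction_apply] at e ⊢
      rw [map_mul, map_mul]
      linear_combination eval (fun k => (s k : S)) (restrictSlice J ρ s₀ r) * e

theorem exists_powerFunction_mem [Fintype ι] [DecidableEq ι] {l : ι → MvPolynomial (Fin n) ℂ}
    (hl : ∀ k : {k // k ∈ J}, aeval π (linForm (c k)) = l k.1) (hc : ∀ k, c k ≠ 0)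
    {ρ : MvPolynomial (Fin n) ℂ →ₐ[ℂ] S} (hρ : ∀ j, ρ (π j) = X j) (s₀ : ι → ℂ)
    (hinj : Function.Injective (algebraMap (MvPolynomial (Fin n ⊕ ι) ℂ) M))
    (hF : IsUnit (algebraMap (MvPolynomial (Fin n ⊕ ι) ℂ) M (rename Sum.inl (∏ k, l k))))
    (D : Fin n → M →+ M)
    (hD1 : ∀ i r m, D i (algebraMap (MvPolynomial (Fin n ⊕ ι) ℂ) M r * m) =
      algebraMap _ M (pderiv (Sum.inl i) r) * m + algebraMap _ M r * D i m)
    (hD2 : ∀ i, algebraMap (MvPolynomial (Fin n ⊕ ι) ℂ) M (rename Sum.inl (∏ k, l k)) * D i 1 =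
      algebraMap _ M (∑ k, X (Sum.inr k) *
        rename Sum.inl (pderiv i (l k) * ∏ k' ∈ Finset.univ.erase k, l k')))
    (b : MvPolynomial ι ℂ)
    (hb : ∀ W : Submodule (MvPolynomial (Fin n ⊕ ι) ℂ) M,
      algebraMap (MvPolynomial (Fin n ⊕ ι) ℂ) M (rename Sum.inl (∏ k, l k)) ∈ W → (∀ i, ∀ m ∈ W, D i m ∈ W) →
      algebraMap (MvPolynomial (Fin n ⊕ ι) ℂ) M (rename Sum.inr b) ∈ W)
    (hN1 : powerFunction (fun k => linForm (c k)) (C (∏ k, linForm (c k))) ∈ N)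
    (hN2 : ∀ f : S, ∀ m ∈ N, (fun s => f * m s) ∈ N)
    (hN3 : ∀ k, ∀ m ∈ N, (fun s => (s k : ℂ) • m s) ∈ N)
    (hN4 : ∀ j, ∀ m ∈ N, (fun s => pderiv j (m s)) ∈ N) :
    ∃ e : ℕ, powerFunction (fun k => linForm (c k))
      (C (ρ (∏ k ∈ Jᶜ, l k) ^ e) * map C (specialize J s₀ b)) ∈ N := by
  have hFu : (rename Sum.inl (∏ k, l k) : MvPolynomial (Fin n ⊕ ι) ℂ) =
      rename Sum.inl (∏ k ∈ Jᶜ, l k) * pullback J π (C (∏ k, linForm (c k))) := by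
    rw [pullback_prod_linForm hl, ← map_mul, mul_comm, Finset.prod_mul_prod_compl]
  have hFK : IsUnit (algebraMap _ M (pullback J π (C (∏ k, linForm (c k))))) := by
    rw [hFu, map_mul] at hF
    exact isUnit_of_mul_isUnit_right hF
  set u : MvPolynomial (Fin n ⊕ ι) ℂ := rename Sum.inl (∏ k ∈ Jᶜ, l k) with hu
  let Q := Submodule.span (MvPolynomial (Fin n ⊕ ι) ℂ) (sliceRel (M := M) π c N)
  let W : Submodule (MvPolynomial (Fin n ⊕ ι) ℂ) M :=
    { carrier := {m | ∃ e : ℕ, u ^ e • m ∈ Q}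
      zero_mem' := ⟨0, by rw [smul_zero]; exact zero_mem _⟩
      add_mem' := by
        rintro x y ⟨e, hx⟩ ⟨e', hy⟩
        refine ⟨e + e', ?_⟩
        rw [smul_add]
        refine add_mem ?_ ?_
        · rw [pow_add, mul_comm, mul_smul]
          exact Submodule.smul_mem _ _ hx
        · rw [pow_add, mul_smul]
          exact Submodule.smul_mem _ _ hy
      smul_mem' := by
        rintro r x ⟨e, hx⟩
        exact ⟨e, by rw [smul_comm]; exact Submodule.smul_mem _ _ hx⟩ }
  obtain ⟨e, he⟩ : algebraMap (MvPolynomial (Fin n ⊕ ι) ℂ) M (rename Sum.inr b) ∈ W := by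
    refine hb W ⟨0, ?_⟩ ?_
    · rw [pow_zero, one_smul, hFu, map_mul, ← Algebra.smul_def]
      refine Submodule.smul_mem _ _ (Submodule.subset_span
        ⟨0, C (∏ k, linForm (c k)), ?_, _, hN1, fun s => ?_⟩)
      · rw [pow_zero, one_mul]
      · rw [pow_zero, one_mul]
    · rintro i m ⟨e, hm⟩
      refine ⟨e + 1, ?_⟩
      have h1 := twisted_sliceRel_mem hl hFK hN4 i (D i) (hD1 i) (hD2 i) hm
      rw [Algebra.smul_def, hD1, pderiv_pow] at h1
      have h2 : u ^ (e + 1) • D i m = (algebraMap _ M u * (algebraMap _ M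
          (e * u ^ (e - 1) * pderiv (Sum.inl i) u) * m + algebraMap _ M (u ^ e) * D i m)) -
          (e * pderiv (Sum.inl i) u) • (u ^ e • m) := by
        simp only [Algebra.smul_def, map_mul, map_pow, map_natCast]
        rcases e with _ | e
        · simp
        · rw [Nat.add_sub_cancel, pow_succ, pow_succ]
          ring
      rw [h2]
      exact sub_mem h1 (Submodule.smul_mem _ _ hm)
  refine ⟨e, ?_⟩
  obtain ⟨L, h, hh, m, hm, hmh⟩ := exists_powerFunction_of_mem_span hρ s₀ hN2 hN3 he
  rw [Algebra.smul_def, ← map_mul, ← map_pow, ← map_mul, hinj.eq_iff] at hh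
  convert hm using 1
  funext s
  apply mul_left_cancel₀ (pow_ne_zero L (Finset.prod_ne_zero_iff.2 fun k (_ : k ∈ Finset.univ) =>
    linForm_ne_zero (hc k)))
  have h1 : restrictSlice J ρ s₀ h = C ((∏ k, linForm (c k)) ^ L) *
      (C (ρ (∏ k ∈ Jᶜ, l k) ^ e) * map C (specialize J s₀ b)) := by
    rw [← hh, map_mul, map_mul, map_pow, map_pow, restrictSlice_pullback hρ,
      restrictSlice_rename_inl, restrictSlice_rename_inr, map_pow, map_pow]
  rw [hmh, h1, powerFunction_apply, powerFunction_apply, map_mul (eval _) (C (_ ^ L)), eval_C,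
    mul_assoc]

end SliceTransferConclusion

section SliceLogarithmic
open MvPolynomial Arrangement

variable {n q : ℕ}

local notation "S" => MvPolynomial (Fin (q + 1)) ℂ

/-- Restriction of polynomials to the affine subspace through `x₀` with directions `w j`. -/
noncomputable def affineRestrict (x₀ : Fin n → ℂ) (w : Fin (q + 1) → Fin n → ℂ) :
    MvPolynomial (Fin n) ℂ →ₐ[ℂ] MvPolynomial (Fin (q + 1)) ℂ :=
  aeval fun x => C (x₀ x) + linForm fun j => w j x

theorem affineRestrict_linForm (x₀ : Fin n → ℂ) (w : Fin (q + 1) → Fin n → ℂ) (a : Fin n → ℂ) :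
    affineRestrict x₀ w (linForm a) = C (a ⬝ᵥ x₀) + linForm fun j => a ⬝ᵥ w j := by
  simp only [linForm, affineRestrict, map_sum, map_mul, aeval_X, algHom_C, algebraMap_eq, mul_add,
    Finset.sum_add_distrib, dotProduct, Finset.mul_sum, Finset.sum_mul]
  rw [Finset.sum_comm]
  simp only [mul_assoc]

theorem eval_zero_affineRestrict (x₀ : Fin n → ℂ) (w : Fin (q + 1) → Fin n → ℂ)
    (f : MvPolynomial (Fin n) ℂ) : eval 0 (affineRestrict x₀ w f) = eval x₀ f := by
  have : (aeval (0 : Fin (q + 1) → ℂ)).comp (affineRestrict x₀ w) = aeval x₀ := by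
    refine algHom_ext fun x => ?_
    simp [affineRestrict, linForm]
  exact DFunLike.congr_fun this f

theorem derivation_C_mul_apply
    (χ : Derivation ℂ (MvPolynomial (Fin n) ℂ) (MvPolynomial (Fin n) ℂ)) (a : ℂ)
    (f : MvPolynomial (Fin n) ℂ) : χ (C a * f) = C a * χ f := by
  rw [← smul_eq_C_mul, χ.map_smul, smul_eq_C_mul]

theorem derivation_linForm (χ : Derivation ℂ (MvPolynomial (Fin n) ℂ) (MvPolynomial (Fin n) ℂ))
    (a : Fin n → ℂ) : χ (linForm a) = ∑ x, C (a x) * χ (X x) := by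
  rw [linForm, map_sum]
  exact Finset.sum_congr rfl fun x _ => derivation_C_mul_apply χ _ _

/-- The components of a derivation along the forms `P j`, restricted to an affine subspace. -/
noncomputable def restrictField (x₀ : Fin n → ℂ) (w P : Fin (q + 1) → Fin n → ℂ) :
    Derivation ℂ (MvPolynomial (Fin n) ℂ) (MvPolynomial (Fin n) ℂ) →ₗ[ℂ] (Fin (q + 1) → S) where
  toFun χ j := affineRestrict x₀ w (χ (linForm (P j)))
  map_add' χ χ' := funext fun j => by simp
  map_smul' a χ := funext fun j => by simp

theorem restrictField_apply (x₀ : Fin n → ℂ) (w P : Fin (q + 1) → Fin n → ℂ)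
    (χ : Derivation ℂ (MvPolynomial (Fin n) ℂ) (MvPolynomial (Fin n) ℂ)) (j : Fin (q + 1)) :
    restrictField x₀ w P χ j = affineRestrict x₀ w (χ (linForm (P j))) := rfl

theorem restrictField_smul (x₀ : Fin n → ℂ) (w P : Fin (q + 1) → Fin n → ℂ)
    (f : MvPolynomial (Fin n) ℂ)
    (χ : Derivation ℂ (MvPolynomial (Fin n) ℂ) (MvPolynomial (Fin n) ℂ)) :
    restrictField x₀ w P (f • χ) = affineRestrict x₀ w f • restrictField x₀ w P χ :=
  funext fun j => by simp [restrictField_apply]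

variable {ι : Type} {J : Finset ι} {A : ι → Fin n → ℂ}
  {c : {k // k ∈ J} → Fin (q + 1) → ℂ} {w P : Fin (q + 1) → Fin n → ℂ} {x₀ : Fin n → ℂ}

theorem restrictField_mem_logFields (hAP : ∀ k : {k // k ∈ J}, A k = ∑ j, c k j • P j)
    (hP : ∀ i j, P i ⬝ᵥ w j = if i = j then 1 else 0) (hPx : ∀ i, P i ⬝ᵥ x₀ = 0)
    {χ : Derivation ℂ (MvPolynomial (Fin n) ℂ) (MvPolynomial (Fin n) ℂ)}
    (hχ : χ ∈ DA fun i => linForm (A i)) : restrictField x₀ w P χ ∈ logFields c := by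
  intro k
  have h1 : linForm (A k) = ∑ j, C (c k j) * linForm (P j) := by
    rw [hAP]
    simp only [linForm, Finset.sum_apply, Pi.smul_apply, smul_eq_mul, map_sum, map_mul,
      Finset.sum_mul, Finset.mul_sum]
    rw [Finset.sum_comm]
    simp only [mul_assoc]
  have h2 : ∀ j, affineRestrict x₀ w (linForm (P j)) = X j := fun j => by
    rw [affineRestrict_linForm, hPx, map_zero, zero_add, linForm]
    simp [hP]
  have h3 : affineRestrict x₀ w (linForm (A k)) = linForm (c k) := by
    rw [h1, map_sum]
    simp only [map_mul, algHom_C, algebraMap_eq, h2]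
    rfl
  have h4 := map_dvd (affineRestrict x₀ w) (Ideal.mem_span_singleton.1 (hχ k.1))
  dsimp only at h4
  rw [h3, h1, map_sum, map_sum] at h4
  simp only [derivation_C_mul_apply, map_mul, algHom_C, algebraMap_eq] at h4
  exact h4

theorem exists_restrictField_eq [Fintype ι] [DecidableEq ι]
    (hAP : ∀ k : {k // k ∈ J}, A k = ∑ j, c k j • P j)
    (hP : ∀ i j, P i ⬝ᵥ w j = if i = j then 1 else 0) (hPx : ∀ i, P i ⬝ᵥ x₀ = 0)
    {η : Fin (q + 1) → S} (hη : η ∈ logFields c) :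
    ∃ χ ∈ DA fun i => linForm (A i), restrictField x₀ w P χ =
      affineRestrict x₀ w (∏ k ∈ Jᶜ, linForm (A k)) • η := by
  let π : S →ₐ[ℂ] MvPolynomial (Fin n) ℂ := aeval fun j => linForm (P j)
  let u := ∏ k ∈ Jᶜ, linForm (A k)
  let χ : Derivation ℂ (MvPolynomial (Fin n) ℂ) (MvPolynomial (Fin n) ℂ) :=
    mkDerivation ℂ fun x => u * ∑ j, C (w j x) * π (η j)
  have hχ : ∀ a, χ (linForm a) = u * ∑ j, C (a ⬝ᵥ w j) * π (η j) := by
    intro a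
    rw [derivation_linForm]
    simp only [χ, mkDerivation_X, Finset.mul_sum, dotProduct, map_sum, map_mul, Finset.sum_mul]
    rw [Finset.sum_comm]
    exact Finset.sum_congr rfl fun j _ => Finset.sum_congr rfl fun x _ => by ring
  have hρπ : ∀ f, affineRestrict x₀ w (π f) = f := by
    intro f
    have : (affineRestrict x₀ w).comp π = AlgHom.id ℂ S := by
      refine algHom_ext fun j => ?_
      rw [AlgHom.comp_apply, aeval_X, affineRestrict_linForm, hPx, map_zero, zero_add, linForm]
      simp [hP]
    exact DFunLike.congr_fun this f
  refine ⟨χ, fun i => ?_, funext fun i => ?_⟩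
  · rw [hχ, Ideal.mem_span_singleton]
    by_cases hi : i ∈ J
    · have h1 := map_dvd π (hη ⟨i, hi⟩)
      have h2 : ∀ j, A i ⬝ᵥ w j = c ⟨i, hi⟩ j := fun j => by
        rw [hAP ⟨i, hi⟩, sum_dotProduct]
        simp [smul_dotProduct, hP]
      have h3 : π (linForm (c ⟨i, hi⟩)) = linForm (A i) := by
        rw [hAP ⟨i, hi⟩]
        simp only [linForm, π, Finset.sum_apply, Pi.smul_apply, smul_eq_mul, map_sum, map_mul,
          Finset.sum_mul, Finset.mul_sum, aeval_X, algHom_C, algebraMap_eq]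
        rw [Finset.sum_comm]
        simp only [mul_assoc]
      rw [h3, map_sum] at h1
      simp only [map_mul, algHom_C, algebraMap_eq, ← h2] at h1
      exact h1.mul_left _
    · exact (Finset.dvd_prod_of_mem _ (Finset.mem_compl.2 hi)).mul_right _
  · rw [restrictField_apply, hχ, map_mul, map_sum]
    simp only [map_mul, algHom_C, algebraMap_eq, hρπ, hP, u, Pi.smul_apply, smul_eq_mul]
    simp [ite_mul]

theorem exists_basis_card_le (L : Submodule (MvPolynomial (Fin n) ℂ)
    (Derivation ℂ (MvPolynomial (Fin n) ℂ) (MvPolynomial (Fin n) ℂ)))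
    (hL : Module.Free (MvPolynomial (Fin n) ℂ) L) :
    ∃ N ≤ n, Nonempty (Module.Basis (Fin N) (MvPolynomial (Fin n) ℂ) L) := by
  let ev : L →ₗ[MvPolynomial (Fin n) ℂ] (Fin n → MvPolynomial (Fin n) ℂ) :=
    { toFun := fun χ x => χ.1 (X x)
      map_add' := fun _ _ => rfl
      map_smul' := fun _ _ => rfl }
  have hev : Function.Injective ev := fun χ χ' h =>
    Subtype.ext (derivation_ext fun x => congrFun h x)
  have : Module.Finite (MvPolynomial (Fin n) ℂ) L := Module.Finite.of_injective ev hev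
  refine ⟨_, ?_, ⟨Module.finBasis (MvPolynomial (Fin n) ℂ) L⟩⟩
  simpa using LinearMap.finrank_le_finrank_of_injective hev

theorem exists_spanning_family {V : Type*} [AddCommGroup V] [Module ℂ V] [Module.Finite ℂ V] {m : ℕ}
    (h : Module.finrank ℂ V ≤ m) : ∃ t : Fin m → V, ∀ x, ∃ a : Fin m → ℂ, ∑ i, a i • t i = x := by
  obtain ⟨b⟩ : Nonempty (Module.Basis (Fin (Module.finrank ℂ V)) ℂ V) := ⟨Module.finBasis ℂ V⟩
  refine ⟨fun i => if h : i.1 < Module.finrank ℂ V then b ⟨i, h⟩ else 0, fun x => ?_⟩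
  refine Submodule.mem_span_range_iff_exists_fun ℂ |>.1
    ((?_ : ⊤ ≤ Submodule.span ℂ _) (Submodule.mem_top (x := x)))
  rw [← b.span_eq]
  refine Submodule.span_mono ?_
  rintro _ ⟨i, rfl⟩
  exact ⟨Fin.castLE h i, by simp⟩

theorem exists_logFields_generators [Fintype ι] [DecidableEq ι]
    (hAP : ∀ k : {k // k ∈ J}, A k = ∑ j, c k j • P j)
    (hP : ∀ i j, P i ⬝ᵥ w j = if i = j then 1 else 0) (hPx : ∀ i, P i ⬝ᵥ x₀ = 0)
    (hx₀ : ∀ k ∉ J, A k ⬝ᵥ x₀ ≠ 0) {Y : Submodule ℂ (Fin n → ℂ)}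
    (hY : Module.finrank ℂ Y + (q + 1) = n) (hYP : ∀ v ∈ Y, ∀ j, P j ⬝ᵥ v = 0)
    (hfree : Module.Free (MvPolynomial (Fin n) ℂ) (DA fun i => linForm (A i))) :
    ∃ T : Fin (q + 1) → Fin (q + 1) → S, ∀ f ∈ logFields c,
      ∃ a : Fin (q + 1) → ℂ, f - ∑ i, a i • T i ∈ maxSmulLogFields c := by
  obtain ⟨N, hN, ⟨e⟩⟩ := exists_basis_card_le (DA fun i => linForm (A i)) hfree
  let u := ∏ k ∈ Jᶜ, linForm (A k)
  have hu : eval x₀ u ≠ 0 := by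
    rw [map_prod, Finset.prod_ne_zero_iff]
    intro k hk
    rw [eval_linForm]
    exact hx₀ k (Finset.mem_compl.1 hk)
  have hred : ∀ (f : MvPolynomial (Fin n) ℂ) (η : Fin (q + 1) → S), η ∈ logFields c →
      affineRestrict x₀ w f • η - eval x₀ f • η ∈ maxSmulLogFields c := by
    intro f η hη
    have : affineRestrict x₀ w f • η - eval x₀ f • η =
        (affineRestrict x₀ w f - C (eval x₀ f)) • η := by
      rw [sub_smul]
      congr 1
      funext j
      simp [smul_eq_C_mul]
    rw [this]
    refine smul_mem_maxSmulLogFields c hη ?_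
    rw [map_sub, eval_zero_affineRestrict, eval_C, sub_self]
  have hφe : ∀ i, restrictField x₀ w P (e i).1 ∈ logFields c := fun i =>
    restrictField_mem_logFields hAP hP hPx (e i).2
  let Z := (maxSmulLogFields c).restrictScalars ℂ
  have hZ : ∀ x y, Z.mkQ x = Z.mkQ y ↔ x - y ∈ maxSmulLogFields c := fun x y =>
    Submodule.Quotient.eq Z
  let g : (Fin N → ℂ) →ₗ[ℂ] (Fin (q + 1) → S) ⧸ Z :=
    Z.mkQ ∘ₗ Fintype.linearCombination ℂ fun i => restrictField x₀ w P (e i).1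
  have hg : ∀ a, g a = Z.mkQ (∑ i, a i • restrictField x₀ w P (e i).1) := fun _ => rfl
  have hrepr : ∀ χ : DA fun i => linForm (A i), χ.1 = ∑ i, e.repr χ i • (e i).1 := by
    intro χ
    conv_lhs => rw [← e.sum_repr χ]
    rw [Submodule.coe_sum]
    rfl
  have hgen : ∀ χ : DA fun i => linForm (A i),
      g (fun i => eval x₀ (e.repr χ i)) = Z.mkQ (restrictField x₀ w P χ.1) := by
    intro χ
    rw [eq_comm, hg, hZ, hrepr χ, map_sum, ← Finset.sum_sub_distrib]
    refine Submodule.sum_mem _ fun i _ => ?_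
    rw [restrictField_smul]
    exact hred _ _ (hφe i)
  have hsurj : ∀ η ∈ logFields c, ∃ a, g a = Z.mkQ η := by
    intro η hη
    obtain ⟨χ, hχ, hχη⟩ := exists_restrictField_eq hAP hP hPx hη
    have h1 := hgen ⟨χ, hχ⟩
    refine ⟨(eval x₀ u)⁻¹ • fun i => eval x₀ (e.repr ⟨χ, hχ⟩ i), ?_⟩
    rw [map_smul, h1, inv_smul_eq_iff₀ hu, ← map_smul, hZ, hχη]
    exact hred u η hη
  let χ : (Fin n → ℂ) → Derivation ℂ (MvPolynomial (Fin n) ℂ) (MvPolynomial (Fin n) ℂ) := fun v =>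
    mkDerivation ℂ fun x => u * C (v x)
  have hχ : ∀ v a, χ v (linForm a) = u * C (a ⬝ᵥ v) := by
    intro v a
    rw [derivation_linForm, dotProduct, map_sum, Finset.mul_sum]
    refine Finset.sum_congr rfl fun x _ => ?_
    rw [mkDerivation_X, map_mul, mul_left_comm]
  have hχmem : ∀ v ∈ Y, χ v ∈ DA fun i => linForm (A i) := by
    intro v hv i
    rw [hχ, Ideal.mem_span_singleton]
    by_cases hi : i ∈ J
    · rw [hAP ⟨i, hi⟩, sum_dotProduct, Finset.sum_eq_zero fun j _ => by
        rw [smul_dotProduct, hYP v hv, smul_zero], map_zero, mul_zero]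
      exact dvd_zero _
    · exact (Finset.dvd_prod_of_mem _ (Finset.mem_compl.2 hi)).mul_right _
  let E : Y →ₗ[ℂ] (Fin N → ℂ) :=
    { toFun := fun v i => eval x₀ (e.repr ⟨χ v, hχmem v v.2⟩ i)
      map_add' := fun v v' => by
        have : (⟨χ (v + v' : Y), hχmem _ (v + v').2⟩ : DA fun i => linForm (A i)) =
            ⟨χ v, hχmem v v.2⟩ + ⟨χ v', hχmem v' v'.2⟩ :=
          Subtype.ext (derivation_ext fun x => by
            simp [χ, mkDerivation_X, mul_add])
        funext i
        rw [this, map_add, Finsupp.add_apply, map_add, Pi.add_apply]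
      map_smul' := fun a v => by
        have : (⟨χ (a • v : Y), hχmem _ (a • v).2⟩ : DA fun i => linForm (A i)) =
            (C a : MvPolynomial (Fin n) ℂ) • ⟨χ v, hχmem v v.2⟩ :=
          Subtype.ext (derivation_ext fun x => by
            simp [χ, mkDerivation_X, mul_left_comm])
        funext i
        rw [this, map_smul, Finsupp.smul_apply, smul_eq_mul, map_mul, eval_C]
        rfl }
  have hE : ∀ v, E v = fun i => eval x₀ (e.repr ⟨χ v, hχmem v v.2⟩ i) := fun _ => rfl
  have hE0 : ∀ v, g (E v) = 0 := by
    intro v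
    rw [hE, hgen, show restrictField x₀ w P (χ v) = 0 from funext fun j => ?_, map_zero]
    rw [restrictField_apply, hχ, hYP v v.2, map_zero, mul_zero, map_zero, Pi.zero_apply]
  have hEinj : Function.Injective E := by
    refine (injective_iff_map_eq_zero E).2 fun v hv => Subtype.ext (funext fun x => ?_)
    have h1 := congrArg (fun ψ : Derivation ℂ _ _ => eval x₀ (ψ (X x)))
      (hrepr ⟨χ v, hχmem v v.2⟩)
    have h2 : ∀ i, eval x₀ (e.repr ⟨χ v, hχmem v v.2⟩ i) = 0 := fun i => congrFun hv i
    have h3 : ∀ ψ : Fin N → Derivation ℂ (MvPolynomial (Fin n) ℂ) (MvPolynomial (Fin n) ℂ),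
        (∑ i, ψ i) (X x) = ∑ i, ψ i (X x) := fun ψ => by
      rw [← Derivation.coeFnAddMonoidHom_apply, map_sum, Finset.sum_apply]
      rfl
    simp only [h3] at h1
    simp only [Derivation.smul_apply, map_sum, smul_eq_mul, map_mul, h2, zero_mul,
      Finset.sum_const_zero, χ, mkDerivation_X, eval_C] at h1
    exact (mul_eq_zero.1 h1).resolve_left hu
  have hker : Module.finrank ℂ Y ≤ Module.finrank ℂ (LinearMap.ker g) :=
    LinearMap.finrank_le_finrank_of_injective (f := E.codRestrict _ hE0)
      fun _ _ h => hEinj (congrArg Subtype.val h)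
  have hrange : Module.finrank ℂ (LinearMap.range g) ≤ q + 1 := by
    have := g.finrank_range_add_finrank_ker
    rw [Module.finrank_fin_fun] at this
    omega
  obtain ⟨t, ht⟩ := exists_spanning_family hrange
  choose T hT using fun i => Z.mkQ_surjective (t i).1
  refine ⟨T, fun f hf => ?_⟩
  obtain ⟨a, ha⟩ := hsurj f hf
  obtain ⟨b, hb⟩ := ht ⟨_, LinearMap.mem_range_self g a⟩
  refine ⟨b, ?_⟩
  rw [← hZ, ← ha, map_sum]
  simp only [map_smul, hT]
  simpa using (congrArg Subtype.val hb).symm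

end SliceLogarithmic

section SliceGeometry
open MvPolynomial Arrangement

variable {n q : ℕ} {ι : Type} {J : Finset ι} {A : ι → Fin n → ℂ}

theorem toLin_linForm (a v : Fin n → ℂ) : toLin (linForm a) v = a ⬝ᵥ v := by
  simp [toLin, coeff_single_linForm, dotProduct]

theorem mem_hyp_linForm (k : ι) (v : Fin n → ℂ) :
    v ∈ hyp (fun i => linForm (A i)) k ↔ A k ⬝ᵥ v = 0 := by
  rw [hyp, LinearMap.mem_ker, toLin_linForm]

theorem dotProduct_single_eq (f : (Fin n → ℂ) →ₗ[ℂ] ℂ) (v : Fin n → ℂ) :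
    (fun x => f (Pi.single x 1)) ⬝ᵥ v = f v := by
  rw [LinearMap.pi_apply_eq_sum_univ f v, dotProduct]
  refine Finset.sum_congr rfl fun x _ => ?_
  rw [smul_eq_mul, mul_comm]
  congr 2
  funext y
  simp [Pi.single_apply, eq_comm]

theorem exists_slice [Finite ι] {Y : Submodule ℂ (Fin n → ℂ)}
    (hYJ : ∀ v ∈ Y, ∀ k ∈ J, A k ⬝ᵥ v = 0)
    (hJ : ∀ k ∉ J, ∃ v ∈ Y, A k ⬝ᵥ v ≠ 0) (hq : Module.finrank ℂ Y + (q + 1) = n) :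
    ∃ (x₀ : Fin n → ℂ) (w P : Fin (q + 1) → Fin n → ℂ),
      (∀ i j, P i ⬝ᵥ w j = if i = j then 1 else 0) ∧ (∀ v ∈ Y, ∀ j, P j ⬝ᵥ v = 0) ∧ x₀ ∈ Y ∧
      (∀ k ∉ J, A k ⬝ᵥ x₀ ≠ 0) ∧ ∀ k ∈ J, A k = ∑ j, (A k ⬝ᵥ w j) • P j := by
  obtain ⟨x₀, hx₀, hx₀'⟩ := Module.Dual.exists_forall_mem_ne_zero_of_forall_exists (K := ℂ) Y
    (fun k : {k // k ∉ J} => toLin (linForm (A k))) fun k => by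
      simpa only [toLin_linForm] using hJ k.1 k.2
  obtain ⟨U, hU⟩ := Y.exists_isCompl
  have hUr : Module.finrank ℂ U = q + 1 := by
    have := Submodule.finrank_add_eq_of_isCompl hU
    rw [Module.finrank_fin_fun] at this
    omega
  let b := Module.finBasisOfFinrankEq ℂ U hUr
  let P : Fin (q + 1) → Fin n → ℂ := fun j x =>
    (b.coord j ∘ₗ U.projectionOnto Y hU.symm) (Pi.single x 1)
  have hP : ∀ j v, P j ⬝ᵥ v = b.coord j (U.projectionOnto Y hU.symm v) := fun j v =>
    dotProduct_single_eq _ v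
  refine ⟨x₀, fun j => b j, P, fun i j => ?_, fun v hv j => ?_, hx₀, fun k hk => ?_,
    fun k hk => ?_⟩
  · rw [hP, Submodule.projectionOnto_apply_left, Module.Basis.coord_apply, Module.Basis.repr_self,
      Finsupp.single_apply]
    simp only [eq_comm]
  · rw [hP, (Submodule.projectionOnto_apply_eq_zero_iff hU.symm).2 hv, map_zero]
  · simpa only [toLin_linForm] using hx₀' ⟨k, hk⟩
  · refine dotProduct_eq _ _ fun v => ?_
    have h1 : v - (U.projectionOnto Y hU.symm v : Fin n → ℂ) ∈ Y := by
      rw [← Submodule.projectionOnto_apply_eq_zero_iff hU.symm, map_sub,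
        Submodule.projectionOnto_apply_left, sub_self]
    have h2 := hYJ _ h1 k hk
    rw [dotProduct_sub, sub_eq_zero] at h2
    change A k ⬝ᵥ v = _ ⬝ᵥ v
    rw [h2, sum_dotProduct]
    conv_lhs => rw [← b.sum_repr (U.projectionOnto Y hU.symm v)]
    rw [Submodule.coe_sum, dotProduct_sum]
    refine Finset.sum_congr rfl fun j _ => ?_
    rw [smul_dotProduct, hP, Submodule.coe_smul, dotProduct_smul, smul_eq_mul, smul_eq_mul,
      Module.Basis.coord_apply, mul_comm]

variable {c : {k // k ∈ J} → Fin (q + 1) → ℂ} {w P : Fin (q + 1) → Fin n → ℂ}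

theorem coeff_dotProduct_eq (hAP : ∀ k : {k // k ∈ J}, A k = ∑ j, c k j • P j)
    (k : {k // k ∈ J}) (v : Fin n → ℂ) : A k ⬝ᵥ v = c k ⬝ᵥ fun j => P j ⬝ᵥ v := by
  rw [hAP, sum_dotProduct]
  simp only [smul_dotProduct, smul_eq_mul]
  rfl

theorem dotProduct_sum_smul (hP : ∀ i j, P i ⬝ᵥ w j = if i = j then 1 else 0)
    (y : Fin (q + 1) → ℂ) (i : Fin (q + 1)) : P i ⬝ᵥ (∑ j, y j • w j) = y i := by
  rw [dotProduct_sum]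
  simp [dotProduct_smul, hP]

theorem eq_zero_of_dotProduct_eq_zero (hAP : ∀ k : {k // k ∈ J}, A k = ∑ j, c k j • P j)
    (hP : ∀ i j, P i ⬝ᵥ w j = if i = j then 1 else 0) {Y : Submodule ℂ (Fin n → ℂ)}
    (hY : ∀ v, (∀ k ∈ J, A k ⬝ᵥ v = 0) → v ∈ Y) (hYP : ∀ v ∈ Y, ∀ j, P j ⬝ᵥ v = 0)
    (y : Fin (q + 1) → ℂ) (hy : ∀ k, c k ⬝ᵥ y = 0) : y = 0 := by
  have h1 : ∑ j, y j • w j ∈ Y := hY _ fun k hk => by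
    have := coeff_dotProduct_eq hAP ⟨k, hk⟩ (∑ j, y j • w j)
    simp only [dotProduct_sum_smul hP] at this
    rw [this]
    exact hy _
  funext i
  rw [← dotProduct_sum_smul hP y i, hYP _ h1, Pi.zero_apply]

theorem not_reducible_of_irredOn (hAP : ∀ k : {k // k ∈ J}, A k = ∑ j, c k j • P j)
    (hP : ∀ i j, P i ⬝ᵥ w j = if i = j then 1 else 0) (hJ : IrredOn (fun i => linForm (A i)) J)
    (V₁ V₂ : Submodule ℂ (Fin (q + 1) → ℂ)) (hV : IsCompl V₁ V₂)
    (h : ∀ k, (∀ y ∈ V₁, c k ⬝ᵥ y = 0) ∨ ∀ y ∈ V₂, c k ⬝ᵥ y = 0)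
    (h₁ : ∃ k, ∀ y ∈ V₁, c k ⬝ᵥ y = 0) : ¬ ∃ k, ∀ y ∈ V₂, c k ⬝ᵥ y = 0 := by
  rintro ⟨k₂, hk₂⟩
  obtain ⟨k₁, hk₁⟩ := h₁
  let W : (Fin (q + 1) → ℂ) →ₗ[ℂ] (Fin n → ℂ) := Fintype.linearCombination ℂ w
  let p : (Fin n → ℂ) →ₗ[ℂ] (Fin (q + 1) → ℂ) := LinearMap.pi fun j => toLin (linForm (P j))
  have hp : ∀ v, p v = fun j => P j ⬝ᵥ v := fun v => funext fun j => toLin_linForm _ _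
  have hpW : ∀ y, p (W y) = y := fun y => by
    rw [hp]
    exact funext fun i => dotProduct_sum_smul hP y i
  have hA : ∀ (k : {k // k ∈ J}) v, A k ⬝ᵥ v = c k ⬝ᵥ p v := fun k v => by
    rw [hp, coeff_dotProduct_eq hAP]
  have h1 : ∀ k : {k // k ∈ J}, (∀ y ∈ V₁, c k ⬝ᵥ y = 0) →
      V₁.map W ≤ hyp (fun i => linForm (A i)) k := by
    rintro k hk _ ⟨y, hy, rfl⟩
    rw [mem_hyp_linForm, hA, hpW]
    exact hk y hy
  have h2 : ∀ k : {k // k ∈ J}, (∀ y ∈ V₂, c k ⬝ᵥ y = 0) →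
      V₂.comap p ≤ hyp (fun i => linForm (A i)) k := by
    intro k hk v hv
    rw [mem_hyp_linForm, hA]
    exact hk _ hv
  refine hJ ⟨V₁.map W, V₂.comap p, ⟨?_, ?_⟩, fun k hk => ?_, ⟨k₁, k₁.2, h1 k₁ hk₁⟩,
    k₂, k₂.2, h2 k₂ hk₂⟩
  · rw [Submodule.disjoint_def]
    rintro _ ⟨y, hy, rfl⟩ hy'
    rw [Submodule.mem_comap, hpW] at hy'
    rw [Submodule.disjoint_def.1 hV.disjoint y hy hy', map_zero]
  · rw [codisjoint_iff, eq_top_iff]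
    rintro v -
    obtain ⟨y₁, hy₁, y₂, hy₂, hy⟩ := Submodule.mem_sup.1
      ((codisjoint_iff.1 hV.codisjoint).ge (Submodule.mem_top (x := p v)))
    refine Submodule.mem_sup.2 ⟨W y₁, ⟨y₁, hy₁, rfl⟩, v - W y₁, ?_, by abel⟩
    rw [Submodule.mem_comap, map_sub, hpW, ← hy, add_sub_cancel_left]
    exact hy₂
  · exact (h ⟨k, hk⟩).imp (h1 ⟨k, hk⟩) (h2 ⟨k, hk⟩)

end SliceGeometry

section BernsteinFactor
open MvPolynomial Arrangement

variable {n : ℕ} {ι : Type}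

theorem eval_specialize {J : Finset ι} (s₀ : ι → ℂ) (b : MvPolynomial ι ℂ) :
    eval (fun k : {k // k ∈ J} => s₀ k) (specialize J s₀ b) = eval s₀ b := by
  have : (aeval fun k : {k // k ∈ J} => s₀ k).comp (specialize J s₀) = aeval s₀ := by
    refine algHom_ext fun k => ?_
    rw [AlgHom.comp_apply, specialize, aeval_X, aeval_X]
    split_ifs
    · rw [aeval_X]
    · rw [aeval_C]
      rfl
  exact DFunLike.congr_fun this b

variable [Fintype ι]

theorem algebraMap_mem_of_mem_Bideal {l : ι → MvPolynomial (Fin n) ℂ}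
    {D : Fin n → Module.End ℂ
      (Localization.Away (rename Sum.inl (∏ i, l i) : MvPolynomial (Fin n ⊕ ι) ℂ))}
    {b : MvPolynomial ι ℂ} (hb : b ∈ Bideal l D)
    (W : Submodule (MvPolynomial (Fin n ⊕ ι) ℂ)
      (Localization.Away (rename Sum.inl (∏ i, l i) : MvPolynomial (Fin n ⊕ ι) ℂ)))
    (hW : algebraMap (MvPolynomial (Fin n ⊕ ι) ℂ) _ (rename Sum.inl (∏ i, l i)) ∈ W)
    (hWD : ∀ i, ∀ m ∈ W, D i m ∈ W) :
    algebraMap (MvPolynomial (Fin n ⊕ ι) ℂ) _ (rename Sum.inr b) ∈ W := by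
  obtain ⟨Q, hQ, hb⟩ := hb
  rw [hb]
  have : ∀ m ∈ W, Q m ∈ W := by
    refine Algebra.adjoin_induction (p := fun Q _ => ∀ m ∈ W, Q m ∈ W) ?_ ?_ ?_ ?_ hQ
    · rintro _ ((⟨i, rfl⟩ | ⟨i, rfl⟩) | ⟨i, rfl⟩) m hm
      · rw [LinearMap.mulLeft_apply, ← Algebra.smul_def]
        exact W.smul_mem _ hm
      · rw [LinearMap.mulLeft_apply, ← Algebra.smul_def]
        exact W.smul_mem _ hm
      · exact hWD i m hm
    · intro a m hm
      rw [Module.algebraMap_end_apply, ← algebraMap_smul (MvPolynomial (Fin n ⊕ ι) ℂ) a m]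
      exact W.smul_mem _ hm
    · exact fun Q Q' _ _ hQ hQ' m hm => W.add_mem (hQ m hm) (hQ' m hm)
    · exact fun Q Q' _ _ hQ hQ' m hm => hQ _ (hQ' m hm)
  exact this _ hW

theorem mem_JX {l : ι → MvPolynomial (Fin n) ℂ} {Y : Submodule ℂ (Fin n → ℂ)} {k : ι} :
    k ∈ JX l Y ↔ Y ≤ hyp l k := by
  simp [JX]

theorem exists_eq_iInf_of_mem_LA {l : ι → MvPolynomial (Fin n) ℂ} {Y : Submodule ℂ (Fin n → ℂ)}
    (hY : Y ∈ LA l) : ∃ I : Finset ι, I.Nonempty ∧ ⨅ i ∈ I, hyp l i = Y := by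
  simpa [LA] using hY

theorem iInf_JX_of_mem_LA {l : ι → MvPolynomial (Fin n) ℂ} {Y : Submodule ℂ (Fin n → ℂ)}
    (hY : Y ∈ LA l) : ⨅ i ∈ JX l Y, hyp l i = Y := by
  obtain ⟨I, -, rfl⟩ := exists_eq_iInf_of_mem_LA hY
  refine le_antisymm ?_ (le_iInf₂ fun i hi => mem_JX.1 hi)
  exact biInf_mono fun i hi => mem_JX.2 (iInf₂_le i hi)

theorem JX_nonempty_of_mem_LA {l : ι → MvPolynomial (Fin n) ℂ} {Y : Submodule ℂ (Fin n → ℂ)}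
    (hY : Y ∈ LA l) : (JX l Y).Nonempty := by
  obtain ⟨I, ⟨i, hi⟩, rfl⟩ := exists_eq_iInf_of_mem_LA hY
  exact ⟨i, mem_JX.2 (iInf₂_le i hi)⟩

variable {A : ι → Fin n → ℂ}

theorem eval_eq_zero_of_mem_Bideal (hA : ∀ i, A i ≠ 0)
    (hprop : ∀ i j, i ≠ j → ∀ t : ℂ, A i ≠ t • A j)
    (hfree : Module.Free (MvPolynomial (Fin n) ℂ) (DA fun i => linForm (A i)))
    {D : Fin n → Module.End ℂ
      (Localization.Away (rename Sum.inl (∏ i, linForm (A i)) : MvPolynomial (Fin n ⊕ ι) ℂ))}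
    (hD : IsTwisted (fun i => linForm (A i)) D) {b : MvPolynomial ι ℂ}
    (hb : b ∈ Bideal (fun i => linForm (A i)) D) {Y : Submodule ℂ (Fin n → ℂ)}
    (hY : Y ∈ Lprime fun i => linForm (A i)) {j : ℕ}
    (hj : j ≤ 2 * ((JX (fun i => linForm (A i)) Y).card - rX Y)) {s₀ : ι → ℂ}
    (hs₀ : ∑ i ∈ JX (fun i => linForm (A i)) Y, s₀ i + ((rX Y : ℂ) + j) = 0) :
    eval s₀ b = 0 := by
  classical
  obtain ⟨hYL, hirr⟩ := Finset.mem_filter.1 hY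
  set J := JX (fun i => linForm (A i)) Y with hJdef
  have hYJ : ∀ v ∈ Y, ∀ k ∈ J, A k ⬝ᵥ v = 0 := fun v hv k hk =>
    (mem_hyp_linForm k v).1 (mem_JX.1 hk hv)
  have hJY : ∀ k ∉ J, ∃ v ∈ Y, A k ⬝ᵥ v ≠ 0 := by
    intro k hk
    obtain ⟨v, hv, hv'⟩ := SetLike.not_le_iff_exists.1 (mt mem_JX.2 hk)
    exact ⟨v, hv, mt (mem_hyp_linForm k v).2 hv'⟩
  have hYmem : ∀ v, (∀ k ∈ J, A k ⬝ᵥ v = 0) → v ∈ Y := by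
    intro v hv
    rw [← iInf_JX_of_mem_LA hYL]
    simp only [Submodule.mem_iInf]
    exact fun k hk => (mem_hyp_linForm k v).2 (hv k hk)
  have hYtop : Y ≠ ⊤ := by
    rintro rfl
    obtain ⟨k, hk⟩ := JX_nonempty_of_mem_LA hYL
    exact hA k (dotProduct_eq _ _ fun v => by
      rw [hYJ v Submodule.mem_top k hk, zero_dotProduct])
  have hlt : Module.finrank ℂ Y < n := by
    simpa using Submodule.finrank_lt hYtop
  obtain ⟨q, hq⟩ : ∃ q, Module.finrank ℂ Y + (q + 1) = n :=
    ⟨n - Module.finrank ℂ Y - 1, by omega⟩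
  have hr : rX Y = q + 1 := by
    rw [rX]
    omega
  rw [hr] at hj hs₀
  obtain ⟨x₀, w, P, hP, hYP, hx₀Y, hx₀, hAP⟩ := exists_slice hYJ hJY hq
  let c : {k // k ∈ J} → Fin (q + 1) → ℂ := fun k i => A k ⬝ᵥ w i
  replace hAP : ∀ k : {k // k ∈ J}, A k = ∑ i, c k i • P i := fun k => hAP k k.2
  have hPx : ∀ i, P i ⬝ᵥ x₀ = 0 := hYP x₀ hx₀Y
  obtain ⟨T, hT⟩ := exists_logFields_generators hAP hP hPx hx₀ hq hYP hfree
  have hc : ∀ k, c k ≠ 0 := fun k hk => hA k (by rw [hAP, hk]; simp)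
  have hcprop : ∀ k k', k ≠ k' → ∀ t : ℂ, c k ≠ t • c k' := fun k k' hkk t h =>
    hprop k k' (fun h => hkk (Subtype.ext h)) t (by
      rw [hAP, hAP k', h, Finset.smul_sum]
      simp only [Pi.smul_apply, smul_eq_mul, mul_smul])
  let ρ := affineRestrict x₀ w
  have hρ : ∀ i, ρ (linForm (P i)) = X i := fun i => by
    rw [affineRestrict_linForm, hPx, map_zero, zero_add, linForm]
    simp [hP]
  have hl : ∀ k : {k // k ∈ J}, aeval (fun i => linForm (P i)) (linForm (c k)) =
      linForm (A k) := by
    intro k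
    rw [hAP]
    simp only [linForm, map_sum, map_mul, aeval_X, algHom_C, algebraMap_eq, Finset.sum_apply,
      Pi.smul_apply, smul_eq_mul, Finset.sum_mul, Finset.mul_sum]
    rw [Finset.sum_comm]
    simp only [mul_assoc]
  let F : MvPolynomial (Fin n ⊕ ι) ℂ := rename Sum.inl (∏ i, linForm (A i))
  have hF0 : F ≠ 0 := by
    rw [Ne, map_eq_zero_iff _ (rename_injective _ Sum.inl_injective), Finset.prod_eq_zero_iff]
    rintro ⟨i, -, hi⟩
    exact linForm_ne_zero (hA i) hi
  let closed : AddSubgroup (({k // k ∈ J} → ℕ) → MvPolynomial (Fin (q + 1)) ℂ) → Prop := fun N =>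
    powerFunction (fun k => linForm (c k)) (C (∏ k, linForm (c k))) ∈ N ∧
    (∀ f, ∀ m ∈ N, (fun s => f * m s) ∈ N) ∧ (∀ k, ∀ m ∈ N, (fun s => (s k : ℂ) • m s) ∈ N) ∧
    ∀ i, ∀ m ∈ N, (fun s => pderiv i (m s)) ∈ N
  let N₀ := sInf {N | closed N}
  have hN₀ : ∀ m, m ∈ N₀ ↔ ∀ N, closed N → m ∈ N := fun m => AddSubgroup.mem_sInf
  obtain ⟨e, he⟩ := exists_powerFunction_mem (J := J) (N := N₀)
    (M := Localization.Away F) hl hc hρ s₀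
    (IsLocalization.injective _ (powers_le_nonZeroDivisors_of_noZeroDivisors hF0))
    (IsLocalization.Away.algebraMap_isUnit F) (fun i => (D i).toAddMonoidHom)
    (fun i r m => hD.1 i r m) (fun i => by convert hD.2 i; rfl) b
    (fun W hW hWD => algebraMap_mem_of_mem_Bideal hb W hW hWD)
    ((hN₀ _).2 fun N hN => hN.1)
    (fun f m hm => (hN₀ _).2 fun N hN => hN.2.1 f m ((hN₀ m).1 hm N hN))
    (fun k m hm => (hN₀ _).2 fun N hN => hN.2.2.1 k m ((hN₀ m).1 hm N hN))
    (fun i m hm => (hN₀ _).2 fun N hN => hN.2.2.2 i m ((hN₀ m).1 hm N hN))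
  rw [← eval_specialize (J := J)]
  refine eval_eq_zero_of_powerFunction_mem hc hcprop
    (eq_zero_of_dotProduct_eq_zero hAP hP hYmem hYP) (not_reducible_of_irredOn hAP hP hirr)
    T hT (j := j) ?_ ?_ (v := ρ (∏ k ∈ Jᶜ, linForm (A k)) ^ e) ?_ _
    fun N h1 h2 h3 h4 => (hN₀ _).1 he N ⟨h1, h2, h3, h4⟩
  · rw [Finset.sum_coe_sort J s₀, ← hs₀]
    push_cast
    ring
  · rwa [Fintype.card_coe]
  · rw [← constantCoeff_eq, ← eval_zero, map_pow, eval_zero_affineRestrict, map_prod]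
    refine pow_ne_zero _ (Finset.prod_ne_zero_iff.2 fun k hk => ?_)
    rw [eval_linForm]
    exact hx₀ k (Finset.mem_compl.1 hk)

end BernsteinFactor

section AffineDivisor

open MvPolynomial

theorem dvd_of_eval_eq_zero_of_dotProduct {σ : Type*} [Fintype σ] {c : σ → ℂ} (hc : c ≠ 0) {a : ℂ}
    {b : MvPolynomial σ ℂ} (h : ∀ s : σ → ℂ, c ⬝ᵥ s + a = 0 → eval s b = 0) :
    linForm c + C a ∣ b := by
  classical
  obtain ⟨k, hk⟩ := Function.ne_iff.1 hc
  rw [Pi.zero_apply] at hk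
  let u : σ → ℂ := Pi.single k (c k)⁻¹
  have hu : c ⬝ᵥ u = 1 := by
    simp [u, hk]
  let φ : MvPolynomial σ ℂ →ₐ[ℂ] MvPolynomial σ ℂ :=
    aeval fun i => X i - C (u i) * (linForm c + C a)
  have hφ0 : φ b = 0 := by
    refine MvPolynomial.funext fun x => ?_
    have hx : eval x (φ b) = eval (x - (c ⬝ᵥ x + a) • u) b := by
      have : (eval x).comp (φ : MvPolynomial σ ℂ →+* MvPolynomial σ ℂ) =
          eval (x - (c ⬝ᵥ x + a) • u) := by
        refine MvPolynomial.ringHom_ext (fun z => by simp) fun i => ?_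
        simp [φ, eval_linForm, dotProduct]
        ring
      exact DFunLike.congr_fun this b
    rw [hx, map_zero]
    refine h _ ?_
    rw [dotProduct_sub, dotProduct_smul, hu, smul_eq_mul]
    ring
  have hcomp : (Ideal.Quotient.mkₐ ℂ (Ideal.span {linForm c + C a})).comp φ =
      Ideal.Quotient.mkₐ ℂ (Ideal.span {linForm c + C a}) := by
    refine MvPolynomial.algHom_ext fun i => ?_
    simp only [AlgHom.comp_apply, φ, aeval_X, Ideal.Quotient.mkₐ_eq_mk]
    rw [Ideal.Quotient.eq, sub_sub_cancel_left, neg_mem_iff]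
    exact Ideal.mul_mem_left _ _ (Ideal.mem_span_singleton_self _)
  have hb := DFunLike.congr_fun hcomp b
  rw [AlgHom.comp_apply, hφ0, map_zero, Ideal.Quotient.mkₐ_eq_mk] at hb
  exact Ideal.mem_span_singleton.1 (Ideal.Quotient.eq_zero_iff_mem.1 hb.symm)

end AffineDivisor

section BernsteinDivisor

open MvPolynomial Arrangement

open Classical in
theorem indicator_ne_zero {σ : Type*} {J : Finset σ} (hJ : J.Nonempty) :
    (fun i => if i ∈ J then (1 : ℂ) else 0) ≠ 0 := by
  obtain ⟨i, hi⟩ := hJ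
  exact fun h => by simpa [hi] using congrFun h i

variable {n : ℕ} {ι : Type} [Fintype ι]

open Classical in
theorem sum_X_eq_linForm_indicator (J : Finset ι) :
    (∑ i ∈ J, X i : MvPolynomial ι ℂ) = linForm fun i => if i ∈ J then 1 else 0 := by
  simp [linForm, apply_ite C, ite_mul, Finset.sum_ite_mem]

theorem eq_of_associated_sum_X_add_C {J J' : Finset ι} (hJ : J.Nonempty)
    {a a' : ℂ} (h : Associated (∑ i ∈ J, X i + C a : MvPolynomial ι ℂ) (∑ i ∈ J', X i + C a')) :
    J = J' ∧ a = a' := by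
  classical
  rw [sum_X_eq_linForm_indicator, sum_X_eq_linForm_indicator] at h
  obtain ⟨t, ht, hc, ha⟩ := associated_linForm_add_C h
  have hmem : ∀ i, i ∈ J ↔ i ∈ J' := by
    intro i
    have := congrFun hc i
    by_cases h1 : i ∈ J <;> by_cases h2 : i ∈ J' <;> simp_all
  obtain ⟨i, hi⟩ := hJ
  have := congrFun hc i
  have ht1 : t = 1 := by
    simpa [hi, (hmem i).1 hi, eq_comm] using this
  exact ⟨Finset.ext hmem, by rw [ha, ht1, one_mul]⟩

theorem irreducible_sum_X_add_C {J : Finset ι} (hJ : J.Nonempty) (a : ℂ) :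
    Irreducible (∑ i ∈ J, X i + C a : MvPolynomial ι ℂ) := by
  classical
  rw [sum_X_eq_linForm_indicator]
  exact irreducible_linForm_add_C (indicator_ne_zero hJ) a

theorem sum_X_add_C_dvd {J : Finset ι} (hJ : J.Nonempty) {a : ℂ} {b : MvPolynomial ι ℂ}
    (h : ∀ s : ι → ℂ, ∑ i ∈ J, s i + a = 0 → eval s b = 0) :
    (∑ i ∈ J, X i + C a : MvPolynomial ι ℂ) ∣ b := by
  classical
  rw [sum_X_eq_linForm_indicator]
  refine dvd_of_eval_eq_zero_of_dotProduct (indicator_ne_zero hJ) fun s hs => h s ?_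
  simpa [dotProduct, Finset.sum_ite_mem] using hs

theorem bGen_dvd_of_forall_eval_eq_zero {l : ι → MvPolynomial (Fin n) ℂ} {b : MvPolynomial ι ℂ}
    (h : ∀ Y ∈ Lprime l, ∀ j ≤ 2 * ((JX l Y).card - rX Y), ∀ s : ι → ℂ,
      ∑ i ∈ JX l Y, s i + ((rX Y : ℂ) + j) = 0 → eval s b = 0) : bGen l ∣ b := by
  classical
  have hL : ∀ Y ∈ Lprime l, Y ∈ LA l := fun Y hY => (Finset.mem_filter.1 hY).1
  rw [bGen, Finset.prod_sigma']
  refine Finset.prod_dvd_of_isRelPrime ?_ ?_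
  · rintro ⟨Y, j⟩ hx ⟨Y', j'⟩ hx' hne
    have hY := hL Y (Finset.mem_sigma.1 hx).1
    have hY' := hL Y' (Finset.mem_sigma.1 hx').1
    have hJ := JX_nonempty_of_mem_LA hY
    have hJ' := JX_nonempty_of_mem_LA hY'
    refine ((irreducible_sum_X_add_C hJ _).isRelPrime_iff_not_dvd).2 fun hdvd => hne ?_
    obtain ⟨h1, h2⟩ := eq_of_associated_sum_X_add_C hJ
      ((irreducible_sum_X_add_C hJ _).associated_of_dvd (irreducible_sum_X_add_C hJ' _) hdvd)
    have hYY : Y = Y' := by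
      rw [← iInf_JX_of_mem_LA hY, ← iInf_JX_of_mem_LA hY', h1]
    subst hYY
    obtain rfl : j = j' := Nat.cast_injective (R := ℂ) (add_left_cancel h2)
    rfl
  · rintro ⟨Y, j⟩ hx
    obtain ⟨hY, hj⟩ := Finset.mem_sigma.1 hx
    replace hj : j < 2 * ((JX l Y).card - rX Y) + 1 := Finset.mem_range.1 hj
    exact sum_X_add_C_dvd (JX_nonempty_of_mem_LA (hL Y hY)) (h Y hY j (by omega))

end BernsteinDivisor

open Arrangement in
/-- If the central arrangement defined by `l₁,…,l_p` is free, then every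
element of the Bernstein ideal is divisible by
`b_de = ∏_{X ∈ L'(A)} ∏_{j=0}^{2(card J(X) − r(X))} ((∑_{i ∈ J(X)} sᵢ) + r(X) + j)`. -/
theorem bGen_dvd_of_mem_bernstein_ideal
    (n p : ℕ) (hp : 1 ≤ p) (l : Fin p → MvPolynomial (Fin n) ℂ)
    (hl0 : ∀ i, l i ≠ 0) (hlh : ∀ i, (l i).IsHomogeneous 1)
    (hprop : ∀ i j, i ≠ j → ∀ c : ℂ, l i ≠ c • l j)
    (hfree : Module.Free (MvPolynomial (Fin n) ℂ) (DA l))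
    (D : Fin n → Module.End ℂ
      (Localization.Away (rename Sum.inl (∏ i, l i) : MvPolynomial (Fin n ⊕ Fin p) ℂ)))
    (hD : IsTwisted l D) :
    ∀ b ∈ Bideal l D, bGen l ∣ b := by
  intro b hb
  choose A hA using fun i => exists_linForm_eq (hlh i)
  obtain rfl : l = fun i => linForm (A i) := _root_.funext hA
  refine bGen_dvd_of_forall_eval_eq_zero fun Y hY j hj s hs =>
    eval_eq_zero_of_mem_Bideal (fun i h => hl0 i ?_) (fun i k hik t h => hprop i k hik t ?_)
      hfree hD hb hY hj hs
  · simp [h, linForm]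
  · simp [h, linForm, Finset.smul_sum, smul_eq_C_mul, mul_assoc]
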